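/- Let n ≥ 1, p ∈ [1/2,∞], p₁,p₂ ∈ [1,∞], and a,a₁,a₂ ≥ 0 satisfy 1/p = 1/p₁ + 1/p₂ and a/p = a₁/p₁ + a₂/p₂. Suppose s > max{1, n(1/p − 1)} or s ∈ 2ℕ. Then there exists C > 0, depending only on n, s, p, p₁, p₂, a₁, a₂, such that for all f, g ∈ 𝒮(ℝⁿ): ‖J^s(fg) − f·(J^s g) + s ∇f·∇(J^{s−2} g)‖_{L^p_{⟨x⟩^a}} ≤ C ( ‖J^s f‖_{L^{p₁}_{⟨x⟩^{a₁}}} ‖g‖_{L^{p₂}_{⟨x⟩^{a₂}}} + ‖∇f‖_{L^{p₁}_{⟨x⟩^{a₁}}} ‖J^{s−1} g‖_{L^{p₂}_{⟨x⟩^{a₂}}} ). -/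

import Mathlib

open MeasureTheory Real Complex
open scoped ENNReal NNReal RealInnerProductSpace

noncomputable section

abbrev Eu (n : ℕ) := EuclideanSpace ℝ (Fin n)

/-- The polynomial weight `⟨x⟩^a = (1+|x|²)^{a/2}` as an `ℝ≥0∞`-valued function. -/
def jweight {n : ℕ} (a : ℝ) (x : Eu n) : ℝ≥0∞ :=
  ENNReal.ofReal ((1 + ‖x‖ ^ 2) ^ (a / 2))

/-- Weighted Lebesgue (quasi-)norm `‖f‖_{L^p_{⟨x⟩^a}}`; for `p = ∞` the essential sup norm. -/
def wNorm {n : ℕ} {F : Type*} [NormedAddCommGroup F] (p : ℝ≥0∞) (a : ℝ)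
    (f : Eu n → F) : ℝ≥0∞ :=
  if p = ∞ then essSup (fun x => (‖f x‖₊ : ℝ≥0∞)) volume
  else (∫⁻ x, (‖f x‖₊ : ℝ≥0∞) ^ p.toReal * jweight a x) ^ (1 / p.toReal)

/-- The Fourier transform `f̂(ξ) = ∫ f(x) e^{-i x·ξ} dx`. -/
def FT {n : ℕ} (f : Eu n → ℂ) (ξ : Eu n) : ℂ :=
  ∫ x, f x * Complex.exp (-(Complex.I * ((⟪x, ξ⟫ : ℝ) : ℂ)))

/-- The inhomogeneous fractional derivative (Bessel potential) `J^s`. -/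
def Js {n : ℕ} (s : ℝ) (f : Eu n → ℂ) (x : Eu n) : ℂ :=
  ((((2 * Real.pi) ^ n)⁻¹ : ℝ) : ℂ) *
    ∫ ξ, (((1 + ‖ξ‖ ^ 2) ^ (s / 2) : ℝ) : ℂ) * FT f ξ *
      Complex.exp (Complex.I * ((⟪x, ξ⟫ : ℝ) : ℂ))

/-- The Euclidean norm `|∇f|(x)` of the gradient of a complex-valued function. -/
def gradNorm {n : ℕ} (f : Eu n → ℂ) (x : Eu n) : ℝ :=
  Real.sqrt (∑ j : Fin n, ‖fderiv ℝ f x (EuclideanSpace.single j 1)‖ ^ 2)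

/-- The "dot product" of gradients `∇f·∇g = Σ_j (∂_j f)(∂_j g)`. -/
def gradDot {n : ℕ} (f g : Eu n → ℂ) (x : Eu n) : ℂ :=
  ∑ j : Fin n, fderiv ℝ f x (EuclideanSpace.single j 1) *
    fderiv ℝ g x (EuclideanSpace.single j 1)

section KP
open scoped FourierTransform SchwartzMap LineDeriv ContDiff
variable {n : ℕ}

abbrev Sw (n : ℕ) := SchwartzMap (Eu n) ℂ


/-- Fourier multiplier. -/
def mu (m : Eu n → ℂ) (f : Sw n) : Sw n := SchwartzMap.fourierMultiplierCLM ℂ m f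

/-- Bessel symbol in Mathlib's normalisation. -/
def br (s : ℝ) (ξ : Eu n) : ℂ := (((1 + (2 * π) ^ 2 * ‖ξ‖ ^ 2) ^ (s / 2) : ℝ) : ℂ)

/-- product of Schwartz functions -/
def mulS (f g : Sw n) : Sw n := SchwartzMap.pairing (ContinuousLinearMap.mul ℂ ℂ) f g

@[simp] lemma mulS_apply (f g : Sw n) (x : Eu n) : mulS f g x = f x * g x := by
  simp [mulS, SchwartzMap.pairing_apply_apply]

lemma br_tg (s : ℝ) : (br s : Eu n → ℂ).HasTemperateGrowth := by
  unfold br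
  have h1 : (fun x : Eu n => (1 + ‖x‖ ^ 2) ^ (s / 2)).HasTemperateGrowth :=
    Function.hasTemperateGrowth_one_add_norm_sq_rpow _ _
  have h2 : (fun x : Eu n => (2 * π) • x).HasTemperateGrowth :=
    ((2 * π) • (ContinuousLinearMap.id ℝ (Eu n))).hasTemperateGrowth
  have h3 := Function.Complex.hasTemperateGrowth_ofReal.comp (h1.comp h2)
  have h4 : (fun ξ : Eu n => (((1 + (2 * π) ^ 2 * ‖ξ‖ ^ 2) ^ (s / 2) : ℝ) : ℂ)) =
      (Complex.ofReal ∘ ((fun x : Eu n => (1 + ‖x‖ ^ 2) ^ (s / 2)) ∘ fun x => (2 * π) • x)) := by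
    ext ξ
    simp only [Function.comp, norm_smul, mul_pow, Real.norm_eq_abs, sq_abs]
  rw [h4]; exact h3

lemma fourier_mu {m : Eu n → ℂ} (hm : m.HasTemperateGrowth) (f : Sw n) (ξ : Eu n) :
    𝓕 (mu m f) ξ = m ξ * 𝓕 f ξ := by
  simp [mu, SchwartzMap.fourierMultiplierCLM_apply, SchwartzMap.smulLeftCLM_apply_apply hm]

lemma mu_ext {f g : Sw n} (h : ∀ ξ, 𝓕 f ξ = 𝓕 g ξ) : f = g := by
  have : 𝓕 f = 𝓕 g := SchwartzMap.ext h
  have h2 := congrArg (fun u => 𝓕⁻ u) this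
  simpa using h2

lemma mu_congr {m m' : Eu n → ℂ} (hm : m.HasTemperateGrowth) (hm' : m'.HasTemperateGrowth)
    (f : Sw n) (h : ∀ ξ, m ξ * 𝓕 f ξ = m' ξ * 𝓕 f ξ) : mu m f = mu m' f := by
  apply mu_ext
  intro ξ
  rw [fourier_mu hm, fourier_mu hm', h]

lemma mu_mu {m m' : Eu n → ℂ} (hm : m.HasTemperateGrowth) (hm' : m'.HasTemperateGrowth)
    (f : Sw n) : mu m (mu m' f) = mu (fun ξ => m ξ * m' ξ) f := by
  apply mu_ext
  intro ξ
  rw [fourier_mu hm, fourier_mu hm', fourier_mu (m := fun ξ => m ξ * m' ξ) (hm.mul hm')]; ring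

lemma mu_apply {m : Eu n → ℂ} (hm : m.HasTemperateGrowth) (f : Sw n) (x : Eu n) :
    mu m f x = ∫ ξ, Complex.exp (2 * π * I * (⟪ξ, x⟫ : ℝ)) * (m ξ * 𝓕 f ξ) := by
  have h : mu m f = 𝓕⁻ (SchwartzMap.smulLeftCLM ℂ m (𝓕 f)) := rfl
  rw [h, SchwartzMap.fourierInv_coe, Real.fourierInv_eq']
  congr 1
  ext ξ
  rw [SchwartzMap.smulLeftCLM_apply_apply hm]
  simp only [smul_eq_mul]
  congr 2
  push_cast; ring

lemma FT_eq (f : Sw n) (ξ : Eu n) : FT ⇑f ((2 * π) • ξ) = 𝓕 f ξ := by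
  rw [SchwartzMap.fourier_coe, Real.fourier_eq', FT]
  congr 1
  ext x
  rw [smul_eq_mul, mul_comm]
  congr 2
  rw [inner_smul_right]
  push_cast; ring

lemma Js_eq (s : ℝ) (f : Sw n) (x : Eu n) : Js s ⇑f x = mu (br s) f x := by
  rw [mu_apply (br_tg s), Js]
  have h := Measure.integral_comp_smul (volume : Measure (Eu n))
    (fun ξ : Eu n => (((1 + ‖ξ‖ ^ 2) ^ (s / 2) : ℝ) : ℂ) * FT f ξ *
      Complex.exp (Complex.I * ((⟪x, ξ⟫ : ℝ) : ℂ))) (2 * π)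
  have hpos : (0:ℝ) < (2 * π) ^ n := by positivity
  rw [finrank_euclideanSpace_fin, abs_of_nonneg (by positivity)] at h
  rw [← Complex.real_smul, ← h]
  congr 1
  ext ξ
  rw [FT_eq, br, norm_smul, Real.norm_of_nonneg (by positivity), mul_pow, inner_smul_right,
    real_inner_comm]
  rw [mul_comm]
  congr 2
  push_cast; ring

lemma Js_mul_eq (s : ℝ) (f g : Sw n) (x : Eu n) :
    Js s (fun y => f y * g y) x = mu (br s) (mulS f g) x := by
  rw [← Js_eq]
  congr 1

/-- Kernel representation. -/
lemma mu_kernel (κ f : Sw n) (x : Eu n) :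
    mu ⇑κ f x = ∫ z, (𝓕⁻ κ) z * f (x - z) := by
  have h1 : mu ⇑κ f = SchwartzMap.convolution (ContinuousLinearMap.mul ℂ ℂ) (𝓕⁻ κ) f := by
    apply mu_ext
    intro ξ
    rw [fourier_mu κ.hasTemperateGrowth, SchwartzMap.fourier_convolution]
    simp [SchwartzMap.pairing_apply_apply]
  rw [h1, SchwartzMap.convolution_apply]
  rfl

lemma deriv_tg (v : Eu n) :
    (fun ξ : Eu n => (2 * π * I : ℂ) * (⟪ξ, v⟫ : ℝ)).HasTemperateGrowth := by
  have := Function.Complex.hasTemperateGrowth_ofReal.comp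
    (Function.hasTemperateGrowth_inner_left (H := Eu n) v)
  exact (Function.HasTemperateGrowth.const _).mul this

lemma fourier_deriv (v : Eu n) (f : Sw n) (ξ : Eu n) :
    𝓕 (∂_{v} f : Sw n) ξ = (2 * π * I : ℂ) * (⟪ξ, v⟫ : ℝ) * 𝓕 f ξ := by
  have : (inner ℝ · v : Eu n → ℝ).HasTemperateGrowth := by fun_prop
  rw [SchwartzMap.fourier_lineDerivOp_eq]
  simp [SchwartzMap.smulLeftCLM_apply_apply this]
  ring

lemma deriv_eq_mu (v : Eu n) (f : Sw n) :
    (∂_{v} f : Sw n) = mu (fun ξ : Eu n => (2 * π * I : ℂ) * (⟪ξ, v⟫ : ℝ)) f := by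
  apply mu_ext
  intro ξ
  rw [fourier_deriv, fourier_mu (deriv_tg v)]

lemma fourier_mulS (f g : Sw n) (ξ : Eu n) :
    𝓕 (mulS f g) ξ = ∫ η, 𝓕 f η * 𝓕 g (ξ - η) := by
  have h1 : mulS f g = 𝓕 (SchwartzMap.convolution (ContinuousLinearMap.mul ℂ ℂ) (𝓕⁻ f) (𝓕⁻ g)) := by
    rw [SchwartzMap.fourier_convolution]; simp [mulS]
  have key : ∀ (h : Sw n) (ξ : Eu n), 𝓕 h ξ = 𝓕⁻ h (-ξ) := by
    intro h ξ
    rw [SchwartzMap.fourierInv_coe, SchwartzMap.fourier_coe, Real.fourierInv_eq_fourier_neg]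
    simp
  rw [key, h1, FourierTransform.fourierInv_fourier_eq, SchwartzMap.convolution_apply]
  simp only [MeasureTheory.convolution, ContinuousLinearMap.mul_apply']
  rw [← integral_neg_eq_self]
  congr 1
  ext η
  rw [key f, key g]
  congr 2
  abel

lemma moment_kernel (κ : Sw n) (v z : Eu n) :
    (⟪z, v⟫ : ℝ) * (𝓕⁻ κ) z = -(2 * π * I)⁻¹ * (𝓕⁻ (∂_{v} κ : Sw n)) z := by
  have : (inner ℝ · v : Eu n → ℝ).HasTemperateGrowth := by fun_prop
  rw [SchwartzMap.fourierInv_lineDerivOp_eq]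
  simp [SchwartzMap.smulLeftCLM_apply_apply this]
  field_simp
  rw [I_sq]; ring

/-- smooth, compactly supported symbol -/
def Ccs (m : Eu n → ℂ) : Prop := ContDiff ℝ ∞ m ∧ HasCompactSupport m

def Ccs.S {m : Eu n → ℂ} (h : Ccs m) : Sw n := h.2.toSchwartzMap h.1

@[simp] lemma Ccs.S_coe {m : Eu n → ℂ} (h : Ccs m) : ⇑h.S = m := rfl

lemma Ccs.tg {m : Eu n → ℂ} (h : Ccs m) : m.HasTemperateGrowth := by
  have := h.S.hasTemperateGrowth
  simpa using this

lemma br_contDiff (s : ℝ) : ContDiff ℝ ∞ (br s : Eu n → ℂ) := (br_tg s).1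

lemma Ccs.mul_left {m m' : Eu n → ℂ} (h : Ccs m) (h' : ContDiff ℝ ∞ m') :
    Ccs (fun ξ => m' ξ * m ξ) := ⟨h'.mul h.1, h.2.mul_left⟩

lemma Ccs.scale {m : Eu n → ℂ} (h : Ccs m) {c : ℝ} (hc : c ≠ 0) : Ccs (fun ξ => m (c • ξ)) :=
  ⟨h.1.comp (contDiff_const_smul c), h.2.comp_smul hc⟩

lemma Ccs.sub {m m' : Eu n → ℂ} (h : Ccs m) (h' : Ccs m') : Ccs (fun ξ => m ξ - m' ξ) :=
  ⟨h.1.sub h'.1, h.2.sub h'.2⟩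

/-- scaled family -/
def fam (a b : Eu n → ℂ) (k : ℕ) (ξ : Eu n) : ℂ := if k = 0 then a ξ else b (((2:ℝ) ^ k)⁻¹ • ξ)

lemma fam_ccs {a b : Eu n → ℂ} (ha : Ccs a) (hb : Ccs b) (k : ℕ) : Ccs (fam a b k) := by
  unfold fam
  by_cases h : k = 0
  · simpa [h] using ha
  · simp only [h, if_false]; exact hb.scale (by positivity)

/-- kernel profile -/
def Ker (n N : ℕ) (l t : ℝ) : ℝ := l ^ n / (1 + l * t) ^ N

lemma mu_ker {m : Eu n → ℂ} (h : Ccs m) (f : Sw n) (x : Eu n) :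
    mu m f x = ∫ z, 𝓕⁻ m z * f (x - z) := by
  have := mu_kernel h.S f x
  rw [SchwartzMap.fourierInv_coe] at this
  simpa using this

lemma schwartz_decay (u : Sw n) (N : ℕ) : ∃ C > 0, ∀ x, ‖u x‖ ≤ C / (1 + ‖x‖) ^ N := by
  have h := fun x => SchwartzMap.one_add_le_sup_seminorm_apply (𝕜 := ℝ) (m := (N, 0)) (k := N) (n := 0) le_rfl le_rfl u x
  refine ⟨2 ^ N * ((Finset.Iic (N, 0)).sup fun m => SchwartzMap.seminorm ℝ m.1 m.2) u + 1, ?_, ?_⟩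
  · have : 0 ≤ ((Finset.Iic (N, 0)).sup fun m => SchwartzMap.seminorm ℝ m.1 m.2) u := apply_nonneg _ _
    positivity
  · intro x
    rw [le_div_iff₀ (by positivity), mul_comm]
    have := h x
    simp only [norm_iteratedFDeriv_zero] at this
    linarith

lemma fourierInv_scale (m : Eu n → ℂ) {l : ℝ} (hl : 0 < l) (x : Eu n) :
    𝓕⁻ (fun ξ => m (l⁻¹ • ξ)) x = (l ^ n : ℝ) * 𝓕⁻ m (l • x) := by
  rw [Real.fourierInv_eq', Real.fourierInv_eq']
  have h := Measure.integral_comp_smul (volume : Measure (Eu n))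
    (fun v => cexp (↑(2 * π * ⟪v, l • x⟫) * I) • m v) l⁻¹
  rw [finrank_euclideanSpace_fin, abs_of_nonneg (by positivity)] at h
  simp only [inv_pow, inv_inv] at h
  rw [← Complex.real_smul, ← h]
  congr 1
  ext v
  simp only [inner_smul_left, inner_smul_right]
  congr 4
  simp; field_simp

lemma KL0 {b : Eu n → ℂ} (hb : Ccs b) (N : ℕ) : ∃ C > 0, ∀ l > 0, ∀ z,
    ‖𝓕⁻ (fun ξ => b (l⁻¹ • ξ)) z‖ ≤ C * Ker n N l ‖z‖ := by
  obtain ⟨C, hC, h⟩ := schwartz_decay (𝓕⁻ hb.S) N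
  refine ⟨C, hC, fun l hl z => ?_⟩
  rw [fourierInv_scale b hl, norm_mul, Complex.norm_real, Real.norm_of_nonneg (by positivity)]
  have := h (l • z)
  rw [SchwartzMap.fourierInv_coe, Ccs.S_coe, norm_smul, Real.norm_of_nonneg hl.le] at this
  calc _ ≤ l ^ n * (C / (1 + l * ‖z‖) ^ N) := by gcongr
    _ = _ := by unfold Ker; ring

/-- uniform kernel bounds from uniform symbol bounds -/
lemma unif_decay (N : ℕ) : ∃ (P : Finset (ℕ × ℕ)) (C : ℝ), 0 < C ∧ ∀ (u : Sw n) (B : ℝ), 0 ≤ B →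
    (∀ q ∈ P, SchwartzMap.seminorm ℝ q.1 q.2 u ≤ B) → ∀ x, ‖𝓕⁻ u x‖ ≤ C * B / (1 + ‖x‖) ^ N := by
  let q : Seminorm ℝ (Sw n) := ((Finset.Iic (N, 0)).sup fun m => SchwartzMap.seminorm ℝ m.1 m.2).comp
    (FourierTransform.fourierInvCLM ℝ (Sw n) : Sw n →L[ℝ] Sw n).toLinearMap
  have hq : Continuous q := by
    have h1 : Continuous ⇑((Finset.Iic (N, 0)).sup fun m => SchwartzMap.seminorm ℝ m.1 m.2 : Seminorm ℝ (Sw n)) :=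
      Seminorm.continuous_finsetSup (fun i _ => (schwartz_withSeminorms ℝ (Eu n) ℂ).continuous_seminorm i)
    exact h1.comp (FourierTransform.fourierInvCLM ℝ (Sw n) : Sw n →L[ℝ] Sw n).continuous
  obtain ⟨P, C, hC, h⟩ := Seminorm.bound_of_continuous (schwartz_withSeminorms ℝ (Eu n) ℂ) q hq
  refine ⟨P, 2 ^ N * C, by have : 0 < C := pos_iff_ne_zero.2 hC
                           positivity, ?_⟩
  intro u B hB hu x
  rw [le_div_iff₀ (by positivity), mul_comm]
  have h1 := SchwartzMap.one_add_le_sup_seminorm_apply (𝕜 := ℝ) (m := (N, 0)) (k := N) (n := 0) le_rfl le_rfl (𝓕⁻ u) x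
  rw [norm_iteratedFDeriv_zero] at h1
  have h2 := h u
  have h3 : (P.sup (schwartzSeminormFamily ℝ (Eu n) ℂ)) u ≤ B :=
    Seminorm.finset_sup_apply_le hB hu
  calc _ ≤ _ := h1
    _ = 2 ^ N * q u := rfl
    _ ≤ 2 ^ N * (C * B) := by
      gcongr
      refine h2.trans ?_
      show (C : ℝ) * _ ≤ _
      gcongr
    _ = _ := by ring

lemma symb_contDiff (b : Eu n → ℂ) (hb : Ccs b) {d : ℝ} (hd : 0 < d) (h0 : ∀ ξ, ‖ξ‖ < d → b ξ = 0)
    (s : ℝ) : ContDiff ℝ ∞ (fun q : ℝ × Eu n =>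
      (((q.1 ^ 2 + (2 * π) ^ 2 * ‖q.2‖ ^ 2) ^ (s / 2) : ℝ) : ℂ) * b q.2) := by
  rw [contDiff_iff_contDiffAt]
  intro q
  by_cases hq : ‖q.2‖ < d
  · have : (fun q : ℝ × Eu n =>
      (((q.1 ^ 2 + (2 * π) ^ 2 * ‖q.2‖ ^ 2) ^ (s / 2) : ℝ) : ℂ) * b q.2) =ᶠ[nhds q] fun _ => 0 := by
      have : ∀ᶠ q' : ℝ × Eu n in nhds q, ‖q'.2‖ < d :=
        (continuous_snd.norm).continuousAt.eventually_lt continuousAt_const hq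
      filter_upwards [this] with q' hq'
      rw [h0 _ hq', mul_zero]
    exact contDiffAt_const.congr_of_eventuallyEq this
  · have hq2 : 0 < ‖q.2‖ := lt_of_lt_of_le hd (not_lt.1 hq)
    have hpos : q.1 ^ 2 + (2 * π) ^ 2 * ‖q.2‖ ^ 2 ≠ 0 := by positivity
    have h1 : ContDiffAt ℝ ∞ (fun q : ℝ × Eu n => q.1 ^ 2 + (2 * π) ^ 2 * ‖q.2‖ ^ 2) q := by
      have : ContDiff ℝ ∞ (fun q : ℝ × Eu n => q.1 ^ 2 + (2 * π) ^ 2 * ‖q.2‖ ^ 2) :=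
        (contDiff_fst.pow 2).add (contDiff_const.mul ((contDiff_snd).norm_sq ℝ))
      exact this.contDiffAt
    have h2 := h1.rpow_const_of_ne (p := s / 2) hpos
    exact ((Complex.ofRealCLM.contDiff.contDiffAt).comp q h2).mul (hb.1.comp contDiff_snd).contDiffAt

lemma KL1a (b : Eu n → ℂ) (hb : Ccs b) {d : ℝ} (hd : 0 < d) (h0 : ∀ ξ, ‖ξ‖ < d → b ξ = 0)
    (s : ℝ) (N : ℕ) : ∃ C > 0, ∀ l : ℝ, 1 ≤ l → ∀ z,
      ‖𝓕⁻ (fun ξ => br s ξ * b (l⁻¹ • ξ)) z‖ ≤ C * l ^ s * Ker n N l ‖z‖ := by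
  set M := (fun q : ℝ × Eu n =>
      (((q.1 ^ 2 + (2 * π) ^ 2 * ‖q.2‖ ^ 2) ^ (s / 2) : ℝ) : ℂ) * b q.2) with hM
  have hMc : ContDiff ℝ ∞ M := symb_contDiff b hb hd h0 s
  have hme : ∀ e : ℝ, Ccs (fun ξ => M (e, ξ)) := by
    intro e
    refine ⟨hMc.comp (contDiff_const.prodMk contDiff_id), ?_⟩
    exact HasCompactSupport.mul_left hb.2
  obtain ⟨P, C, hC, hP⟩ := unif_decay (n := n) N
  -- uniform seminorm bound
  have hsem : ∀ q : ℕ × ℕ, ∃ B : ℝ, 0 ≤ B ∧ ∀ e ∈ Set.Icc (0:ℝ) 1,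
      SchwartzMap.seminorm ℝ q.1 q.2 (hme e).S ≤ B := by
    intro q
    have hcomp : IsCompact (Set.Icc (0:ℝ) 1 ×ˢ tsupport b) := isCompact_Icc.prod hb.2
    have hcont : Continuous (fun y : ℝ × Eu n => ‖y.2‖ ^ q.1 * ‖iteratedFDeriv ℝ q.2 M y‖) := by
      have := hMc.continuous_iteratedFDeriv (m := q.2) (by exact_mod_cast le_top)
      fun_prop
    obtain ⟨B, hB⟩ := hcomp.bddAbove_image hcont.continuousOn
    have hinr : ‖ContinuousLinearMap.inr ℝ ℝ (Eu n)‖ ≤ 1 :=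
      ContinuousLinearMap.norm_inr_le_one ℝ ℝ (Eu n)
    refine ⟨max B 0, le_max_right _ _, fun e he => ?_⟩
    apply SchwartzMap.seminorm_le_bound _ _ _ _ (le_max_right _ _)
    intro x
    by_cases hx : x ∈ tsupport b
    · refine le_trans ?_ (le_max_left _ _)
      have h1 : ⇑(hme e).S = (fun y => M ((e, 0) + y)) ∘ ContinuousLinearMap.inr ℝ ℝ (Eu n) := by
        ext ξ; simp
      have hc2 : ContDiff ℝ ∞ (fun y => M ((e, 0) + y)) := hMc.comp (contDiff_const.add contDiff_id)
      rw [h1, ContinuousLinearMap.iteratedFDeriv_comp_right _ hc2 _ (by exact_mod_cast le_top),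
        iteratedFDeriv_comp_add_left]
      refine le_trans ?_ (hB ⟨(e, x), ⟨he, hx⟩, rfl⟩)
      simp only
      gcongr
      refine (ContinuousMultilinearMap.norm_compContinuousLinearMap_le _ _).trans ?_
      have : ∏ i : Fin q.2, ‖ContinuousLinearMap.inr ℝ ℝ (Eu n)‖ ≤ 1 :=
        Finset.prod_le_one (fun _ _ => norm_nonneg _) (fun _ _ => hinr)
      calc _ ≤ ‖iteratedFDeriv ℝ q.2 M ((e, 0) + ContinuousLinearMap.inr ℝ ℝ (Eu n) x)‖ * 1 := by gcongr
        _ = _ := by simp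
    · have : iteratedFDeriv ℝ q.2 (⇑(hme e).S) x = 0 := by
        have hx' : x ∉ tsupport (⇑(hme e).S) := fun h => hx (tsupport_mul_subset_right h)
        have := (support_iteratedFDeriv_subset (𝕜 := ℝ) (f := ⇑(hme e).S) q.2)
        by_contra hne
        exact hx' (this hne)
      rw [this]; simp
  choose B hB0 hB using hsem
  refine ⟨C * (∑ q ∈ P, B q + 1), by have := Finset.sum_nonneg (s := P) (fun q _ => hB0 q)
                                     positivity, fun l hl z => ?_⟩
  have hl0 : 0 < l := by linarith
  have key : (fun ξ => br s ξ * b (l⁻¹ • ξ)) =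
      fun ξ => (fun ζ => ((l ^ s : ℝ) : ℂ) * M (l⁻¹, ζ)) (l⁻¹ • ξ) := by
    ext ξ
    simp only [hM, br]
    rw [← mul_assoc, ← Complex.ofReal_mul]
    congr 2
    have : l ^ s = (l ^ 2) ^ (s / 2) := by
      rw [← Real.rpow_natCast, ← Real.rpow_mul hl0.le]; congr 1; push_cast; ring
    rw [this, ← Real.mul_rpow (by positivity) (by positivity)]
    congr 1
    rw [norm_smul, Real.norm_of_nonneg (by positivity)]
    field_simp
  rw [key, fourierInv_scale (fun ζ => ((l ^ s : ℝ) : ℂ) * M (l⁻¹, ζ)) hl0]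
  have h2 := hP (hme l⁻¹).S (∑ q ∈ P, B q + 1)
    (by have := Finset.sum_nonneg (s := P) (fun q _ => hB0 q)
        positivity)
    (fun q hq => (hB q l⁻¹ ⟨by positivity, inv_le_one_of_one_le₀ hl⟩).trans (by
      have := Finset.single_le_sum (f := B) (fun q _ => hB0 q) hq
      linarith)) (l • z)
  rw [SchwartzMap.fourierInv_coe, Ccs.S_coe] at h2
  have h3 : 𝓕⁻ (fun ζ => ((l ^ s : ℝ) : ℂ) * M (l⁻¹, ζ)) (l • z)
      = ((l ^ s : ℝ) : ℂ) * 𝓕⁻ (fun ζ => M (l⁻¹, ζ)) (l • z) := by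
    rw [Real.fourierInv_eq', Real.fourierInv_eq', ← integral_const_mul]
    congr 1; ext v; simp only [smul_eq_mul]; ring
  rw [h3, norm_mul, norm_mul, Complex.norm_real, Complex.norm_real,
    Real.norm_of_nonneg (by positivity), Real.norm_of_nonneg (by positivity)]
  rw [norm_smul, Real.norm_of_nonneg hl0.le] at h2
  calc _ ≤ l ^ n * (l ^ s * (C * (∑ q ∈ P, B q + 1) / (1 + l * ‖z‖) ^ N)) := by gcongr
    _ = _ := by unfold Ker; ring

lemma KL1 {a b : Eu n → ℂ} (ha : Ccs a) (hb : Ccs b) (h0 : ∃ d > 0, ∀ ξ, ‖ξ‖ < d → b ξ = 0)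
    (s : ℝ) (N : ℕ) : ∃ C > 0, ∀ k : ℕ, ∀ z,
      ‖𝓕⁻ (fun ξ => br s ξ * fam a b k ξ) z‖ ≤ C * ((2:ℝ) ^ k) ^ s * Ker n N (2 ^ k) ‖z‖ := by
  obtain ⟨d, hd, h0⟩ := h0
  obtain ⟨C1, hC1, h1⟩ := KL1a b hb hd h0 s N
  have hab := ha.mul_left (br_contDiff s)
  obtain ⟨C2, hC2, h2⟩ := KL0 hab N
  refine ⟨C1 + C2, by positivity, fun k z => ?_⟩
  have hK : 0 ≤ Ker n N (2 ^ k) ‖z‖ := by unfold Ker; positivity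
  by_cases hk : k = 0
  · subst hk
    have := h2 1 one_pos z
    simp only [fam, inv_one, one_smul, if_true, pow_zero, Real.one_rpow, mul_one] at this hK ⊢
    nlinarith
  · simp only [fam, hk, if_false]
    refine (h1 (2 ^ k) (one_le_pow₀ (by norm_num)) z).trans ?_
    gcongr
    linarith

def bumpE (n : ℕ) : ContDiffBump (0 : Eu n) := ⟨1, 2, one_pos, by norm_num⟩

def phi (ξ : Eu n) : ℂ := ((bumpE n ξ : ℝ) : ℂ)

lemma phi_ccs : Ccs (phi : Eu n → ℂ) := by
  refine ⟨Complex.ofRealCLM.contDiff.comp (bumpE n).contDiff, ?_⟩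
  exact (bumpE n).hasCompactSupport.comp_left (g := fun x : ℝ => (x : ℂ)) (by simp)

lemma phi_one {ξ : Eu n} (h : ‖ξ‖ ≤ 1) : phi ξ = 1 := by
  unfold phi
  rw [(bumpE n).one_of_mem_closedBall (by simpa [bumpE] using h)]; simp

lemma phi_zero {ξ : Eu n} (h : 2 ≤ ‖ξ‖) : phi ξ = 0 := by
  unfold phi
  rw [(bumpE n).zero_of_le_dist (by simpa [bumpE] using h)]; simp

lemma phi_norm_le (ξ : Eu n) : ‖phi ξ‖ ≤ 1 := by
  unfold phi
  rw [Complex.norm_real, Real.norm_of_nonneg (bumpE n).nonneg]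
  exact (bumpE n).le_one

def psi (ξ : Eu n) : ℂ := phi ξ - phi ((2:ℝ) • ξ)

lemma psi_ccs : Ccs (psi : Eu n → ℂ) := phi_ccs.sub (phi_ccs.scale two_ne_zero)

lemma psi_zero : ∃ d > 0, ∀ ξ : Eu n, ‖ξ‖ < d → psi ξ = 0 := by
  refine ⟨1/2, by norm_num, fun ξ h => ?_⟩
  rw [psi, phi_one (by linarith), phi_one (by rw [norm_smul]; norm_num; linarith), sub_self]

def chi (ξ : Eu n) : ℂ := phi ((1/4:ℝ) • ξ) - phi ((8:ℝ) • ξ)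

lemma chi_ccs : Ccs (chi : Eu n → ℂ) :=
  (phi_ccs.scale (by norm_num)).sub (phi_ccs.scale (by norm_num))

lemma chi_zero : ∃ d > 0, ∀ ξ : Eu n, ‖ξ‖ < d → chi ξ = 0 := by
  refine ⟨1/8, by norm_num, fun ξ h => ?_⟩
  rw [chi, phi_one (by rw [norm_smul]; norm_num; linarith),
    phi_one (by rw [norm_smul]; norm_num; linarith), sub_self]

def thin (k : ℕ) : Eu n → ℂ := fam phi psi k
def fat (k : ℕ) : Eu n → ℂ := fam (fun ξ => phi ((1/4:ℝ) • ξ)) chi k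

lemma thin_ccs (k : ℕ) : Ccs (thin k : Eu n → ℂ) := fam_ccs phi_ccs psi_ccs k
lemma fat_ccs (k : ℕ) : Ccs (fat k : Eu n → ℂ) :=
  fam_ccs (phi_ccs.scale (by norm_num)) chi_ccs k

lemma norm_sc (k : ℕ) (ξ : Eu n) : ‖((2:ℝ) ^ k)⁻¹ • ξ‖ = ‖ξ‖ / 2 ^ k := by
  rw [norm_smul, Real.norm_of_nonneg (by positivity)]; field_simp

lemma thin_hi {k : ℕ} {ξ : Eu n} (h : thin k ξ ≠ 0) : ‖ξ‖ ≤ 2 * 2 ^ k := by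
  by_contra hc
  push Not at hc
  apply h
  unfold thin fam
  split_ifs with hk
  · subst hk; exact phi_zero (by simp at hc; linarith)
  · have : 2 ≤ ‖((2:ℝ) ^ k)⁻¹ • ξ‖ := by
      rw [norm_sc, le_div_iff₀ (by positivity)]; linarith
    rw [psi, phi_zero this, phi_zero (by rw [norm_smul]; norm_num; linarith), sub_self]

lemma thin_lo {k : ℕ} (hk : k ≠ 0) {ξ : Eu n} (h : thin k ξ ≠ 0) : 2 ^ k / 2 ≤ ‖ξ‖ := by
  by_contra hc
  push Not at hc
  apply h
  unfold thin fam
  rw [if_neg hk]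
  have : ‖((2:ℝ) ^ k)⁻¹ • ξ‖ ≤ 1 / 2 := by
    rw [norm_sc, div_le_iff₀ (by positivity)]; linarith
  rw [psi, phi_one (by linarith), phi_one (by rw [norm_smul]; norm_num; linarith), sub_self]

lemma fat_one {k : ℕ} {ξ : Eu n} (h1 : ‖ξ‖ ≤ 4 * 2 ^ k) (h2 : k = 0 ∨ 2 ^ k / 4 ≤ ‖ξ‖) :
    fat k ξ = 1 := by
  unfold fat fam
  split_ifs with hk
  · subst hk; exact phi_one (by rw [norm_smul]; norm_num at h1 ⊢; linarith)
  · have h2 := h2.resolve_left hk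
    have hp : (0:ℝ) < 2 ^ k := by positivity
    have e1 : ‖((2:ℝ) ^ k)⁻¹ • ξ‖ ≤ 4 := by
      rw [norm_sc, div_le_iff₀ (by positivity)]; linarith
    have e2 : 1 / 4 ≤ ‖((2:ℝ) ^ k)⁻¹ • ξ‖ := by
      rw [norm_sc, le_div_iff₀ (by positivity)]; linarith
    rw [chi, phi_one (by rw [norm_smul]; norm_num; linarith),
      phi_zero (by rw [norm_smul]; norm_num; linarith), sub_zero]

lemma thin_sum (J : ℕ) (ξ : Eu n) :
    ∑ j ∈ Finset.range (J + 1), thin j ξ = phi (((2:ℝ) ^ J)⁻¹ • ξ) := by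
  induction J with
  | zero => simp [thin, fam]
  | succ J ih =>
    rw [Finset.sum_range_succ, ih]
    simp only [thin, fam, Nat.succ_ne_zero, if_false, psi, smul_smul]
    have : (2:ℝ) * (2 ^ (J + 1))⁻¹ = (2 ^ J)⁻¹ := by
      rw [pow_succ]; field_simp
    rw [this]; simp

/-- Littlewood–Paley piece -/
def lpp (k : ℕ) (f : Sw n) : Sw n := mu (thin k) f

/-- partial derivative -/
def D (l : Fin n) (u : Sw n) : Sw n := ∂_{(EuclideanSpace.single l (1:ℝ) : Eu n)} u

lemma D_apply (l : Fin n) (u : Sw n) (x : Eu n) :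
    D l u x = fderiv ℝ u x (EuclideanSpace.single l 1) :=
  SchwartzMap.lineDerivOp_apply_eq_fderiv _ _ _

def dsym (l : Fin n) (ξ : Eu n) : ℂ := (2 * π * I : ℂ) * ((ξ l : ℝ) : ℂ)

lemma dsym_eq (l : Fin n) : (dsym l : Eu n → ℂ) =
    fun ξ => (2 * π * I : ℂ) * (⟪ξ, (EuclideanSpace.single l (1:ℝ) : Eu n)⟫ : ℝ) := by
  ext ξ; simp only [dsym, EuclideanSpace.inner_single_right]; simp

lemma dsym_tg (l : Fin n) : (dsym l : Eu n → ℂ).HasTemperateGrowth := by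
  rw [dsym_eq]; exact deriv_tg _

lemma D_eq_mu (l : Fin n) (u : Sw n) : D l u = mu (dsym l) u := by
  rw [D, deriv_eq_mu, dsym_eq]

/-- spectral support -/
def Sp (R : ℝ) (u : Sw n) : Prop := ∀ ξ, 𝓕 u ξ ≠ 0 → ‖ξ‖ ≤ R
def SpL (R : ℝ) (u : Sw n) : Prop := ∀ ξ, 𝓕 u ξ ≠ 0 → R ≤ ‖ξ‖

lemma Sp.mono {R R' : ℝ} {u : Sw n} (h : Sp R u) (hR : R ≤ R') : Sp R' u :=
  fun ξ hξ => (h ξ hξ).trans hR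

lemma Sp.mu {R : ℝ} {u : Sw n} (h : Sp R u) {m : Eu n → ℂ} (hm : m.HasTemperateGrowth) :
    Sp R (mu m u) := by
  intro ξ hξ
  rw [fourier_mu hm] at hξ
  exact h ξ (right_ne_zero_of_mul hξ)

lemma Sp.D {R : ℝ} {u : Sw n} (h : Sp R u) (l : Fin n) : Sp R (D l u) := by
  rw [D_eq_mu]; exact h.mu (dsym_tg l)

lemma lpp_sp (k : ℕ) (f : Sw n) : Sp (2 * 2 ^ k) (lpp k f) := by
  intro ξ hξ
  rw [lpp, fourier_mu (thin_ccs k).tg] at hξ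
  exact thin_hi (left_ne_zero_of_mul hξ)

lemma lpp_spL {k : ℕ} (hk : k ≠ 0) (f : Sw n) : SpL (2 ^ k / 2) (lpp k f) := by
  intro ξ hξ
  rw [lpp, fourier_mu (thin_ccs k).tg] at hξ
  exact thin_lo hk (left_ne_zero_of_mul hξ)

lemma Sp_mulS {R R' : ℝ} {u v : Sw n} (hu : Sp R u) (hv : Sp R' v) : Sp (R + R') (mulS u v) := by
  intro ξ hξ
  rw [fourier_mulS] at hξ
  obtain ⟨η, hη⟩ : ∃ η, 𝓕 u η * 𝓕 v (ξ - η) ≠ 0 := by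
    by_contra hc
    push Not at hc
    apply hξ; simp [hc]
  have h1 := hu _ (left_ne_zero_of_mul hη)
  have h2 := hv _ (right_ne_zero_of_mul hη)
  calc ‖ξ‖ = ‖η + (ξ - η)‖ := by congr 1; abel
    _ ≤ _ := (norm_add_le _ _).trans (by linarith)

lemma SpL_mulS {R R' : ℝ} {u v : Sw n} (hu : Sp R u) (hv : SpL R' v) : SpL (R' - R) (mulS u v) := by
  intro ξ hξ
  rw [fourier_mulS] at hξ
  obtain ⟨η, hη⟩ : ∃ η, 𝓕 u η * 𝓕 v (ξ - η) ≠ 0 := by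
    by_contra hc
    push Not at hc
    apply hξ; simp [hc]
  have h1 := hu _ (left_ne_zero_of_mul hη)
  have h2 := hv _ (right_ne_zero_of_mul hη)
  have := norm_sub_le ξ η
  linarith

/-- insert fat cutoff -/
lemma mu_fat {k : ℕ} {u : Sw n} (s : ℝ) (h1 : Sp (4 * 2 ^ k) u) (h2 : k = 0 ∨ SpL (2 ^ k / 4) u) :
    mu (br s) u = mu (fun ξ => br s ξ * fat k ξ) u := by
  apply mu_congr (br_tg s) ((fat_ccs k).mul_left (br_contDiff s)).tg
  intro ξ
  by_cases h : 𝓕 u ξ = 0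
  · rw [h]; simp
  · rw [fat_one (h1 ξ h) (h2.imp id fun h2 => h2 ξ h), mul_one]

/-- insert a thin sum -/
lemma mu_thin_sum {J : ℕ} {u : Sw n} (s : ℝ) (h1 : Sp (2 ^ J) u) (x : Eu n) :
    mu (br s) u x = ∑ i ∈ Finset.range (J + 1), mu (fun ξ => br s ξ * thin i ξ) u x := by
  have hm : ∀ i, (fun ξ : Eu n => br s ξ * thin i ξ).HasTemperateGrowth :=
    fun i => ((thin_ccs i).mul_left (br_contDiff s)).tg
  have : mu (br s) u = ∑ i ∈ Finset.range (J + 1), mu (fun ξ => br s ξ * thin i ξ) u := by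
    apply mu_ext
    intro ξ
    rw [fourier_mu (br_tg s)]
    have e : 𝓕 (∑ i ∈ Finset.range (J + 1), mu (fun ξ => br s ξ * thin i ξ) u)
        = ∑ i ∈ Finset.range (J + 1), 𝓕 (mu (fun ξ => br s ξ * thin i ξ) u) :=
      map_sum (FourierTransform.fourierCLM ℂ (Sw n)) _ _
    rw [e, sum_apply]
    simp_rw [fourier_mu (hm _)]
    by_cases h : 𝓕 u ξ = 0
    · rw [h]; simp
    · simp_rw [mul_assoc (br s ξ)]
      rw [← Finset.mul_sum, ← Finset.sum_mul, thin_sum, phi_one, one_mul]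
      rw [norm_sc, div_le_one (by positivity)]; exact h1 ξ h
  rw [this, sum_apply]

lemma Ker_nonneg {N : ℕ} {l t : ℝ} (hl : 0 < l) (ht : 0 ≤ t) : 0 ≤ Ker n N l t := by
  unfold Ker; positivity

lemma integrable_base (n : ℕ) : Integrable (fun z : Eu n => Ker n (n + 1) 1 ‖z‖) := by
  have h := integrable_one_add_norm (E := Eu n) (μ := volume) (r := (n + 1 : ℝ)) (by simp)
  refine h.congr (Filter.Eventually.of_forall fun z => ?_)
  simp only [Ker]
  rw [Real.rpow_neg (by positivity)]
  have : ((n:ℝ) + 1) = ((n + 1 : ℕ) : ℝ) := by push_cast; ring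
  rw [this, Real.rpow_natCast]; simp

lemma Ker_scale {N : ℕ} {l : ℝ} (hl : 0 < l) (z : Eu n) :
    Ker n N l ‖z‖ = l ^ n * Ker n N 1 ‖l • z‖ := by
  simp only [Ker]
  rw [norm_smul, Real.norm_of_nonneg hl.le]; simp; ring

lemma Ker_integrable {l : ℝ} (hl : 0 < l) : Integrable (fun z : Eu n => Ker n (n + 1) l ‖z‖) := by
  have h := ((integrable_base n).comp_smul hl.ne').const_mul (l ^ n)
  refine h.congr (Filter.Eventually.of_forall fun z => ?_)
  simp only; rw [← Ker_scale hl]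

/-- constant -/
def cI (n : ℕ) : ℝ := ∫ z : Eu n, Ker n (n + 1) 1 ‖z‖

lemma cI_nonneg (n : ℕ) : 0 ≤ cI n := integral_nonneg fun z => Ker_nonneg one_pos (norm_nonneg _)

lemma Ker_integral {l : ℝ} (hl : 0 < l) : ∫ z : Eu n, Ker n (n + 1) l ‖z‖ = cI n := by
  simp_rw [Ker_scale hl]
  rw [integral_const_mul, Measure.integral_comp_smul volume (fun z : Eu n => Ker n (n + 1) 1 ‖z‖),
    finrank_euclideanSpace_fin, abs_of_nonneg (by positivity), cI, smul_eq_mul]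
  field_simp

lemma Ker_mul_pow {N M : ℕ} (h : M + n + 1 ≤ N) {l t : ℝ} (hl : 0 < l) (ht : 0 ≤ t) :
    Ker n N l t * (1 + l * t) ^ M ≤ Ker n (n + 1) l t := by
  unfold Ker
  have h1 : 1 ≤ 1 + l * t := by nlinarith [mul_nonneg hl.le ht]
  rw [div_mul_eq_mul_div, div_le_div_iff₀ (by positivity) (by positivity), mul_assoc, ← pow_add]
  gcongr
  omega

lemma conv_bound {K v : Eu n → ℂ} {N M : ℕ} (h : M + n + 1 ≤ N) {l A B : ℝ} (hl : 0 < l)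
    (hA : 0 ≤ A) (hB : 0 ≤ B)
    (hK : ∀ z, ‖K z‖ ≤ B * Ker n N l ‖z‖) (hv : ∀ z, ‖v z‖ ≤ A * (1 + l * ‖z‖) ^ M) :
    ‖∫ z, K z * v z‖ ≤ B * A * cI n := by
  rw [← Ker_integral hl, ← integral_const_mul]
  apply norm_integral_le_of_norm_le ((Ker_integrable hl).const_mul _)
  refine Filter.Eventually.of_forall fun z => ?_
  rw [norm_mul]
  have h1 : 0 ≤ Ker n N l ‖z‖ := Ker_nonneg hl (norm_nonneg _)
  calc ‖K z‖ * ‖v z‖ ≤ (B * Ker n N l ‖z‖) * (A * (1 + l * ‖z‖) ^ M) := by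
        gcongr
        · exact hK z
        · exact hv z
    _ = B * A * (Ker n N l ‖z‖ * (1 + l * ‖z‖) ^ M) := by ring
    _ ≤ _ := by gcongr; exact Ker_mul_pow h hl (norm_nonneg _)

/-- pointwise control with Peetre weights -/
def Ctl (N : ℕ) (l A : ℝ) (u : Sw n) (x : Eu n) : Prop :=
  ∀ z, ‖u (x - z)‖ ≤ A * (1 + l * ‖z‖) ^ N

lemma Ctl.at {N : ℕ} {l A : ℝ} {u : Sw n} {x : Eu n} (h : Ctl N l A u x) : ‖u x‖ ≤ A := by
  simpa using h 0

lemma Ctl.shift {N : ℕ} {l A : ℝ} {u : Sw n} {x : Eu n} (hl : 0 ≤ l) (hA : 0 ≤ A)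
    (h : Ctl N l A u x) (w : Eu n) : Ctl N l (A * (1 + l * ‖w‖) ^ N) u (x - w) := by
  intro z
  have := h (w + z)
  rw [← sub_sub] at this
  refine this.trans ?_
  rw [mul_assoc, ← mul_pow]
  gcongr
  have : l * ‖w + z‖ ≤ l * (‖w‖ + ‖z‖) := by gcongr; exact norm_add_le _ _
  nlinarith [mul_nonneg (mul_nonneg hl (norm_nonneg w)) (mul_nonneg hl (norm_nonneg z))]

lemma Ctl.mono_l {N : ℕ} {l l' A : ℝ} {u : Sw n} {x : Eu n} (hA : 0 ≤ A) (hl : 0 ≤ l) (hll : l ≤ l')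
    (h : Ctl N l A u x) : Ctl N l' A u x := fun z => (h z).trans (by gcongr)

lemma Ctl.mono {N : ℕ} {l A A' : ℝ} {u : Sw n} {x : Eu n} (hl : 0 ≤ l) (hll : A ≤ A')
    (h : Ctl N l A u x) : Ctl N l A' u x := fun z => (h z).trans (by gcongr)

/-- multiplier acting on controlled functions -/
lemma Ctl.mul {N N' : ℕ} (hN : N + n + 1 ≤ N') {m : Eu n → ℂ} (hm : Ccs m) {l A B : ℝ} (hl : 0 < l)
    (hA : 0 ≤ A) (hB : 0 ≤ B) (hK : ∀ z, ‖𝓕⁻ m z‖ ≤ B * Ker n N' l ‖z‖) {u : Sw n} {x : Eu n}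
    (h : Ctl N l A u x) : Ctl N l (B * A * cI n) (mu m u) x := by
  intro w
  rw [mu_ker hm]
  have := conv_bound (K := 𝓕⁻ m) (v := fun z => u (x - w - z)) hN hl (A := A * (1 + l * ‖w‖) ^ N)
    (by positivity) hB hK (h.shift hl.le hA w)
  refine this.trans (le_of_eq (by ring))

lemma kerB_scale {b : Eu n → ℂ} (hb : Ccs b) (N : ℕ) : ∃ C > 0, ∀ k : ℕ, ∀ z,
    ‖𝓕⁻ (fun ξ => b (((2:ℝ) ^ k)⁻¹ • ξ)) z‖ ≤ C * Ker n N (2 ^ k) ‖z‖ := by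
  obtain ⟨C, hC, h⟩ := KL0 hb N
  exact ⟨C, hC, fun k z => h (2 ^ k) (by positivity) z⟩

lemma fourierInv_const_mul (c : ℂ) (m : Eu n → ℂ) (z : Eu n) :
    𝓕⁻ (fun ξ => c * m ξ) z = c * 𝓕⁻ m z := by
  rw [Real.fourierInv_eq', Real.fourierInv_eq', ← integral_const_mul]
  congr 1; ext v; simp only [smul_eq_mul]; ring

lemma dsym_contDiff (l : Fin n) : ContDiff ℝ ∞ (dsym l : Eu n → ℂ) := (dsym_tg l).1

lemma dsym_scale (l : Fin n) (c : ℝ) (ξ : Eu n) : dsym l (c • ξ) = c * dsym l ξ := by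
  simp [dsym]; ring

/-- Bernstein -/
lemma Bern (n N : ℕ) : ∃ C > 0, ∀ (j : ℕ) (u : Sw n) (x : Eu n) (A : ℝ), 0 ≤ A →
    Sp (8 * 2 ^ j) u → Ctl N (2 ^ j) A u x → ∀ l, Ctl N (2 ^ j) (C * 2 ^ j * A) (D l u) x := by
  have hb : ∀ l : Fin n, Ccs (fun ξ : Eu n => dsym l ξ * phi ((1/8:ℝ) • ξ)) := fun l =>
    (phi_ccs.scale (by norm_num)).mul_left (dsym_contDiff l)
  choose C hC h using fun l : Fin n => kerB_scale (hb l) (N + n + 1)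
  have hcI := cI_nonneg n
  refine ⟨∑ l, C l * cI n + 1, by
    have : 0 ≤ ∑ l, C l * cI n := Finset.sum_nonneg fun l _ => mul_nonneg (hC l).le hcI
    positivity, ?_⟩
  intro j u x A hA hsp hctl l
  have hcc : Ccs (fun ξ : Eu n => (((2:ℝ) ^ j : ℝ) : ℂ) *
      (fun ξ => dsym l ξ * phi ((1/8:ℝ) • ξ)) (((2:ℝ) ^ j)⁻¹ • ξ)) :=
    ((hb l).scale (by positivity)).mul_left contDiff_const
  have e : D l u = mu (fun ξ : Eu n => (((2:ℝ) ^ j : ℝ) : ℂ) *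
      (fun ξ => dsym l ξ * phi ((1/8:ℝ) • ξ)) (((2:ℝ) ^ j)⁻¹ • ξ)) u := by
    rw [D_eq_mu]
    apply mu_congr (dsym_tg l) hcc.tg
    intro ξ
    by_cases h0 : 𝓕 u ξ = 0
    · rw [h0]; simp
    · simp only
      rw [phi_one, dsym_scale]
      · push_cast; field_simp
      · rw [norm_smul, norm_sc]
        have := hsp ξ h0
        rw [Real.norm_of_nonneg (by norm_num)]
        have : ‖ξ‖ / 2 ^ j ≤ 8 := by rw [div_le_iff₀ (by positivity)]; linarith
        linarith
  rw [e]
  refine (Ctl.mul (N' := N + n + 1) le_rfl hcc (B := 2 ^ j * C l) (by positivity) hA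
    (by have := hC l; positivity) (fun z => ?_) hctl).mono (by positivity) ?_
  · rw [fourierInv_const_mul, norm_mul, Complex.norm_real, Real.norm_of_nonneg (by positivity), mul_assoc]
    gcongr
    exact h l j z
  · have : C l * cI n ≤ ∑ l, C l * cI n :=
      Finset.single_le_sum (f := fun l => C l * cI n) (fun l _ => mul_nonneg (hC l).le hcI) (Finset.mem_univ l)
    calc 2 ^ j * C l * A * cI n = (C l * cI n) * 2 ^ j * A := by ring
      _ ≤ (∑ l, C l * cI n + 1) * 2 ^ j * A := by gcongr; linarith

lemma fat_kernel (n : ℕ) (s : ℝ) (N : ℕ) : ∃ C > 0, ∀ k : ℕ, ∀ z : Eu n,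
      ‖𝓕⁻ (fun ξ => br s ξ * fat k ξ) z‖ ≤ C * ((2:ℝ) ^ k) ^ s * Ker n N (2 ^ k) ‖z‖ :=
  KL1 (phi_ccs.scale (by norm_num)) chi_ccs chi_zero s N

lemma thin_kernel (n : ℕ) (s : ℝ) (N : ℕ) : ∃ C > 0, ∀ k : ℕ, ∀ z : Eu n,
      ‖𝓕⁻ (fun ξ => br s ξ * thin k ξ) z‖ ≤ C * ((2:ℝ) ^ k) ^ s * Ker n N (2 ^ k) ‖z‖ :=
  KL1 phi_ccs psi_ccs psi_zero s N

lemma lpp_fat (k : ℕ) (f : Sw n) (s : ℝ) :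
    mu (br s) (lpp k f) = mu (fun ξ => br s ξ * fat k ξ) (lpp k f) := by
  apply mu_fat s ((lpp_sp k f).mono (by have : (0:ℝ) < 2 ^ k := by positivity
                                        linarith))
  by_cases hk : k = 0
  · exact Or.inl hk
  · refine Or.inr fun ξ hξ => ?_
    have := lpp_spL hk f ξ hξ
    have : (0:ℝ) < 2 ^ k := by positivity
    linarith

lemma Mult (n N : ℕ) (s : ℝ) : ∃ C > 0, ∀ (k : ℕ) (f : Sw n) (x : Eu n) (A : ℝ), 0 ≤ A →
    Ctl N (2 ^ k) A (lpp k f) x → Ctl N (2 ^ k) (C * ((2:ℝ) ^ k) ^ s * A) (mu (br s) (lpp k f)) x := by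
  obtain ⟨C, hC, h⟩ := fat_kernel n s (N + n + 1)
  have hcI := cI_nonneg n
  refine ⟨C * (cI n + 1), by positivity, ?_⟩
  intro k f x A hA hctl
  rw [lpp_fat]
  refine (Ctl.mul (N' := N + n + 1) le_rfl ((fat_ccs k).mul_left (br_contDiff s))
    (B := C * ((2:ℝ) ^ k) ^ s) (by positivity) hA (by positivity) (h k) hctl).mono (by positivity) ?_
  calc C * ((2:ℝ) ^ k) ^ s * A * cI n = C * cI n * ((2:ℝ) ^ k) ^ s * A := by ring
    _ ≤ _ := by gcongr; linarith

lemma eu_sum (v : Eu n) : v = ∑ l, v l • (EuclideanSpace.single l (1:ℝ) : Eu n) := by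
  ext i
  simp [Finset.sum_apply, Pi.single_apply]

lemma lin_sum (L : Eu n →L[ℝ] ℂ) (v : Eu n) :
    L v = ∑ l, (v l : ℂ) * L (EuclideanSpace.single l 1) := by
  conv_lhs => rw [eu_sum v, map_sum]
  simp

lemma lin_norm (L : Eu n →L[ℝ] ℂ) : ‖L‖ ≤ ∑ l, ‖L (EuclideanSpace.single l 1)‖ := by
  apply ContinuousLinearMap.opNorm_le_bound _ (Finset.sum_nonneg fun _ _ => norm_nonneg _)
  intro v
  rw [lin_sum, Finset.sum_mul]
  refine (norm_sum_le _ _).trans (Finset.sum_le_sum fun l _ => ?_)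
  rw [norm_mul, mul_comm, Complex.norm_real]
  gcongr
  exact PiLp.norm_apply_le v l

lemma seg_form {x z y : Eu n} (hy : y ∈ segment ℝ x (x - z)) :
    ∃ w : Eu n, y = x - w ∧ ‖w‖ ≤ ‖z‖ := by
  rw [segment_eq_image_lineMap] at hy
  obtain ⟨t, ht, rfl⟩ := hy
  refine ⟨t • z, ?_, ?_⟩
  · simp [AffineMap.lineMap_apply]; abel
  · rw [norm_smul, Real.norm_of_nonneg ht.1]
    exact mul_le_of_le_one_left (norm_nonneg _) ht.2

lemma Tay1 {N : ℕ} {l A : ℝ} (hl : 0 ≤ l) (hA : 0 ≤ A) {u : Sw n} {x : Eu n}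
    (h : ∀ i, Ctl N l A (D i u) x) (z : Eu n) :
    ‖u (x - z) - u x‖ ≤ n * A * (1 + l * ‖z‖) ^ N * ‖z‖ := by
  have := Convex.norm_image_sub_le_of_norm_fderiv_le (𝕜 := ℝ) (f := ⇑u) (s := segment ℝ x (x - z))
    (C := n * A * (1 + l * ‖z‖) ^ N) (x := x) (y := x - z) (fun y _ => u.differentiableAt)
    (fun y hy => ?_) (convex_segment _ _) (left_mem_segment _ _ _) (right_mem_segment _ _ _)
  · simpa using this
  · obtain ⟨w, rfl, hw⟩ := seg_form hy
    refine (lin_norm _).trans ?_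
    calc _ ≤ ∑ i : Fin n, A * (1 + l * ‖z‖) ^ N := by
          refine Finset.sum_le_sum fun i _ => ?_
          rw [← D_apply]
          refine (h i w).trans ?_
          gcongr
      _ = _ := by simp; ring

lemma Tay2 {N : ℕ} {l A : ℝ} (hl : 0 ≤ l) (hA : 0 ≤ A) {u : Sw n} {x : Eu n}
    (h : ∀ i m, Ctl N l A (D m (D i u)) x) (z : Eu n) :
    ‖u (x - z) - u x + ∑ i, (z i : ℂ) * D i u x‖ ≤ n * (n * A * (1 + l * ‖z‖) ^ N * ‖z‖) * ‖z‖ := by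
  have := Convex.norm_image_sub_le_of_norm_hasFDerivWithin_le' (𝕜 := ℝ) (f := ⇑u)
    (f' := fderiv ℝ u) (φ := fderiv ℝ u x) (s := segment ℝ x (x - z))
    (C := n * (n * A * (1 + l * ‖z‖) ^ N * ‖z‖)) (x := x) (y := x - z)
    (fun y _ => u.differentiableAt.hasFDerivAt.hasFDerivWithinAt)
    (fun y hy => ?_) (convex_segment _ _) (left_mem_segment _ _ _) (right_mem_segment _ _ _)
  · rw [sub_sub_cancel_left, map_neg, norm_neg, lin_sum] at this
    simp_rw [D_apply]
    simpa using this
  · obtain ⟨w, rfl, hw⟩ := seg_form hy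
    refine (lin_norm _).trans ?_
    calc _ ≤ ∑ i : Fin n, n * A * (1 + l * ‖z‖) ^ N * ‖z‖ := by
          refine Finset.sum_le_sum fun i _ => ?_
          have := Tay1 hl hA (h i) w
          rw [D_apply, D_apply] at this
          simp only [sub_apply]
          refine this.trans ?_
          gcongr
      _ = _ := by simp

/-- the bilinear operator -/
def TT (s : ℝ) (f g : Sw n) (x : Eu n) : ℂ :=
  mu (br s) (mulS f g) x - f x * mu (br s) g x + (s : ℂ) * ∑ i, D i f x * D i (mu (br (s - 2)) g) x

lemma br_deriv (s : ℝ) (ξ : Eu n) (i : Fin n) :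
    fderiv ℝ (br s) ξ (EuclideanSpace.single i 1) = s * ((2 * π) ^ 2 * (ξ i : ℝ) : ℝ) * br (s - 2) ξ := by
  have hpos : (0:ℝ) < 1 + (2 * π) ^ 2 * ‖ξ‖ ^ 2 := by positivity
  have h1 : HasFDerivAt (fun ξ : Eu n => 1 + (2 * π) ^ 2 * ‖ξ‖ ^ 2)
      ((2 * π) ^ 2 • (2 • (innerSL ℝ ξ))) ξ :=
    (((hasStrictFDerivAt_norm_sq ξ).hasFDerivAt).const_mul ((2 * π) ^ 2)).const_add 1
  have h2 := h1.rpow_const (p := s / 2) (Or.inl hpos.ne')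
  have h3 := (Complex.ofRealCLM.hasFDerivAt).comp ξ h2
  have h4 : HasFDerivAt (br s : Eu n → ℂ) _ ξ := h3
  rw [h4.fderiv]
  simp only [ContinuousLinearMap.comp_apply, smul_apply, innerSL_apply_apply,
    EuclideanSpace.inner_single_right, Complex.ofRealCLM_apply, br, smul_eq_mul]
  rw [show (s - 2) / 2 = s / 2 - 1 by ring]
  push_cast
  simp
  ring

lemma fat_fderiv {k : ℕ} {ξ : Eu n} (h1 : ‖ξ‖ ≤ 2 * 2 ^ k) (h2 : 2 ^ k / 2 ≤ ‖ξ‖)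
    (s : ℝ) : (fun ξ => br s ξ * fat k ξ) =ᶠ[nhds ξ] br s := by
  have hp : (0:ℝ) < 2 ^ k := by positivity
  have e1 : ∀ᶠ y in nhds ξ, ‖y‖ < 4 * 2 ^ k :=
    continuous_norm.continuousAt.eventually_lt continuousAt_const (by linarith)
  have e2 : ∀ᶠ y in nhds ξ, 2 ^ k / 4 < ‖y‖ :=
    continuousAt_const.eventually_lt continuous_norm.continuousAt (by linarith)
  filter_upwards [e1, e2] with y h1 h2
  rw [fat_one h1.le (Or.inr h2.le), mul_one]

/-- first moment identity -/
lemma moment_id {k : ℕ} (hk : k ≠ 0) (s : ℝ) (g : Sw n) (x : Eu n) (i : Fin n) :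
    ∫ z, 𝓕⁻ (fun ξ => br s ξ * fat k ξ) z * ((z i : ℂ) * lpp k g (x - z)) =
      s * D i (mu (br (s - 2)) (lpp k g)) x := by
  have hcc : Ccs (fun ξ : Eu n => br s ξ * fat k ξ) := (fat_ccs k).mul_left (br_contDiff s)
  set κ := hcc.S with hκ
  have h1 := moment_kernel κ (EuclideanSpace.single i 1)
  have h2 : ∀ z, 𝓕⁻ (fun ξ => br s ξ * fat k ξ) z * ((z i : ℂ) * lpp k g (x - z)) =
      -(2 * π * I)⁻¹ * ((𝓕⁻ (D i κ)) z * lpp k g (x - z)) := by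
    intro z
    have := h1 z
    rw [SchwartzMap.fourierInv_coe] at this
    simp only [EuclideanSpace.inner_single_right, hκ, Ccs.S_coe] at this
    simp only [one_mul, conj_trivial] at this
    rw [← mul_assoc, ← mul_assoc, mul_comm _ (z i : ℂ), this]; rfl
  simp_rw [h2]
  rw [integral_const_mul, ← mu_kernel]
  have h3 : (-(2 * π * I)⁻¹ : ℂ) • mu (⇑(D i κ)) (lpp k g) =
      (s : ℂ) • D i (mu (br (s - 2)) (lpp k g)) := by
    apply mu_ext
    intro ξ
    rw [FourierTransform.fourier_smul, FourierTransform.fourier_smul, D_eq_mu i (mu _ _)]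
    simp only [smul_apply, smul_eq_mul]
    rw [fourier_mu (D i κ).hasTemperateGrowth, fourier_mu (dsym_tg i), fourier_mu (br_tg _)]
    by_cases h0 : 𝓕 (lpp k g) ξ = 0
    · rw [h0]; simp
    · have e : D i κ ξ = fderiv ℝ (br s) ξ (EuclideanSpace.single i 1) := by
        rw [D_apply]
        congr 1
        exact (fat_fderiv (lpp_sp k g ξ h0) (lpp_spL hk g ξ h0) s).fderiv_eq
      rw [e, br_deriv, dsym]
      push_cast
      have : (π : ℂ) ≠ 0 := by exact_mod_cast Real.pi_ne_zero
      field_simp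
      rw [I_sq]; ring
  have h4 := congrArg (fun u : Sw n => u x) h3
  simpa using h4

lemma Sw_bdd (v : Sw n) : ∃ C, 0 ≤ C ∧ ∀ x, ‖v x‖ ≤ C := by
  obtain ⟨C, hC, h⟩ := schwartz_decay v 0
  exact ⟨C, hC.le, fun x => by simpa using h x⟩

lemma int_K {m : Eu n → ℂ} (hm : Ccs m) (v : Sw n) (x : Eu n) {P : Eu n → ℂ} (hP : Continuous P) {c : ℝ}
    (hc : ∀ z, ‖P z‖ ≤ c * (1 + ‖z‖)) :
    Integrable (fun z => 𝓕⁻ m z * (P z * v (x - z))) := by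
  obtain ⟨B, hB, hv⟩ := Sw_bdd v
  have hS : 𝓕⁻ m = ⇑(𝓕⁻ hm.S : Sw n) := by rw [SchwartzMap.fourierInv_coe]; rfl
  rw [hS]
  set S : Sw n := 𝓕⁻ hm.S
  have h1 : Integrable (fun z => ‖S z‖) := S.integrable.norm
  have h2 := S.integrable_pow_mul volume 1
  have h3 := (h1.add h2).const_mul (c * B)
  refine h3.mono' ?_ (Filter.Eventually.of_forall fun z => ?_)
  · have : Continuous fun z => S z * (P z * v (x - z)) :=
      S.continuous.mul (hP.mul (v.continuous.comp (continuous_const.sub continuous_id)))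
    exact this.aestronglyMeasurable
  · simp only [Pi.add_apply, pow_one]
    rw [norm_mul, norm_mul]
    calc ‖S z‖ * (‖P z‖ * ‖v (x - z)‖) ≤ ‖S z‖ * ((c * (1 + ‖z‖)) * B) := by
          have h0 : 0 ≤ c * (1 + ‖z‖) := (norm_nonneg _).trans (hc z)
          have := hc z
          have := hv (x - z)
          gcongr
      _ = _ := by ring

lemma prod_fat {j k : ℕ} (h : j + 3 ≤ k) (u : Sw n) (g : Sw n) (s : ℝ) (hu : Sp (2 * 2 ^ j) u) :
    mu (br s) (mulS u (lpp k g)) = mu (fun ξ => br s ξ * fat k ξ) (mulS u (lpp k g)) := by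
  have hk : k ≠ 0 := by omega
  have h8 : (8:ℝ) * 2 ^ j ≤ 2 ^ k := by
    calc (8:ℝ) * 2 ^ j = 2 ^ (j + 3) := by rw [pow_add]; norm_num; ring
      _ ≤ 2 ^ k := pow_le_pow_right₀ (by norm_num) h
  have hp : (0:ℝ) < 2 ^ j := by positivity
  apply mu_fat s
  · exact (Sp_mulS hu (lpp_sp k g)).mono (by linarith)
  · right
    intro ξ hξ
    have := SpL_mulS hu (lpp_spL hk g) ξ hξ
    linarith

lemma mulS_comm (f g : Sw n) : mulS f g = mulS g f := by
  ext x; simp [mul_comm]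

lemma pow_bd {l t : ℝ} (hl : 0 < l) (ht : 0 ≤ t) (i M : ℕ) :
    t ^ i * (1 + l * t) ^ M ≤ (l ^ i)⁻¹ * (1 + l * t) ^ (M + i) := by
  have h : t ≤ l⁻¹ * (1 + l * t) := by
    rw [mul_add, ← mul_assoc, inv_mul_cancel₀ hl.ne']; simp; positivity
  calc t ^ i * (1 + l * t) ^ M ≤ (l⁻¹ * (1 + l * t)) ^ i * (1 + l * t) ^ M := by gcongr
    _ = _ := by rw [mul_pow, pow_add, inv_pow]; ring

lemma PA (n N : ℕ) (s : ℝ) : ∃ C > 0, ∀ (j k : ℕ) (f g : Sw n) (x : Eu n) (A G : ℝ), 0 ≤ A → 0 ≤ G →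
    j + 3 ≤ k → (∀ i, Ctl N (2 ^ j) A (D i (lpp j f)) x) → Ctl N (2 ^ k) G (lpp k g) x →
    ‖TT s (lpp j f) (lpp k g) x‖ ≤ C * (((2:ℝ) ^ k) ^ s * ((2 ^ k) ^ 2)⁻¹ * 2 ^ j) * (A * G) := by
  obtain ⟨C1, hC1, hB⟩ := Bern n N
  obtain ⟨C2, hC2, hK⟩ := fat_kernel n s (N + N + 2 + n + 1)
  have hcI := cI_nonneg n
  refine ⟨C2 * n * n * C1 * cI n + 1, by positivity, ?_⟩
  intro j k f g x A G hA hG hjk hf hg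
  set u := lpp j f with hu
  set v := lpp k g with hv
  have hk0 : k ≠ 0 := by omega
  have hm : Ccs (fun ξ : Eu n => br s ξ * fat k ξ) := (fat_ccs k).mul_left (br_contDiff s)
  set K := 𝓕⁻ (fun ξ : Eu n => br s ξ * fat k ξ) with hKdef
  have e : TT s u v x = ∫ z, K z * ((u (x - z) - u x + ∑ i, (z i : ℂ) * D i u x) * v (x - z)) := by
    unfold TT
    rw [prod_fat hjk u g s (lpp_sp j f), mu_ker hm, lpp_fat, mu_ker hm]
    have e1 : (s : ℂ) * ∑ i, D i u x * D i (mu (br (s - 2)) (lpp k g)) x =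
        ∑ i, ∫ z, K z * (((z i : ℂ) * D i u x) * v (x - z)) := by
      rw [Finset.mul_sum]
      refine Finset.sum_congr rfl fun i _ => ?_
      rw [← mul_left_comm, ← moment_id hk0, ← integral_const_mul]
      congr 1; ext z; ring
    have i1 : Integrable fun z => K z * (u (x - z) * v (x - z)) := by
      obtain ⟨c, hc0, hc⟩ := Sw_bdd u
      refine int_K hm v x (u.continuous.comp (continuous_const.sub continuous_id)) (c := c) fun z => ?_
      refine (hc _).trans ?_
      nlinarith [norm_nonneg z]
    have i2 : Integrable fun z => K z * (u x * v (x - z)) := by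
      refine int_K hm v x continuous_const (c := ‖u x‖) fun z => ?_
      nlinarith [norm_nonneg z, norm_nonneg (u x)]
    have i3 : ∀ i, Integrable fun z => K z * (((z i : ℂ) * D i u x) * v (x - z)) := by
      intro i
      refine int_K hm v x (by fun_prop) (c := ‖D i u x‖) fun z => ?_
      rw [norm_mul, Complex.norm_real, mul_comm]
      gcongr
      have := PiLp.norm_apply_le z i
      linarith
    rw [hv, e1, ← integral_finsetSum _ (fun i _ => i3 i), ← integral_const_mul, ← hv]
    have i2' : Integrable fun z => u x * (K z * v (x - z)) := i2.congr
      (Filter.Eventually.of_forall fun z => by simp only; ring)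
    simp only [mulS_apply]
    have i4 : Integrable fun z => K z * (u (x - z) * v (x - z)) - u x * (K z * v (x - z)) := i1.sub i2'
    rw [← integral_sub i1 i2', ← integral_add i4 (integrable_finsetSum _ fun i _ => i3 i)]
    congr 1; ext z
    rw [← Finset.mul_sum, ← Finset.sum_mul]; ring
  have hDD : ∀ i m, Ctl N (2 ^ j) (C1 * 2 ^ j * A) (D m (D i u)) x := fun i m =>
    hB j (D i u) x A hA (((lpp_sp j f).D i).mono (by
      have : (0:ℝ) < 2 ^ j := by positivity
      linarith)) (hf i) m
  rw [e]
  have hlk : (0:ℝ) < 2 ^ k := by positivity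
  have hjk' : (2:ℝ) ^ j ≤ 2 ^ k := pow_le_pow_right₀ (by norm_num) (by omega)
  have hb : ∀ z, ‖(u (x - z) - u x + ∑ i, (z i : ℂ) * D i u x) * v (x - z)‖ ≤
      (n * n * (C1 * 2 ^ j * A) * G * ((2 ^ k) ^ 2)⁻¹) * (1 + 2 ^ k * ‖z‖) ^ (N + N + 2) := by
    intro z
    rw [norm_mul]
    calc _ ≤ (n * (n * (C1 * 2 ^ j * A) * (1 + 2 ^ j * ‖z‖) ^ N * ‖z‖) * ‖z‖) *
          (G * (1 + 2 ^ k * ‖z‖) ^ N) := by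
          gcongr
          · exact Tay2 (by positivity) (by positivity) hDD z
          · exact hg z
      _ ≤ (n * (n * (C1 * 2 ^ j * A) * (1 + 2 ^ k * ‖z‖) ^ N * ‖z‖) * ‖z‖) *
          (G * (1 + 2 ^ k * ‖z‖) ^ N) := by gcongr
      _ = (n * n * (C1 * 2 ^ j * A) * G) * (‖z‖ ^ 2 * (1 + 2 ^ k * ‖z‖) ^ (N + N)) := by
          rw [pow_add]; ring
      _ ≤ (n * n * (C1 * 2 ^ j * A) * G) * (((2 ^ k) ^ 2)⁻¹ * (1 + 2 ^ k * ‖z‖) ^ (N + N + 2)) := by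
          gcongr ?_ * ?_
          exact pow_bd hlk (norm_nonneg z) 2 (N + N)
      _ = _ := by ring
  refine (conv_bound le_rfl hlk (by positivity) (by positivity) (hK k) hb).trans ?_
  calc _ = (C2 * n * n * C1 * cI n) * (((2:ℝ) ^ k) ^ s * ((2 ^ k) ^ 2)⁻¹ * 2 ^ j) * (A * G) := by ring
    _ ≤ _ := by gcongr; linarith

lemma PB (n N : ℕ) (s : ℝ) : ∃ C > 0, ∀ (j k : ℕ) (f g : Sw n) (x : Eu n) (A G : ℝ), 0 ≤ A → 0 ≤ G →
    k + 3 ≤ j → Ctl N (2 ^ j) A (lpp j f) x → Ctl N (2 ^ k) G (lpp k g) x →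
    ‖mu (br s) (mulS (lpp j f) (lpp k g)) x - mu (br s) (lpp j f) x * lpp k g x‖ ≤
      C * (((2:ℝ) ^ j) ^ s * (2 ^ j)⁻¹ * 2 ^ k) * (A * G) := by
  obtain ⟨C1, hC1, hB⟩ := Bern n N
  obtain ⟨C2, hC2, hK⟩ := fat_kernel n s (N + N + 1 + n + 1)
  have hcI := cI_nonneg n
  refine ⟨C2 * n * C1 * cI n + 1, by positivity, ?_⟩
  intro j k f g x A G hA hG hjk hf hg
  set u := lpp j f with hu
  set v := lpp k g with hv
  have hm : Ccs (fun ξ : Eu n => br s ξ * fat j ξ) := (fat_ccs j).mul_left (br_contDiff s)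
  set K := 𝓕⁻ (fun ξ : Eu n => br s ξ * fat j ξ) with hKdef
  have e : mu (br s) (mulS u v) x - mu (br s) u x * v x = ∫ z, K z * ((v (x - z) - v x) * u (x - z)) := by
    rw [mulS_comm, prod_fat hjk v f s (lpp_sp k g), mu_ker hm, lpp_fat, mu_ker hm]
    have i1 : Integrable fun z => K z * (v (x - z) * u (x - z)) := by
      obtain ⟨c, hc0, hc⟩ := Sw_bdd v
      refine int_K hm u x (v.continuous.comp (continuous_const.sub continuous_id)) (c := c) fun z => ?_
      refine (hc _).trans ?_
      nlinarith [norm_nonneg z]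
    have i2 : Integrable fun z => K z * (v x * u (x - z)) := by
      refine int_K hm u x continuous_const (c := ‖v x‖) fun z => ?_
      nlinarith [norm_nonneg z, norm_nonneg (v x)]
    have i2' : Integrable fun z => (K z * u (x - z)) * v x := i2.congr
      (Filter.Eventually.of_forall fun z => by simp only; ring)
    rw [← integral_mul_const]
    simp only [mulS_apply]
    rw [← integral_sub i1 i2']
    congr 1; ext z
    ring
  have hD : ∀ i, Ctl N (2 ^ k) (C1 * 2 ^ k * G) (D i v) x := fun i =>
    hB k v x G hG ((lpp_sp k g).mono (by
      have : (0:ℝ) < 2 ^ k := by positivity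
      linarith)) hg i
  rw [e]
  have hlk : (0:ℝ) < 2 ^ j := by positivity
  have hjk' : (2:ℝ) ^ k ≤ 2 ^ j := pow_le_pow_right₀ (by norm_num) (by omega)
  have hb : ∀ z, ‖(v (x - z) - v x) * u (x - z)‖ ≤
      (n * (C1 * 2 ^ k * G) * A * (2 ^ j)⁻¹) * (1 + 2 ^ j * ‖z‖) ^ (N + N + 1) := by
    intro z
    rw [norm_mul]
    calc _ ≤ (n * (C1 * 2 ^ k * G) * (1 + 2 ^ k * ‖z‖) ^ N * ‖z‖) *
          (A * (1 + 2 ^ j * ‖z‖) ^ N) := by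
          gcongr
          · exact Tay1 (by positivity) (by positivity) hD z
          · exact hf z
      _ ≤ (n * (C1 * 2 ^ k * G) * (1 + 2 ^ j * ‖z‖) ^ N * ‖z‖) *
          (A * (1 + 2 ^ j * ‖z‖) ^ N) := by gcongr
      _ = (n * (C1 * 2 ^ k * G) * A) * (‖z‖ ^ 1 * (1 + 2 ^ j * ‖z‖) ^ (N + N)) := by
          rw [pow_add]; ring
      _ ≤ (n * (C1 * 2 ^ k * G) * A) * (((2 ^ j) ^ 1)⁻¹ * (1 + 2 ^ j * ‖z‖) ^ (N + N + 1)) := by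
          gcongr ?_ * ?_
          exact pow_bd hlk (norm_nonneg z) 1 (N + N)
      _ = _ := by rw [pow_one]; ring
  refine (conv_bound le_rfl hlk (by positivity) (by positivity) (hK j) hb).trans ?_
  calc _ = (C2 * n * C1 * cI n) * (((2:ℝ) ^ j) ^ s * (2 ^ j)⁻¹ * 2 ^ k) * (A * G) := by ring
    _ ≤ _ := by gcongr; linarith

/-- gradient dot term -/
lemma PC (n N : ℕ) (s : ℝ) : ∃ C > 0, ∀ (j k : ℕ) (f g : Sw n) (x : Eu n) (A G : ℝ), 0 ≤ A → 0 ≤ G →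
    (∀ i, Ctl N (2 ^ j) A (D i (lpp j f)) x) → Ctl N (2 ^ k) G (lpp k g) x →
    ‖∑ i, D i (lpp j f) x * D i (mu (br (s - 2)) (lpp k g)) x‖ ≤
      C * (((2:ℝ) ^ k) ^ (s - 2) * 2 ^ k) * (A * G) := by
  obtain ⟨C1, hC1, hB⟩ := Bern n N
  obtain ⟨C2, hC2, hM⟩ := Mult n N (s - 2)
  refine ⟨n * C1 * C2 + 1, by positivity, ?_⟩
  intro j k f g x A G hA hG hf hg
  have h1 := hM k g x G hG hg
  have h2 := hB k _ x _ (by positivity) (((lpp_sp k g).mu (br_tg (s - 2))).mono (by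
      have : (0:ℝ) < 2 ^ k := by positivity
      linarith)) h1
  refine (norm_sum_le _ _).trans ?_
  calc _ ≤ ∑ i : Fin n, A * (C1 * 2 ^ k * (C2 * ((2:ℝ) ^ k) ^ (s - 2) * G)) := by
        refine Finset.sum_le_sum fun i _ => ?_
        rw [norm_mul]
        gcongr
        · exact (hf i).at
        · exact (h2 i).at
    _ = (n * C1 * C2) * (((2:ℝ) ^ k) ^ (s - 2) * 2 ^ k) * (A * G) := by simp; ring
    _ ≤ _ := by gcongr; linarith

lemma mu_add (m : Eu n → ℂ) (f g : Sw n) : mu m (f + g) = mu m f + mu m g := map_add _ _ _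
lemma mu_sub (m : Eu n → ℂ) (f g : Sw n) : mu m (f - g) = mu m f - mu m g := map_sub _ _ _
lemma mu_sum {ι : Type*} (t : Finset ι) (m : Eu n → ℂ) (f : ι → Sw n) :
    mu m (∑ i ∈ t, f i) = ∑ i ∈ t, mu m (f i) := map_sum (SchwartzMap.fourierMultiplierCLM ℂ m) _ _

lemma D_mulS (i : Fin n) (u v : Sw n) : D i (mulS u v) = mulS (D i u) v + mulS u (D i v) := by
  ext x
  have h : (⇑(mulS u v) : Eu n → ℂ) = fun y => u y * v y := by ext y; simp
  rw [D_apply, h, fderiv_fun_mul u.differentiableAt v.differentiableAt]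
  simp [D_apply]; ring

lemma D_add (i : Fin n) (u v : Sw n) : D i (u + v) = D i u + D i v := by
  rw [D_eq_mu, D_eq_mu, D_eq_mu, mu_add]

lemma br_two (w : Sw n) : mu (br 2) w = w - ∑ i, D i (D i w) := by
  apply mu_ext
  intro ξ
  have e : 𝓕 (w - ∑ i, D i (D i w)) = 𝓕 w - ∑ i, 𝓕 (D i (D i w)) := by
    have := map_sub (FourierTransform.fourierCLM ℂ (Sw n)) w (∑ i, D i (D i w))
    rw [map_sum] at this
    exact this
  rw [e, fourier_mu (br_tg 2)]
  simp only [D_eq_mu, sub_apply, sum_apply, fourier_mu (dsym_tg _)]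
  have : (br 2 ξ : ℂ) = 1 - ∑ i, dsym i ξ * dsym i ξ := by
    simp only [br, dsym]
    rw [EuclideanSpace.norm_sq_eq]
    norm_num
    rw [Finset.mul_sum, ← sub_neg_eq_add, ← Finset.sum_neg_distrib]
    congr 1
    refine Finset.sum_congr rfl fun i _ => ?_
    norm_cast
    push_cast
    ring_nf
    rw [I_sq]
    push_cast
    ring
  rw [this, sub_mul, Finset.sum_mul, one_mul]
  congr 1
  refine Finset.sum_congr rfl fun i _ => by ring

lemma br_add (s t : ℝ) (ξ : Eu n) : br s ξ * br t ξ = br (s + t) ξ := by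
  simp only [br]
  rw [← Complex.ofReal_mul, ← Real.rpow_add (by positivity)]
  congr 2; ring

lemma mu_br_br (s t : ℝ) (w : Sw n) : mu (br s) (mu (br t) w) = mu (br (s + t)) w := by
  rw [mu_mu (br_tg s) (br_tg t)]
  congr 1; ext ξ; exact br_add s t ξ

lemma mu_br_zero (w : Sw n) : mu (br 0) w = w := by
  apply mu_ext; intro ξ; rw [fourier_mu (br_tg 0)]; simp [br]

/-- Pointwise bound for even powers on products. -/
lemma PE (n N m : ℕ) : ∃ C > 0, ∀ (j : ℕ) (u v : Sw n) (x : Eu n) (A B : ℝ), 0 ≤ A → 0 ≤ B →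
    Sp (8 * 2 ^ j) u → Sp (8 * 2 ^ j) v → Ctl N (2 ^ j) A u x → Ctl N (2 ^ j) B v x →
    ‖mu (br (2 * m)) (mulS u v) x‖ ≤ C * (2 ^ j) ^ (2 * m) * (A * B) := by
  obtain ⟨C1, hC1, hB⟩ := Bern n N
  induction m with
  | zero =>
    refine ⟨1, one_pos, fun j u v x A B hA hB' _ _ hu hv => ?_⟩
    simp only [Nat.cast_zero, mul_zero, mu_br_zero, pow_zero, mul_one, one_mul, mulS_apply, norm_mul]
    gcongr
    · exact hu.at
    · exact hv.at
  | succ m ih =>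
    obtain ⟨C, hC, ih⟩ := ih
    refine ⟨C * (1 + n * (4 * C1 ^ 2)), by positivity, ?_⟩
    intro j u v x A B hA hB' su sv hu hv
    have hj1 : (1:ℝ) ≤ 2 ^ j := one_le_pow₀ (by norm_num)
    have e : mu (br (2 * (m + 1 : ℕ))) (mulS u v) = mu (br (2 * m)) (mulS u v) -
        ∑ i, (mu (br (2 * m)) (mulS (D i (D i u)) v) + mu (br (2 * m)) (mulS (D i u) (D i v)) +
          (mu (br (2 * m)) (mulS (D i u) (D i v)) + mu (br (2 * m)) (mulS u (D i (D i v))))) := by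
      have : (2 * ((m + 1 : ℕ) : ℝ)) = 2 * m + 2 := by push_cast; ring
      rw [this, ← mu_br_br, br_two, mu_sub, mu_sum]
      simp only [D_mulS, D_add, mu_add]
    rw [e, sub_apply, sum_apply]
    have hu1 : ∀ i, Ctl N (2 ^ j) (C1 * 2 ^ j * A) (D i u) x := hB j u x A hA su hu
    have hv1 : ∀ i, Ctl N (2 ^ j) (C1 * 2 ^ j * B) (D i v) x := hB j v x B hB' sv hv
    have hu2 : ∀ i, Ctl N (2 ^ j) (C1 * 2 ^ j * (C1 * 2 ^ j * A)) (D i (D i u)) x := fun i =>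
      hB j _ x _ (by positivity) (su.D i) (hu1 i) i
    have hv2 : ∀ i, Ctl N (2 ^ j) (C1 * 2 ^ j * (C1 * 2 ^ j * B)) (D i (D i v)) x := fun i =>
      hB j _ x _ (by positivity) (sv.D i) (hv1 i) i
    have b0 := ih j u v x A B hA hB' su sv hu hv
    have b1 := fun i => ih j _ _ x _ _ (by positivity) hB' ((su.D i).D i) sv (hu2 i) hv
    have b2 := fun i => ih j _ _ x _ _ (by positivity) (by positivity) (su.D i) (sv.D i) (hu1 i) (hv1 i)
    have b3 := fun i => ih j _ _ x _ _ hA (by positivity) su ((sv.D i).D i) hu (hv2 i)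
    have hs : ‖∑ i, (mu (br (2 * m)) (mulS (D i (D i u)) v) + mu (br (2 * m)) (mulS (D i u) (D i v)) +
          (mu (br (2 * m)) (mulS (D i u) (D i v)) + mu (br (2 * m)) (mulS u (D i (D i v))))) x‖
        ≤ ∑ i : Fin n, 4 * C1 ^ 2 * (C * (2 ^ j) ^ (2 * (m + 1)) * (A * B)) := by
      refine (norm_sum_le _ _).trans (Finset.sum_le_sum fun i _ => ?_)
      simp only [add_apply]
      have t1 := b1 i
      have t2 := b2 i
      have t3 := b3 i
      refine (norm_add_le _ _).trans ?_
      refine (add_le_add (norm_add_le _ _) (norm_add_le _ _)).trans ?_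
      refine (add_le_add (add_le_add t1 t2) (add_le_add t2 t3)).trans (le_of_eq ?_)
      rw [show 2 * (m + 1) = 2 * m + 2 by ring, pow_add]
      ring
    refine (norm_sub_le _ _).trans ?_
    refine (add_le_add b0 hs).trans ?_
    simp only [Finset.sum_const, Finset.card_univ, Fintype.card_fin, nsmul_eq_mul]
    have : C * ((2:ℝ) ^ j) ^ (2 * m) * (A * B) ≤ C * (2 ^ j) ^ (2 * (m + 1)) * (A * B) := by
      gcongr
      omega
    linarith

def Wt (b : ℝ) (x : Eu n) : ℝ := (1 + ‖x‖ ^ 2) ^ (b / 2)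

lemma Wt_pos (b : ℝ) (x : Eu n) : 0 < Wt b x := by unfold Wt; positivity

lemma Wt_cont (b : ℝ) : Continuous (Wt b : Eu n → ℝ) := by
  unfold Wt
  exact Continuous.rpow_const (by fun_prop) fun x => Or.inl (by positivity)

lemma Wt_add (b c : ℝ) (x : Eu n) : Wt (b + c) x = Wt b x * Wt c x := by
  unfold Wt; rw [← Real.rpow_add (by positivity)]; congr 1; ring

lemma Wt_peetre {b : ℝ} (hb : 0 ≤ b) {β : ℕ} (hβ : b ≤ β) (x z : Eu n) :
    Wt b x ≤ (1 + ‖z‖) ^ β * Wt b (x - z) := by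
  have h0 : 0 ≤ ‖z‖ := norm_nonneg z
  have h1 : ‖x‖ ≤ ‖x - z‖ + ‖z‖ := by simpa using norm_add_le (x - z) z
  have h : 1 + ‖x‖ ^ 2 ≤ (1 + ‖z‖) ^ 2 * (1 + ‖x - z‖ ^ 2) := by
    have : ‖x‖ ^ 2 ≤ (‖x - z‖ + ‖z‖) ^ 2 := by gcongr
    nlinarith [sq_nonneg (‖x - z‖ - 1), sq_nonneg (‖x - z‖), mul_nonneg h0 (sq_nonneg (‖x - z‖ - 1)),
      mul_nonneg (sq_nonneg ‖z‖) (sq_nonneg ‖x - z‖), mul_nonneg h0 (norm_nonneg (x - z))]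
  unfold Wt
  calc (1 + ‖x‖ ^ 2) ^ (b / 2) ≤ ((1 + ‖z‖) ^ 2 * (1 + ‖x - z‖ ^ 2)) ^ (b / 2) := by gcongr
    _ = (1 + ‖z‖) ^ b * (1 + ‖x - z‖ ^ 2) ^ (b / 2) := by
        rw [Real.mul_rpow (by positivity) (by positivity), ← Real.rpow_natCast, ← Real.rpow_mul (by positivity)]
        congr 2; push_cast; ring
    _ ≤ _ := by
        gcongr
        rw [← Real.rpow_natCast]
        exact Real.rpow_le_rpow_of_exponent_le (by linarith) hβ

def nm {F : Type*} [NormedAddCommGroup F] [NormedSpace ℝ F] (p : ℝ≥0∞) (b : ℝ) (u : Eu n → F) : ℝ≥0∞ :=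
  eLpNorm (fun x => Wt b x • u x) p volume

lemma nm_mono {F G : Type*} [NormedAddCommGroup F] [NormedSpace ℝ F] [NormedAddCommGroup G] [NormedSpace ℝ G]
    (p : ℝ≥0∞) (b : ℝ) {u : Eu n → F} {v : Eu n → G} {C : ℝ} (h : ∀ x, ‖u x‖ ≤ C * ‖v x‖) :
    nm p b u ≤ ENNReal.ofReal C * nm p b v := by
  refine eLpNorm_le_mul_eLpNorm_of_ae_le_mul (Filter.Eventually.of_forall fun x => ?_) p
  rw [norm_smul, norm_smul]
  calc _ ≤ ‖Wt b x‖ * (C * ‖v x‖) := by gcongr; exact h x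
    _ = _ := by ring

lemma nm_norm {F : Type*} [NormedAddCommGroup F] [NormedSpace ℝ F] (p : ℝ≥0∞) (b : ℝ) (u : Eu n → F) :
    nm p b (fun x => ‖u x‖) = nm p b u := by
  apply eLpNorm_congr_norm_ae
  exact Filter.Eventually.of_forall fun x => by simp [norm_smul]

lemma nm_holder {p p₁ p₂ : ℝ≥0∞} (h : 1 / p = 1 / p₁ + 1 / p₂) (b₁ b₂ : ℝ) {u v : Eu n → ℝ}
    (hu : Continuous u) (hv : Continuous v) :
    nm p (b₁ + b₂) (fun x => u x * v x) ≤ nm p₁ b₁ u * nm p₂ b₂ v := by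
  have : ENNReal.HolderTriple p₁ p₂ p := ⟨by simpa using h.symm⟩
  have := eLpNorm_le_eLpNorm_mul_eLpNorm_of_nnnorm (μ := volume) (p := p₁) (q := p₂) (r := p)
    (f := fun x : Eu n => Wt b₁ x • u x) (g := fun x => Wt b₂ x • v x)
    ((Wt_cont b₁).smul hu).aestronglyMeasurable ((Wt_cont b₂).smul hv).aestronglyMeasurable
    (fun a b => a * b) 1 (Filter.Eventually.of_forall fun x => by simp)
  simp only [ENNReal.coe_one, one_mul] at this
  refine le_trans (le_of_eq ?_) this
  unfold nm
  congr 1; ext x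
  simp only [smul_eq_mul, Wt_add]; ring

def qq (p : ℝ≥0∞) : ℝ := (min 1 p).toReal

lemma qq_of_one_le {p : ℝ≥0∞} (h : 1 ≤ p) : qq p = 1 := by simp [qq, h]
lemma qq_of_lt {p : ℝ≥0∞} (h : p < 1) : qq p = p.toReal := by simp [qq, h.le]
lemma qq_pos {p : ℝ≥0∞} (h : p ≠ 0) : 0 < qq p := by
  apply ENNReal.toReal_pos
  · simp [h]
  · exact (lt_of_le_of_lt (min_le_left _ _) ENNReal.one_lt_top).ne
lemma nm_add {p : ℝ≥0∞} (hp : p ≠ 0) (b : ℝ) {u v : Eu n → ℂ} (hu : Continuous u) (hv : Continuous v) :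
    nm p b (fun x => u x + v x) ^ qq p ≤ nm p b u ^ qq p + nm p b v ^ qq p := by
  have mu : AEStronglyMeasurable (fun x => Wt b x • u x) volume := ((Wt_cont b).smul hu).aestronglyMeasurable
  have mv : AEStronglyMeasurable (fun x => Wt b x • v x) volume := ((Wt_cont b).smul hv).aestronglyMeasurable
  have e : (fun x => Wt b x • (u x + v x)) = (fun x => Wt b x • u x) + fun x => Wt b x • v x := by
    ext x; simp [smul_add]
  unfold nm
  rw [e]
  rcases lt_or_ge p 1 with h | h
  · have htop : p ≠ ⊤ := (h.trans ENNReal.one_lt_top).ne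
    have h0 := ENNReal.toReal_pos hp htop
    rw [qq_of_lt h]
    have h1 : p.toReal ≤ 1 := by simpa using ENNReal.toReal_mono ENNReal.one_ne_top h.le
    simp only [eLpNorm_eq_lintegral_rpow_enorm_toReal hp htop, ← ENNReal.rpow_mul, one_div, inv_mul_cancel₀ h0.ne',
      ENNReal.rpow_one]
    rw [← lintegral_add_left' (mu.enorm.pow_const _)]
    refine lintegral_mono fun x => ?_
    refine le_trans ?_ (ENNReal.rpow_add_le_add_rpow _ _ h0.le h1)
    gcongr
    exact enorm_add_le _ _
  · simp only [qq_of_one_le h, ENNReal.rpow_one]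
    exact eLpNorm_add_le mu mv h

lemma nm_sum {p : ℝ≥0∞} (hp : p ≠ 0) (b : ℝ) {ι : Type*} (t : Finset ι) {u : ι → Eu n → ℂ}
    (hu : ∀ i, Continuous (u i)) :
    nm p b (fun x => ∑ i ∈ t, u i x) ^ qq p ≤ ∑ i ∈ t, nm p b (u i) ^ qq p := by
  classical
  induction t using Finset.induction_on with
  | empty => simp [nm, qq_pos hp]
  | insert i t hi ih =>
    simp only [Finset.sum_insert hi]
    exact (nm_add hp b (hu i) (continuous_finsetSum t fun j _ => hu j)).trans (by gcongr)

lemma nm_fatou (p : ℝ≥0∞) (b : ℝ) {u : ℕ → Eu n → ℂ} {v : Eu n → ℂ} (hu : ∀ i, Continuous (u i))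
    (h : ∀ x, Filter.Tendsto (fun i => u i x) Filter.atTop (nhds (v x))) {B : ℝ≥0∞} (hB : ∀ i, nm p b (u i) ≤ B) :
    nm p b v ≤ B := by
  refine (Lp.eLpNorm_lim_le_liminf_eLpNorm (fun i => ((Wt_cont b).smul (hu i)).aestronglyMeasurable) _
    (Filter.Eventually.of_forall fun x => (h x).const_smul (Wt b x))).trans ?_
  exact Filter.liminf_le_of_frequently_le' (Filter.Frequently.of_forall hB)

lemma wNorm_eq {F : Type*} [NormedAddCommGroup F] [NormedSpace ℝ F] {p : ℝ≥0∞} (hp : p ≠ 0) (a : ℝ) (f : Eu n → F) :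
    wNorm p a f = nm p (a / p.toReal) f := by
  unfold wNorm nm
  split_ifs with h
  · subst h
    simp [eLpNormEssSup, Wt, enorm_eq_nnnorm]
  · rw [eLpNorm_eq_lintegral_rpow_enorm_toReal hp h]
    congr 1
    refine lintegral_congr fun x => ?_
    have h0 := ENNReal.toReal_pos hp h
    rw [enorm_smul, ENNReal.mul_rpow_of_nonneg _ _ h0.le, mul_comm]
    congr 1
    rw [Real.enorm_eq_ofReal (Wt_pos _ _).le, ENNReal.ofReal_rpow_of_nonneg (Wt_pos _ _).le h0.le, jweight, Wt,
      ← Real.rpow_mul (by positivity)]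
    congr 2
    field_simp

def Kl (n M : ℕ) (l : ℝ) (z : Eu n) : ℝ≥0∞ := ENNReal.ofReal (Ker n M l ‖z‖)
def CV (M : ℕ) (l : ℝ) (V : Eu n → ℝ≥0∞) (x : Eu n) : ℝ≥0∞ := ∫⁻ z, Kl n M l z * V (x - z)

lemma Ker_cont {M : ℕ} {l : ℝ} (hl : 0 < l) : Continuous (fun z : Eu n => Ker n M l ‖z‖) := by
  unfold Ker
  refine Continuous.div (by fun_prop) (by fun_prop) fun z => ?_
  have : 0 < 1 + l * ‖z‖ := by positivity
  positivity

lemma Kl_meas {M : ℕ} {l : ℝ} (hl : 0 < l) : Measurable (Kl n M l) :=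
  ENNReal.measurable_ofReal.comp (Ker_cont hl).measurable

lemma Kl_lint {l : ℝ} (hl : 0 < l) : ∫⁻ z, Kl n (n + 1) l z = ENNReal.ofReal (cI n) := by
  rw [← Ker_integral hl, ofReal_integral_eq_lintegral_ofReal (Ker_integrable hl)]
  · rfl
  · exact Filter.Eventually.of_forall fun z => Ker_nonneg hl (norm_nonneg _)

lemma tonelli {K V : Eu n → ℝ≥0∞} (hK : Measurable K) (hV : Measurable V) :
    ∫⁻ x, ∫⁻ z, K z * V (x - z) = (∫⁻ z, K z) * ∫⁻ x, V x := by
  rw [lintegral_lintegral_swap, ← lintegral_mul_const _ hK]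
  · refine lintegral_congr fun z => ?_
    rw [lintegral_const_mul _ (by fun_prop), lintegral_sub_right_eq_self V z]
  · apply Measurable.aemeasurable
    fun_prop

lemma YG1 {p : ℝ≥0∞} (hp : 1 ≤ p) {l : ℝ} (hl : 0 < l) {V : Eu n → ℝ≥0∞} (hV : Measurable V) :
    eLpNorm (CV (n + 1) l V) p volume ≤ ENNReal.ofReal (cI n) * eLpNorm V p volume := by
  have hK := Kl_meas (n := n) (M := n + 1) hl
  by_cases htop : p = ⊤
  · subst htop
    rw [eLpNorm_exponent_top, eLpNorm_exponent_top]
    refine eLpNormEssSup_le_of_ae_enorm_bound (Filter.Eventually.of_forall fun x => ?_)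
    rw [enorm_eq_self, ← Kl_lint hl, ← lintegral_mul_const _ hK]
    refine lintegral_mono_ae ?_
    have h1 := enorm_ae_le_eLpNormEssSup V volume
    have h2 := (quasiMeasurePreserving_sub_left volume x).ae h1
    filter_upwards [h2] with z hz
    gcongr
    simpa using hz
  · have hp0 : p ≠ 0 := (zero_lt_one.trans_le hp).ne'
    have h1 : 1 ≤ p.toReal := by simpa using ENNReal.toReal_mono htop hp
    have h0 : 0 < p.toReal := by linarith
    set q := p.toReal with hq
    have key : ∀ x, CV (n + 1) l V x ^ q ≤ ENNReal.ofReal (cI n) ^ (q - 1) * ∫⁻ z, Kl n (n + 1) l z * V (x - z) ^ q := by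
      intro x
      have := eLpNorm'_le_eLpNorm'_mul_rpow_measure_univ (p := 1) (q := q) one_pos h1
        (μ := volume.withDensity (Kl n (n + 1) l)) (f := fun z => V (x - z))
        (by apply Measurable.aestronglyMeasurable; fun_prop)
      rw [eLpNorm'_eq_lintegral_enorm, eLpNorm'_eq_lintegral_enorm, withDensity_apply _ MeasurableSet.univ,
        setLIntegral_univ, Kl_lint hl] at this
      simp only [enorm_eq_self, ENNReal.rpow_one, div_one] at this
      rw [lintegral_withDensity_eq_lintegral_mul _ hK (by fun_prop),
        lintegral_withDensity_eq_lintegral_mul _ hK (by fun_prop)] at this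
      calc CV (n + 1) l V x ^ q ≤ _ := by
            exact ENNReal.rpow_le_rpow this h0.le
        _ = _ := by
            rw [ENNReal.mul_rpow_of_nonneg _ _ h0.le, ← ENNReal.rpow_mul, ← ENNReal.rpow_mul, one_div,
              inv_mul_cancel₀ h0.ne', ENNReal.rpow_one, mul_comm]
            congr 2
            field_simp
    rw [eLpNorm_eq_lintegral_rpow_enorm_toReal hp0 htop, eLpNorm_eq_lintegral_rpow_enorm_toReal hp0 htop]
    simp only [enorm_eq_self]
    rw [← hq]
    calc (∫⁻ x, CV (n + 1) l V x ^ q) ^ (1 / q)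
        ≤ (∫⁻ x, ENNReal.ofReal (cI n) ^ (q - 1) * ∫⁻ z, Kl n (n + 1) l z * V (x - z) ^ q) ^ (1 / q) := by
          gcongr with x; exact key x
      _ = (ENNReal.ofReal (cI n) ^ (q - 1) * (ENNReal.ofReal (cI n) * ∫⁻ x, V x ^ q)) ^ (1 / q) := by
          rw [lintegral_const_mul', tonelli (V := fun x => V x ^ q) hK (by fun_prop), Kl_lint hl]
          exact ENNReal.rpow_ne_top_of_nonneg (by linarith) ENNReal.ofReal_ne_top
      _ = _ := by
          rw [← mul_assoc, ENNReal.mul_rpow_of_nonneg _ _ (by positivity)]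
          congr 1
          rcases eq_or_lt_of_le (cI_nonneg n) with h | h
          · rw [← h]; simp [h0]
          · have : ENNReal.ofReal (cI n) ^ (q - 1) * ENNReal.ofReal (cI n) = ENNReal.ofReal (cI n) ^ q := by
              nth_rw 2 [← ENNReal.rpow_one (ENNReal.ofReal (cI n))]
              rw [← ENNReal.rpow_add _ _ (by simpa using h) ENNReal.ofReal_ne_top]
              congr 1; ring
            rw [this, ← ENNReal.rpow_mul, mul_one_div_cancel h0.ne', ENNReal.rpow_one]

/-- scaling of the kernel mass, any exponent -/
lemma Kl_scale {M : ℕ} {l : ℝ} (hl : 0 < l) : ∫⁻ z, Kl n M l z = ∫⁻ z, Kl n M 1 z := by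
  have h : ∫⁻ z, Kl n M 1 (l • z) = ENNReal.ofReal |(l ^ (Module.finrank ℝ (Eu n)))⁻¹| * ∫⁻ z, Kl n M 1 z := by
    rw [← lintegral_map (Kl_meas one_pos) (measurable_const_smul l),
      MeasureTheory.Measure.map_addHaar_smul volume hl.ne', lintegral_smul_measure, smul_eq_mul]
  have e : ∀ z, Kl n M l z = ENNReal.ofReal (l ^ n) * Kl n M 1 (l • z) := by
    intro z
    unfold Kl
    rw [Ker_scale hl, ENNReal.ofReal_mul (by positivity)]
  simp only [e]
  rw [lintegral_const_mul' _ _ ENNReal.ofReal_ne_top, h]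
  rw [← mul_assoc]
  simp only [finrank_euclideanSpace, Fintype.card_fin]
  rw [abs_of_pos (by positivity), ← ENNReal.ofReal_mul (by positivity), mul_inv_cancel₀ (by positivity)]
  simp

lemma Kl_pos (M : ℕ) : ∫⁻ z, Kl n M 1 z ≠ 0 := by
  intro h
  rw [lintegral_eq_zero_iff (Kl_meas one_pos)] at h
  obtain ⟨z, hz⟩ := h.exists
  simp only [Kl, Pi.zero_apply, ENNReal.ofReal_eq_zero] at hz
  have : 0 < Ker n M 1 ‖z‖ := by unfold Ker; positivity
  linarith

lemma Kl_mono {M M' : ℕ} (h : M ≤ M') {l : ℝ} (hl : 0 < l) (z : Eu n) : Kl n M' l z ≤ Kl n M l z := by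
  unfold Kl Ker
  gcongr
  have : 0 ≤ l * ‖z‖ := by positivity
  linarith

lemma Kl_fin {M : ℕ} (h : n + 1 ≤ M) {l : ℝ} (hl : 0 < l) : ∫⁻ z, Kl n M l z ≠ ⊤ := by
  refine ne_top_of_le_ne_top ?_ (lintegral_mono fun z => Kl_mono h hl z)
  rw [Kl_lint hl]; exact ENNReal.ofReal_ne_top

lemma inv_pow_subm {l L a b : ℝ} (hl : 0 < l) (hL : l ≤ L) (ha : 0 ≤ a) (hb : 0 ≤ b) {c : ℝ} (hc0 : 0 ≤ c) (hc : c ≤ a + b) (M : ℕ) :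
    ((1 + l * a) ^ M)⁻¹ * ((1 + L * b) ^ M)⁻¹ ≤ ((1 + l * c) ^ M)⁻¹ := by
  have hL0 : 0 < L := hl.trans_le hL
  rw [← mul_inv, ← mul_pow]
  gcongr
  have h1 : l * c ≤ l * (a + b) := by gcongr
  have h2 : l * b ≤ L * b := by gcongr
  nlinarith [mul_nonneg (mul_nonneg hl.le ha) (mul_nonneg hL0.le hb)]

lemma YGs (n N' : ℕ) {p : ℝ≥0∞} (hp : 2⁻¹ ≤ p) (hp1 : p < 1) : ∃ C > 0, ∀ l L : ℝ, 0 < l → l ≤ L →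
    ∀ V : Eu n → ℝ≥0∞, Measurable V → (∀ x w, V x ≤ V (x - w) * ENNReal.ofReal ((1 + L * ‖w‖) ^ N')) →
    eLpNorm (CV (2 * n + 2) l V) p volume ≤
      ENNReal.ofReal (C * (L / l) ^ ((n:ℝ) * (1 / p.toReal - 1))) * eLpNorm V p volume := by
  set M := 2 * n + 2 with hM
  set q := p.toReal with hq
  have htop : p ≠ ⊤ := (hp1.trans ENNReal.one_lt_top).ne
  have hp0 : p ≠ 0 := by rintro rfl; simp at hp
  have hq1 : q < 1 := by
    have := (ENNReal.toReal_lt_toReal htop ENNReal.one_ne_top).2 hp1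
    simpa using this
  have hq2 : 1 / 2 ≤ q := by
    have := ENNReal.toReal_mono htop hp
    simpa using this
  have hq0 : 0 < q := by linarith
  set c1 : ℝ≥0∞ := ∫⁻ z, Kl n (N' + M) 1 z with hc1
  have hc10 : c1 ≠ 0 := Kl_pos _
  have hc1t : c1 ≠ ⊤ := Kl_fin (by omega) one_pos
  set cc : ℝ≥0∞ := ((c1⁻¹) ^ (1 - q) * ENNReal.ofReal (cI n)) ^ (1 / q) with hcc
  have hcct : cc ≠ ⊤ := by
    apply ENNReal.rpow_ne_top_of_nonneg (by positivity)
    apply ENNReal.mul_ne_top _ ENNReal.ofReal_ne_top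
    apply ENNReal.rpow_ne_top_of_nonneg (by linarith)
    simpa using hc10
  refine ⟨cc.toReal + 1, by positivity, ?_⟩
  intro l L hl hL V hV hslow
  have hL0 : 0 < L := hl.trans_le hL
  set κ : Eu n → ℝ≥0∞ := fun z => ENNReal.ofReal (((1 + l * ‖z‖) ^ M)⁻¹) with hκ
  have hκm : Measurable κ := by
    apply ENNReal.measurable_ofReal.comp
    fun_prop
  have hKl : ∀ z, Kl n M l z = ENNReal.ofReal (l ^ n) * κ z := by
    intro z
    simp only [Kl, Ker, hκ]
    rw [← ENNReal.ofReal_mul (by positivity), div_eq_mul_inv]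
  set W : Eu n → ℝ≥0∞ := fun x => ∫⁻ z, (κ z * V (x - z)) ^ q with hW
  have step1 : ∀ x z, (κ z * V (x - z)) ^ q * c1 ≤ ENNReal.ofReal (L ^ n) * W x := by
    intro x z
    have hw : ∀ w, (κ z * V (x - z)) ^ q * ENNReal.ofReal (((1 + L * ‖w‖) ^ (N' + M))⁻¹) ≤
        (κ (z + w) * V (x - (z + w))) ^ q := by
      intro w
      set t := ENNReal.ofReal (((1 + L * ‖w‖) ^ (N' + M))⁻¹) with ht
      have hone : (1:ℝ) ≤ 1 + L * ‖w‖ := by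
        have : 0 ≤ L * ‖w‖ := by positivity
        linarith
      have ht1 : t ≤ 1 := by
        rw [ht]
        exact ENNReal.ofReal_le_one.2 (inv_le_one_of_one_le₀ (one_le_pow₀ hone))
      have ht2 : t ≤ t ^ q := by
        nth_rw 1 [← ENNReal.rpow_one t]
        exact ENNReal.rpow_le_rpow_of_exponent_ge ht1 hq1.le
      have e : t = ENNReal.ofReal (((1 + L * ‖w‖) ^ N')⁻¹) * ENNReal.ofReal (((1 + L * ‖w‖) ^ M)⁻¹) := by
        rw [ht, ← ENNReal.ofReal_mul (by positivity), pow_add, mul_inv]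
      calc _ ≤ (κ z * V (x - z)) ^ q * t ^ q := by gcongr
        _ = (κ z * V (x - z) * t) ^ q := (ENNReal.mul_rpow_of_nonneg _ _ hq0.le).symm
        _ ≤ _ := by
          refine ENNReal.rpow_le_rpow ?_ hq0.le
          have a1 : κ z * ENNReal.ofReal (((1 + L * ‖w‖) ^ M)⁻¹) ≤ κ (z + w) := by
            simp only [hκ]
            rw [← ENNReal.ofReal_mul (by positivity)]
            exact ENNReal.ofReal_le_ofReal
              (inv_pow_subm hl hL (norm_nonneg _) (norm_nonneg _) (norm_nonneg _) (norm_add_le _ _) M)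
          have a2 : V (x - z) * ENNReal.ofReal (((1 + L * ‖w‖) ^ N')⁻¹) ≤ V (x - (z + w)) := by
            have := hslow (x - z) w
            rw [sub_sub] at this
            rw [ENNReal.ofReal_inv_of_pos (by positivity), ← div_eq_mul_inv]
            exact ENNReal.div_le_of_le_mul this
          calc κ z * V (x - z) * t = (κ z * ENNReal.ofReal (((1 + L * ‖w‖) ^ M)⁻¹)) *
                (V (x - z) * ENNReal.ofReal (((1 + L * ‖w‖) ^ N')⁻¹)) := by rw [e]; ring
            _ ≤ _ := mul_le_mul' a1 a2
    have e1 : c1 = ENNReal.ofReal (L ^ n) * ∫⁻ w : Eu n, ENNReal.ofReal (((1 + L * ‖w‖) ^ (N' + M))⁻¹) := by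
      rw [hc1, ← Kl_scale hL0, ← lintegral_const_mul' _ _ ENNReal.ofReal_ne_top]
      refine lintegral_congr fun w => ?_
      rw [← ENNReal.ofReal_mul (by positivity), Kl, Ker, div_eq_mul_inv]
    rw [e1, mul_left_comm]
    gcongr
    rw [hW]
    simp only
    rw [← lintegral_add_left_eq_self (fun z => (κ z * V (x - z)) ^ q) z, ← lintegral_const_mul]
    · exact lintegral_mono hw
    · apply ENNReal.measurable_ofReal.comp
      fun_prop
  have step2 : ∀ x, CV M l V x ^ q ≤ ENNReal.ofReal (l ^ n) ^ q * (ENNReal.ofReal (L ^ n) * c1⁻¹) ^ (1 - q) * W x := by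
    intro x
    set B := ENNReal.ofReal (L ^ n) * W x * c1⁻¹ with hB
    have hb : ∀ z, (κ z * V (x - z)) ^ q ≤ B := by
      intro z
      rw [hB, ← div_eq_mul_inv, ENNReal.le_div_iff_mul_le (Or.inl hc10) (Or.inl hc1t)]
      exact step1 x z
    have h1 : CV M l V x ≤ ENNReal.ofReal (l ^ n) * (B ^ ((1 - q) / q) * W x) := by
      unfold CV
      simp only [hKl, mul_assoc]
      rw [lintegral_const_mul' _ _ ENNReal.ofReal_ne_top]
      gcongr
      rw [hW]
      simp only
      rw [← lintegral_const_mul _ (by fun_prop)]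
      refine lintegral_mono fun z => ?_
      calc κ z * V (x - z) = ((κ z * V (x - z)) ^ q) ^ ((1 - q) / q) * (κ z * V (x - z)) ^ q := by
            rw [← ENNReal.rpow_mul, ← ENNReal.rpow_add_of_nonneg]
            · rw [mul_div_cancel₀ _ hq0.ne', sub_add_cancel, ENNReal.rpow_one]
            · rw [mul_div_cancel₀ _ hq0.ne']; linarith
            · exact hq0.le
        _ ≤ _ := by
            refine mul_le_mul_left (ENNReal.rpow_le_rpow (hb z) (div_nonneg (by linarith) hq0.le)) _
    calc CV M l V x ^ q ≤ (ENNReal.ofReal (l ^ n) * (B ^ ((1 - q) / q) * W x)) ^ q := by gcongr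
      _ = ENNReal.ofReal (l ^ n) ^ q * (B ^ (1 - q) * W x ^ q) := by
          rw [ENNReal.mul_rpow_of_nonneg _ _ hq0.le, ENNReal.mul_rpow_of_nonneg _ _ hq0.le, ← ENNReal.rpow_mul,
            div_mul_cancel₀ _ hq0.ne']
      _ = _ := by
          rw [hB, mul_right_comm, ENNReal.mul_rpow_of_nonneg _ _ (by linarith : 0 ≤ 1 - q), mul_assoc, mul_assoc]
          congr 2
          rw [← ENNReal.rpow_add_of_nonneg _ _ (by linarith) hq0.le, sub_add_cancel, ENNReal.rpow_one]
  have step3 : ENNReal.ofReal (l ^ n) * ∫⁻ x, W x ≤ ENNReal.ofReal (cI n) * ∫⁻ x, V x ^ q := by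
    have : ∫⁻ x, W x = (∫⁻ z, κ z ^ q) * ∫⁻ x, V x ^ q := by
      rw [← tonelli (by fun_prop) (by fun_prop)]
      refine lintegral_congr fun x => ?_
      simp only [hW]
      refine lintegral_congr fun z => ?_
      rw [ENNReal.mul_rpow_of_nonneg _ _ hq0.le]
    rw [this, ← mul_assoc]
    gcongr
    rw [← Kl_lint hl, ← lintegral_const_mul' _ _ ENNReal.ofReal_ne_top]
    refine lintegral_mono fun z => ?_
    simp only [Kl, Ker, hκ]
    rw [ENNReal.ofReal_rpow_of_nonneg (by positivity) hq0.le, ← ENNReal.ofReal_mul (by positivity), div_eq_mul_inv]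
    apply ENNReal.ofReal_le_ofReal
    gcongr
    have h1 : (1:ℝ) ≤ 1 + l * ‖z‖ := by
      have : 0 ≤ l * ‖z‖ := by positivity
      linarith
    rw [Real.inv_rpow (by positivity)]
    gcongr
    rw [← Real.rpow_natCast, ← Real.rpow_natCast, ← Real.rpow_mul (by positivity)]
    apply Real.rpow_le_rpow_of_exponent_le h1
    rw [hM]; push_cast
    nlinarith [(Nat.cast_nonneg n : (0:ℝ) ≤ n)]
  have hln : ENNReal.ofReal (l ^ n) ≠ 0 := by
    simp only [ne_eq, ENNReal.ofReal_eq_zero, not_le]; positivity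
  have step4 : ∫⁻ x, CV M l V x ^ q ≤ (ENNReal.ofReal ((L / l) ^ n)) ^ (1 - q) *
      ((c1⁻¹) ^ (1 - q) * ENNReal.ofReal (cI n)) * ∫⁻ x, V x ^ q := by
    have hfin : ENNReal.ofReal (l ^ n) ^ q * (ENNReal.ofReal (L ^ n) * c1⁻¹) ^ (1 - q) ≠ ⊤ := by
      apply ENNReal.mul_ne_top
      · exact ENNReal.rpow_ne_top_of_nonneg hq0.le ENNReal.ofReal_ne_top
      · apply ENNReal.rpow_ne_top_of_nonneg (by linarith)
        exact ENNReal.mul_ne_top ENNReal.ofReal_ne_top (by simpa using hc10)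
    have e2 : ENNReal.ofReal (l ^ n) ^ q = ENNReal.ofReal (l ^ n) * (ENNReal.ofReal (l ^ n))⁻¹ ^ (1 - q) := by
      nth_rw 2 [← ENNReal.rpow_one (ENNReal.ofReal (l ^ n))]
      rw [ENNReal.inv_rpow, ← ENNReal.rpow_neg, ← ENNReal.rpow_add _ _ hln ENNReal.ofReal_ne_top]
      congr 1; ring
    have e3 : ENNReal.ofReal ((L / l) ^ n) = ENNReal.ofReal (L ^ n) * (ENNReal.ofReal (l ^ n))⁻¹ := by
      rw [div_pow, ← ENNReal.ofReal_inv_of_pos (by positivity), ← ENNReal.ofReal_mul (by positivity), div_eq_mul_inv]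
    calc ∫⁻ x, CV M l V x ^ q ≤ ∫⁻ x, ENNReal.ofReal (l ^ n) ^ q * (ENNReal.ofReal (L ^ n) * c1⁻¹) ^ (1 - q) * W x :=
          lintegral_mono step2
      _ = ENNReal.ofReal (l ^ n) ^ q * (ENNReal.ofReal (L ^ n) * c1⁻¹) ^ (1 - q) * ∫⁻ x, W x :=
          lintegral_const_mul' _ _ hfin
      _ = (ENNReal.ofReal ((L / l) ^ n)) ^ (1 - q) * (c1⁻¹) ^ (1 - q) * (ENNReal.ofReal (l ^ n) * ∫⁻ x, W x) := by
          rw [e2, e3, ENNReal.mul_rpow_of_nonneg _ _ (by linarith : 0 ≤ 1 - q),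
            ENNReal.mul_rpow_of_nonneg _ _ (by linarith : 0 ≤ 1 - q)]
          ring
      _ ≤ (ENNReal.ofReal ((L / l) ^ n)) ^ (1 - q) * (c1⁻¹) ^ (1 - q) * (ENNReal.ofReal (cI n) * ∫⁻ x, V x ^ q) := by
          gcongr
      _ = _ := by ring
  rw [eLpNorm_eq_lintegral_rpow_enorm_toReal hp0 htop, eLpNorm_eq_lintegral_rpow_enorm_toReal hp0 htop]
  simp only [enorm_eq_self]
  rw [← hq]
  calc (∫⁻ x, CV M l V x ^ q) ^ (1 / q) ≤ _ := ENNReal.rpow_le_rpow step4 (by positivity)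
    _ = ENNReal.ofReal ((L / l) ^ ((n:ℝ) * (1 / q - 1))) * cc * (∫⁻ x, V x ^ q) ^ (1 / q) := by
      rw [ENNReal.mul_rpow_of_nonneg _ _ (by positivity), ENNReal.mul_rpow_of_nonneg _ _ (by positivity)]
      congr 2
      have hLl : 0 < L / l := by positivity
      rw [← ENNReal.rpow_mul, ENNReal.ofReal_rpow_of_pos (by positivity), ← Real.rpow_natCast, ← Real.rpow_mul hLl.le]
      congr 2
      field_simp
    _ ≤ _ := by
      rw [mul_comm _ cc, ENNReal.ofReal_mul (by positivity)]
      gcongr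
      rw [← ENNReal.ofReal_toReal hcct]
      exact ENNReal.ofReal_le_ofReal (by simp)

def MM (N : ℕ) (l : ℝ) (u : Eu n → ℝ) (x : Eu n) : ℝ := ∫ z, Ker n N l ‖z‖ * u (x - z)

def Bc (u : Eu n → ℝ) : Prop := Continuous u ∧ (∀ x, 0 ≤ u x) ∧ ∃ B, ∀ x, u x ≤ B

def Slow (N : ℕ) (l : ℝ) (F : Eu n → ℝ) : Prop := ∀ x z, F (x - z) ≤ F x * (1 + l * ‖z‖) ^ N

lemma Bc_sw (f : Sw n) : Bc (fun x => ‖f x‖) := by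
  obtain ⟨C, _, h⟩ := Sw_bdd f
  exact ⟨f.continuous.norm, fun x => norm_nonneg _, C, h⟩

lemma Ker_int' {N : ℕ} (hN : n + 1 ≤ N) {l : ℝ} (hl : 0 < l) : Integrable (fun z : Eu n => Ker n N l ‖z‖) := by
  refine (Ker_integrable hl).mono' (Ker_cont hl).aestronglyMeasurable (Filter.Eventually.of_forall fun z => ?_)
  rw [Real.norm_of_nonneg (Ker_nonneg hl (norm_nonneg _))]
  have := Ker_mul_pow (n := n) (M := 0) (N := N) (by omega) hl (norm_nonneg z)
  simpa using this

lemma MM_int {N : ℕ} (hN : n + 1 ≤ N) {l : ℝ} (hl : 0 < l) {u : Eu n → ℝ} (hu : Bc u) (x : Eu n) :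
    Integrable (fun z : Eu n => Ker n N l ‖z‖ * u (x - z)) := by
  obtain ⟨h1, h2, B, h3⟩ := hu
  refine ((Ker_int' hN hl).mul_const B).mono' ?_ (Filter.Eventually.of_forall fun z => ?_)
  · exact ((Ker_cont hl).mul (h1.comp (by fun_prop))).aestronglyMeasurable
  · have := Ker_nonneg (n := n) (N := N) hl (norm_nonneg z)
    rw [Real.norm_of_nonneg (mul_nonneg this (h2 _))]
    gcongr
    exact h3 _

lemma MM_nonneg {N : ℕ} {l : ℝ} (hl : 0 < l) {u : Eu n → ℝ} (hu : Bc u) (x : Eu n) : 0 ≤ MM N l u x :=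
  integral_nonneg fun z => mul_nonneg (Ker_nonneg hl (norm_nonneg z)) (hu.2.1 _)

lemma MM_cont {N : ℕ} (hN : n + 1 ≤ N) {l : ℝ} (hl : 0 < l) {u : Eu n → ℝ} (hu : Bc u) : Continuous (MM N l u) := by
  obtain ⟨h1, h2, B, h3⟩ := hu
  unfold MM
  refine continuous_of_dominated (bound := fun z => Ker n N l ‖z‖ * B) (fun x => ?_)
    (fun x => Filter.Eventually.of_forall fun z => ?_) ((Ker_int' hN hl).mul_const B)
    (Filter.Eventually.of_forall fun z => by fun_prop)
  · exact ((Ker_cont hl).mul (h1.comp (by fun_prop))).aestronglyMeasurable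
  · have := Ker_nonneg (n := n) (N := N) hl (norm_nonneg z)
    rw [Real.norm_of_nonneg (mul_nonneg this (h2 _))]
    gcongr
    exact h3 _

lemma MM_slow {N : ℕ} (hN : n + 1 ≤ N) {l : ℝ} (hl : 0 < l) {u : Eu n → ℝ} (hu : Bc u) : Slow N l (MM N l u) := by
  intro x w
  have e : MM N l u (x - w) = ∫ y, Ker n N l ‖y - w‖ * u (x - y) := by
    unfold MM
    rw [← integral_add_right_eq_self (μ := volume) (fun y => Ker n N l ‖y - w‖ * u (x - y)) w]
    congr 1; ext z
    rw [add_sub_cancel_right, sub_sub, add_comm w z]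
  rw [e, MM, ← integral_mul_const]
  have hi := (MM_int hN hl hu x).mul_const ((1 + l * ‖w‖) ^ N)
  have hpt : ∀ y : Eu n, Ker n N l ‖y - w‖ * u (x - y) ≤ Ker n N l ‖y‖ * u (x - y) * (1 + l * ‖w‖) ^ N := by
    intro y
    have h0 := hu.2.1 (x - y)
    have : Ker n N l ‖y - w‖ ≤ Ker n N l ‖y‖ * (1 + l * ‖w‖) ^ N := by
      unfold Ker
      rw [div_mul_eq_mul_div, div_le_div_iff₀ (by positivity) (by positivity), mul_assoc, ← mul_pow]
      gcongr
      have : l * ‖y‖ ≤ l * (‖w‖ + ‖y - w‖) := by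
        gcongr; simpa using norm_add_le w (y - w)
      nlinarith [mul_nonneg (mul_nonneg hl.le (norm_nonneg w)) (mul_nonneg hl.le (norm_nonneg (y - w)))]
    calc _ ≤ Ker n N l ‖y‖ * (1 + l * ‖w‖) ^ N * u (x - y) := by gcongr
      _ = _ := by ring
  refine integral_mono_of_nonneg (Filter.Eventually.of_forall fun y => ?_) hi (Filter.Eventually.of_forall hpt)
  exact mul_nonneg (Ker_nonneg hl (norm_nonneg _)) (hu.2.1 _)

lemma MM_dom {N : ℕ} (hN : n + 1 ≤ N) {l : ℝ} (hl : 0 < l) {m : Eu n → ℂ} (hm : Ccs m) {B : ℝ}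
    (hK : ∀ z, ‖𝓕⁻ m z‖ ≤ B * Ker n N l ‖z‖) {u : Eu n → ℝ} (hu : Bc u) {f : Sw n} (hf : ∀ x, ‖f x‖ ≤ u x) (x : Eu n) :
    ‖mu m f x‖ ≤ B * MM N l u x := by
  rw [mu_ker hm, MM, ← integral_const_mul]
  refine norm_integral_le_of_norm_le ((MM_int hN hl hu x).const_mul B) (Filter.Eventually.of_forall fun z => ?_)
  rw [norm_mul, ← mul_assoc]
  exact mul_le_mul (hK z) (hf _) (norm_nonneg _) ((norm_nonneg _).trans (hK z))

lemma wt_CV {N M β : ℕ} (hN : M + β ≤ N) {l : ℝ} (hl : 1 ≤ l) {b : ℝ} (hb : 0 ≤ b) (hβ : b ≤ β) (u : Eu n → ℝ) (x : Eu n) :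
    ‖Wt b x • MM N l u x‖ₑ ≤ CV M l (fun y => ‖Wt b y • u y‖ₑ) x := by
  have hl0 : 0 < l := by linarith
  unfold MM CV
  rw [smul_eq_mul, ← integral_const_mul]
  refine (enorm_integral_le_lintegral_enorm _).trans (lintegral_mono fun z => ?_)
  rw [Kl, ← Real.enorm_eq_ofReal (Ker_nonneg hl0 (norm_nonneg _))]
  have e1 : ‖Wt b x * (Ker n N l ‖z‖ * u (x - z))‖ₑ = ‖Wt b x * Ker n N l ‖z‖‖ₑ * ‖u (x - z)‖ₑ := by
    rw [← mul_assoc, enorm_mul]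
  have e2 : ‖Ker n M l ‖z‖‖ₑ * ‖Wt b (x - z) • u (x - z)‖ₑ = ‖Ker n M l ‖z‖ * Wt b (x - z)‖ₑ * ‖u (x - z)‖ₑ := by
    rw [smul_eq_mul, ← enorm_mul, ← mul_assoc, enorm_mul]
  show _ ≤ ‖Ker n M l ‖z‖‖ₑ * ‖Wt b (x - z) • u (x - z)‖ₑ
  rw [e1, e2]
  gcongr
  have h1 := Wt_pos b x
  have h2 := Wt_pos b (x - z)
  have k1 := Ker_nonneg (n := n) (N := N) hl0 (norm_nonneg z)
  have k2 := Ker_nonneg (n := n) (N := M) hl0 (norm_nonneg z)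
  rw [Real.enorm_eq_ofReal (by positivity), Real.enorm_eq_ofReal (by positivity)]
  apply ENNReal.ofReal_le_ofReal
  have hone : (1:ℝ) ≤ 1 + l * ‖z‖ := by
    have : 0 ≤ l * ‖z‖ := by positivity
    linarith
  have k3 : Ker n N l ‖z‖ * (1 + l * ‖z‖) ^ β ≤ Ker n M l ‖z‖ := by
    unfold Ker
    rw [div_mul_eq_mul_div, div_le_div_iff₀ (by positivity) (by positivity), mul_assoc, ← pow_add]
    gcongr
    omega
  calc Wt b x * Ker n N l ‖z‖ ≤ ((1 + ‖z‖) ^ β * Wt b (x - z)) * Ker n N l ‖z‖ := by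
        gcongr; exact Wt_peetre hb hβ x z
    _ ≤ ((1 + l * ‖z‖) ^ β * Wt b (x - z)) * Ker n N l ‖z‖ := by
        gcongr
        nlinarith [norm_nonneg z]
    _ = (Ker n N l ‖z‖ * (1 + l * ‖z‖) ^ β) * Wt b (x - z) := by ring
    _ ≤ _ := by gcongr

lemma nm_MM {p : ℝ≥0∞} (hp : 1 ≤ p) {N β : ℕ} (hN : n + 1 + β ≤ N) {l : ℝ} (hl : 1 ≤ l) {b : ℝ} (hb : 0 ≤ b) (hβ : b ≤ β)
    {u : Eu n → ℝ} (hu : Bc u) : nm p b (MM N l u) ≤ ENNReal.ofReal (cI n) * nm p b u := by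
  have hc : Continuous (fun y => Wt b y • u y) := (Wt_cont b).smul hu.1
  refine (eLpNorm_mono_enorm (g := CV (n + 1) l (fun y => ‖Wt b y • u y‖ₑ)) fun x => ?_).trans ?_
  · rw [enorm_eq_self]; exact wt_CV hN hl hb hβ u x
  · refine (YG1 hp (by linarith) hc.enorm.measurable).trans (le_of_eq ?_)
    rw [eLpNorm_enorm]; rfl

def dl (n : ℕ) (p : ℝ≥0∞) : ℝ := if p < 1 then (n:ℝ) * (1 / p.toReal - 1) else 0

lemma nm_MMs (n N' : ℕ) {p : ℝ≥0∞} (hp : 2⁻¹ ≤ p) {b : ℝ} (hb : 0 ≤ b) {β : ℕ} (hβ : b ≤ β) {N : ℕ}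
    (hN : 2 * n + 2 + β ≤ N) : ∃ C > 0, ∀ l L : ℝ, 1 ≤ l → l ≤ L → ∀ H : Eu n → ℝ, Bc H → Slow N' L H →
    nm p b (MM N l H) ≤ ENNReal.ofReal (C * (L / l) ^ dl n p) * nm p b H := by
  rcases lt_or_ge p 1 with h | h
  · obtain ⟨C, hC, hY⟩ := YGs n (N' + β) hp h
    refine ⟨C, hC, fun l L hl hL H hH hs => ?_⟩
    have hL0 : 0 < L := by linarith
    have hc : Continuous (fun y => Wt b y • H y) := (Wt_cont b).smul hH.1
    refine (eLpNorm_mono_enorm (g := CV (2 * n + 2) l (fun y => ‖Wt b y • H y‖ₑ)) fun x => ?_).trans ?_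
    · rw [enorm_eq_self]; exact wt_CV hN hl hb hβ H x
    · refine (hY l L (by linarith) hL _ hc.enorm.measurable fun x w => ?_).trans (le_of_eq ?_)
      · have a1 := hs (x - w) (-w)
        rw [sub_neg_eq_add, sub_add_cancel, norm_neg] at a1
        have a2 := Wt_peetre hb hβ x w
        have h1 := Wt_pos b x
        have h2 := Wt_pos b (x - w)
        have p1 := hH.2.1 x
        have p2 := hH.2.1 (x - w)
        rw [Real.enorm_eq_ofReal (by positivity), Real.enorm_eq_ofReal (by positivity),
          ← ENNReal.ofReal_mul (by positivity)]
        apply ENNReal.ofReal_le_ofReal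
        simp only [smul_eq_mul]
        calc Wt b x * H x ≤ ((1 + ‖w‖) ^ β * Wt b (x - w)) * (H (x - w) * (1 + L * ‖w‖) ^ N') := by gcongr
          _ ≤ ((1 + L * ‖w‖) ^ β * Wt b (x - w)) * (H (x - w) * (1 + L * ‖w‖) ^ N') := by
              gcongr
              · nlinarith [norm_nonneg w]
          _ = _ := by ring
      · rw [eLpNorm_enorm, dl, if_pos h]; rfl
  · have := cI_nonneg n
    refine ⟨cI n + 1, by positivity, fun l L hl hL H hH _ => ?_⟩
    refine (nm_MM h (by omega) hl hb hβ hH).trans ?_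
    gcongr
    rw [dl, if_neg (not_lt.2 h)]; simp

lemma Slow.ctl {N : ℕ} {l B : ℝ} (hB : 0 ≤ B) {F : Eu n → ℝ} (hF : Slow N l F) {u : Sw n} (h : ∀ x, ‖u x‖ ≤ B * F x) (x : Eu n) :
    Ctl N l (B * F x) u x := by
  intro z
  refine (h _).trans ?_
  rw [mul_assoc]
  gcongr
  exact hF x z

lemma geo_le {ρ : ℝ} (h0 : 0 < ρ) (h1 : ρ < 1) (J : ℕ) :
    ∑ i ∈ Finset.range (J + 1), ρ ^ (J - i) ≤ (1 - ρ)⁻¹ := by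
  have := Finset.sum_range_reflect (fun i => ρ ^ i) (J + 1)
  simp only [Nat.add_sub_cancel] at this
  rw [this]
  rw [← tsum_geometric_of_lt_one h0.le h1]
  exact (summable_geometric_of_lt_one h0.le h1).sum_le_tsum _ (fun i _ => by positivity)

lemma nm_geo {p : ℝ≥0∞} (hp : p ≠ 0) (b : ℝ) {ρ : ℝ} (h0 : 0 < ρ) (h1 : ρ < 1) : ∃ K > 0, ∀ (J : ℕ) (A : ℝ) (X : ℝ≥0∞)
    (u : ℕ → Eu n → ℂ), 0 ≤ A → (∀ i, Continuous (u i)) →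
    (∀ i ∈ Finset.range (J + 1), nm p b (u i) ≤ ENNReal.ofReal (A * ρ ^ (J - i)) * X) →
    nm p b (fun x => ∑ i ∈ Finset.range (J + 1), u i x) ≤ ENNReal.ofReal (K * A) * X := by
  have hq := qq_pos hp
  set q := qq p
  set σ := ρ ^ q
  have s0 : 0 < σ := Real.rpow_pos_of_pos h0 _
  have s1 : σ < 1 := Real.rpow_lt_one h0.le h1 hq
  have hs : 0 < (1 - σ)⁻¹ := inv_pos.2 (by linarith)
  refine ⟨((1 - σ)⁻¹) ^ (1 / q), by positivity, fun J A X u hA hu h => ?_⟩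
  rw [← ENNReal.rpow_le_rpow_iff hq]
  refine (nm_sum hp b _ hu).trans ?_
  calc ∑ i ∈ Finset.range (J + 1), nm p b (u i) ^ q
      ≤ ∑ i ∈ Finset.range (J + 1), ENNReal.ofReal (A ^ q * σ ^ (J - i)) * X ^ q := by
        refine Finset.sum_le_sum fun i hi => ?_
        refine (ENNReal.rpow_le_rpow (h i hi) hq.le).trans (le_of_eq ?_)
        rw [ENNReal.mul_rpow_of_nonneg _ _ hq.le, ENNReal.ofReal_rpow_of_nonneg (by positivity) hq.le,
          Real.mul_rpow hA (by positivity)]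
        congr 3
        rw [← Real.rpow_natCast, ← Real.rpow_mul h0.le, ← Real.rpow_natCast, ← Real.rpow_mul h0.le, mul_comm]
    _ = ENNReal.ofReal (A ^ q * ∑ i ∈ Finset.range (J + 1), σ ^ (J - i)) * X ^ q := by
        rw [← Finset.sum_mul, ← ENNReal.ofReal_sum_of_nonneg (fun i _ => by positivity), Finset.mul_sum]
    _ ≤ ENNReal.ofReal (A ^ q * (1 - σ)⁻¹) * X ^ q := by
        gcongr; exact geo_le s0 s1 J
    _ = _ := by
        rw [ENNReal.mul_rpow_of_nonneg _ _ hq.le, ENNReal.ofReal_rpow_of_nonneg (by positivity) hq.le,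
          Real.mul_rpow (by positivity) hA, ← Real.rpow_mul hs.le, one_div_mul_cancel hq.ne', Real.rpow_one, mul_comm (A ^ q)]

lemma Slow.mono_l {N : ℕ} {l l' : ℝ} (hl : 0 ≤ l) (h : l ≤ l') {F : Eu n → ℝ} (hF : Bc F) (hs : Slow N l F) : Slow N l' F := by
  intro x z
  have := hF.2.1 x
  refine (hs x z).trans ?_
  gcongr

lemma Slow.mul {N : ℕ} {l : ℝ} (hl : 0 ≤ l) {F G : Eu n → ℝ} (hF : Bc F) (hG : Bc G) (h1 : Slow N l F) (h2 : Slow N l G) :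
    Slow (2 * N) l (fun x => F x * G x) := by
  intro x z
  have a1 := hF.2.1 x
  have a2 := hG.2.1 (x - z)
  calc F (x - z) * G (x - z) ≤ (F x * (1 + l * ‖z‖) ^ N) * (G x * (1 + l * ‖z‖) ^ N) := by
        gcongr
        · exact h1 x z
        · exact h2 x z
    _ = _ := by rw [two_mul, pow_add]; ring

lemma Bc.mul {F G : Eu n → ℝ} (hF : Bc F) (hG : Bc G) : Bc (fun x => F x * G x) := by
  obtain ⟨a1, a2, A, a3⟩ := hF
  obtain ⟨b1, b2, B, b3⟩ := hG
  exact ⟨a1.mul b1, fun x => mul_nonneg (a2 x) (b2 x), A * B, fun x =>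
    mul_le_mul (a3 x) (b3 x) (b2 x) ((a2 x).trans (a3 x))⟩

lemma Bc.const_mul {F : Eu n → ℝ} (hF : Bc F) {c : ℝ} (hc : 0 ≤ c) : Bc (fun x => c * F x) := by
  obtain ⟨a1, a2, A, a3⟩ := hF
  exact ⟨continuous_const.mul a1, fun x => mul_nonneg hc (a2 x), c * A, fun x => mul_le_mul_of_nonneg_left (a3 x) hc⟩

lemma Slow.const_mul {N : ℕ} {l : ℝ} {F : Eu n → ℝ} (h : Slow N l F) {c : ℝ} (hc : 0 ≤ c) : Slow N l (fun x => c * F x) := by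
  intro x z
  show c * F (x - z) ≤ c * F x * _
  rw [mul_assoc]; gcongr; exact h x z

lemma mulS_apply' (f g : Sw n) (x : Eu n) : mulS f g x = f x * g x := by
  simp [mulS_apply]

lemma Diag (n N : ℕ) {p : ℝ≥0∞} (hp : 2⁻¹ ≤ p) {b : ℝ} (hb : 0 ≤ b) (s : ℝ)
    (hs : dl n p < s ∨ ∃ m : ℕ, s = 2 * m) : ∃ C > 0, ∀ (j k : ℕ) (f g : Sw n) (F G : Eu n → ℝ),
    j ≤ k + 2 → k ≤ j + 2 → Bc F → Bc G → Slow N (2 ^ j) F → Slow N (2 ^ k) G →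
    (∀ x, ‖lpp j f x‖ ≤ F x) → (∀ x, ‖lpp k g x‖ ≤ G x) →
    nm p b (mu (br s) (mulS (lpp j f) (lpp k g))) ≤ ENNReal.ofReal (C * ((2:ℝ) ^ j) ^ s) * nm p b (fun x => F x * G x) := by
  have hp0 : p ≠ 0 := by rintro rfl; simp at hp
  rcases hs with hs | ⟨m, rfl⟩
  · obtain ⟨β, hβ⟩ := exists_nat_ge b
    obtain ⟨C1, hC1, h1⟩ := nm_MMs n (2 * N) hp hb hβ le_rfl
    obtain ⟨C2, hC2, h2⟩ := thin_kernel n s (2 * n + 2 + β)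
    set e := s - dl n p
    have he : 0 < e := by simp only [e]; linarith
    obtain ⟨K, hK, h3⟩ := nm_geo (n := n) hp0 b (ρ := (2:ℝ) ^ (-e)) (by positivity)
      (Real.rpow_lt_one_of_one_lt_of_neg (by norm_num) (by linarith))
    refine ⟨K * (C2 * C1 * (2 ^ 4) ^ s), by positivity, fun j k f g F G hjk hkj hF hG sF sG bF bG => ?_⟩
    have hk2 : (2:ℝ) ^ k ≤ 2 ^ (j + 2) := pow_le_pow_right₀ (by norm_num) hkj
    have hj0 : (0:ℝ) < 2 ^ j := by positivity
    have hsp : Sp ((2:ℝ) ^ (j + 4)) (mulS (lpp j f) (lpp k g)) :=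
      (Sp_mulS (lpp_sp j f) (lpp_sp k g)).mono (by rw [pow_add] at *; nlinarith)
    have hH := hF.mul hG
    have sH : Slow (2 * N) ((2:ℝ) ^ (j + 4)) (fun x => F x * G x) := by
      refine Slow.mul (by positivity) hF hG (sF.mono_l hj0.le ?_ hF) (sG.mono_l (by positivity) ?_ hG) <;>
      exact pow_le_pow_right₀ (by norm_num) (by omega)
    have key := h3 (j + 4) (C2 * C1 * ((2:ℝ) ^ (j + 4)) ^ s) (nm p b (fun x => F x * G x))
      (fun i => mu (fun ξ => br s ξ * thin i ξ) (mulS (lpp j f) (lpp k g))) (by positivity) (fun i => SchwartzMap.continuous _)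
      (fun i hi => ?_)
    · rw [show (⇑(mu (br s) (mulS (lpp j f) (lpp k g)))) = fun x => ∑ i ∈ Finset.range (j + 4 + 1),
        mu (fun ξ => br s ξ * thin i ξ) (mulS (lpp j f) (lpp k g)) x from funext fun x => mu_thin_sum s hsp x]
      refine key.trans (le_of_eq ?_)
      congr 2
      rw [pow_add, Real.mul_rpow (by positivity) (by positivity)]; ring
    · have hi' : i ≤ j + 4 := by simpa [Nat.lt_succ_iff] using hi
      have hle : (2:ℝ) ^ i ≤ 2 ^ (j + 4) := pow_le_pow_right₀ (by norm_num) hi'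
      have d := MM_dom (N := 2 * n + 2 + β) (by omega) (l := (2:ℝ) ^ i) (by positivity) ((thin_ccs i).mul_left (br_contDiff s)) (h2 i) hH
        (f := mulS (lpp j f) (lpp k g))
        (fun x => by rw [mulS_apply', norm_mul]; exact mul_le_mul (bF x) (bG x) (norm_nonneg _) (hF.2.1 x))
      refine (nm_mono p b (v := MM (2 * n + 2 + β) ((2:ℝ) ^ i) (fun x => F x * G x)) (C := C2 * ((2:ℝ) ^ i) ^ s) fun x => ?_).trans ?_
      · rw [Real.norm_of_nonneg (MM_nonneg (by positivity) hH x)]; exact d x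
      · refine (mul_le_mul_right (h1 ((2:ℝ) ^ i) ((2:ℝ) ^ (j + 4)) (one_le_pow₀ (by norm_num)) hle _ hH sH) _).trans (le_of_eq ?_)
        rw [← mul_assoc, ← ENNReal.ofReal_mul (by positivity)]
        congr 2
        obtain ⟨d, hd⟩ := Nat.exists_eq_add_of_le hi'
        rw [hd, Nat.add_sub_cancel_left, pow_add, mul_div_cancel_left₀ _ (by positivity),
          Real.mul_rpow (by positivity) (by positivity)]
        rw [← Real.rpow_natCast 2 d, ← Real.rpow_natCast _ d, ← Real.rpow_mul (by norm_num), ← Real.rpow_mul (by norm_num),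
          ← Real.rpow_mul (by norm_num)]
        rw [show (2:ℝ) ^ ((d:ℝ) * dl n p) = 2 ^ ((d:ℝ) * s) * 2 ^ (-e * d) by
          rw [← Real.rpow_add (by norm_num)]; congr 1; simp only [e]; ring]
        ring
  · obtain ⟨C, hC, h⟩ := PE n N m
    refine ⟨C * (2 ^ 2) ^ (2 * m), by positivity, fun j k f g F G hjk hkj hF hG sF sG bF bG => ?_⟩
    have hj2 : (2:ℝ) ^ j ≤ 2 ^ (j + 2) := pow_le_pow_right₀ (by norm_num) (by omega)
    have hk2 : (2:ℝ) ^ k ≤ 2 ^ (j + 2) := pow_le_pow_right₀ (by norm_num) hkj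
    have hj0 : (0:ℝ) < 2 ^ j := by positivity
    have hk0 : (0:ℝ) < 2 ^ k := by positivity
    refine nm_mono p b fun x => ?_
    have f0 := hF.2.1 x
    have g0 := hG.2.1 x
    have c1 := (sF.ctl (B := 1) zero_le_one (u := lpp j f) (fun y => by simpa using bF y) x).mono_l (by simpa) hj0.le hj2
    have c2 := (sG.ctl (B := 1) zero_le_one (u := lpp k g) (fun y => by simpa using bG y) x).mono_l (by simpa) hk0.le hk2
    refine (h (j + 2) _ _ x _ _ (by simpa) (by simpa) ((lpp_sp j f).mono (by nlinarith)) ((lpp_sp k g).mono (by nlinarith)) c1 c2).trans (le_of_eq ?_)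
    rw [Real.norm_of_nonneg (mul_nonneg f0 g0), one_mul, one_mul, show ((2:ℝ) * (m:ℝ)) = ((2 * m : ℕ) : ℝ) by push_cast; ring,
      Real.rpow_natCast, pow_add, mul_pow]
    ring

def RR (s : ℝ) (j k : ℕ) (f g : Sw n) (x : Eu n) : ℂ :=
  TT s (lpp j f) (lpp k g) x - (if 1 ≤ j then mu (br s) (lpp j f) x * lpp k g x else 0)

def Om (r : ℝ) (j k : ℕ) : ℝ := ((2:ℝ) ^ (max j k)) ^ r * ((2:ℝ) ^ (-(min 1 r))) ^ (max j k - min j k)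

lemma Om_pos (r : ℝ) (j k : ℕ) : 0 < Om r j k := by unfold Om; positivity

lemma Om_right (r : ℝ) (j d : ℕ) : Om r j (j + d) = ((2:ℝ) ^ j * 2 ^ d) ^ r * ((2:ℝ) ^ d) ^ (-(min 1 r)) := by
  rw [Om, max_eq_right (Nat.le_add_right j d), min_eq_left (Nat.le_add_right j d), Nat.add_sub_cancel_left, pow_add]
  congr 1
  rw [← Real.rpow_natCast, ← Real.rpow_natCast, ← Real.rpow_mul (by norm_num), ← Real.rpow_mul (by norm_num), mul_comm]

lemma Om_left (r : ℝ) (k d : ℕ) : Om r (k + d) k = ((2:ℝ) ^ k * 2 ^ d) ^ r * ((2:ℝ) ^ d) ^ (-(min 1 r)) := by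
  rw [← Om_right, Om, Om, max_comm (k + d) k, min_comm (k + d) k]

lemma y_inv {y r : ℝ} (hy : 1 ≤ y) : y⁻¹ ≤ y ^ (-(min 1 r)) := by
  rw [← Real.rpow_neg_one]
  exact Real.rpow_le_rpow_of_exponent_le hy (by simp)

/-- Hypotheses packaging for a pair. -/
structure PH (N j k : ℕ) (f g : Sw n) (F G : Eu n → ℝ) : Prop where
  hF : Bc F
  hG : Bc G
  sF : Slow N (2 ^ j) F
  sG : Slow N (2 ^ k) G
  hD : ∀ i x, ‖D i (lpp j f) x‖ ≤ F x
  hf : (1 ≤ j ∨ k ≤ j + 2) → ∀ x, ‖lpp j f x‖ ≤ ((2:ℝ) ^ j)⁻¹ * F x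
  hg : ∀ x, ‖lpp k g x‖ ≤ G x

lemma PH.cD {N j k : ℕ} {f g : Sw n} {F G : Eu n → ℝ} (h : PH N j k f g F G) (x : Eu n) (i : Fin n) :
    Ctl N (2 ^ j) (F x) (D i (lpp j f)) x := by
  simpa using h.sF.ctl (B := 1) zero_le_one (u := D i (lpp j f)) (fun y => by simpa using h.hD i y) x

lemma PH.cf {N j k : ℕ} {f g : Sw n} {F G : Eu n → ℝ} (h : PH N j k f g F G) (h1 : 1 ≤ j ∨ k ≤ j + 2) (x : Eu n) :
    Ctl N (2 ^ j) (((2:ℝ) ^ j)⁻¹ * F x) (lpp j f) x :=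
  h.sF.ctl (by positivity) (h.hf h1) x

lemma PH.cg {N j k : ℕ} {f g : Sw n} {F G : Eu n → ℝ} (h : PH N j k f g F G) (x : Eu n) :
    Ctl N (2 ^ k) (G x) (lpp k g) x := by
  simpa using h.sG.ctl (B := 1) zero_le_one (u := lpp k g) (fun y => by simpa using h.hg y) x

lemma Jf_g (n N : ℕ) (s : ℝ) : ∃ C > 0, ∀ (j k : ℕ) (f g : Sw n) (F G : Eu n → ℝ), PH N j k f g F G →
    ∀ x, ‖(if 1 ≤ j then mu (br s) (lpp j f) x * lpp k g x else 0)‖ ≤ C * (((2:ℝ) ^ j) ^ (s - 1)) * (F x * G x) := by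
  obtain ⟨C, hC, h⟩ := Mult n N s
  refine ⟨C, hC, fun j k f g F G H x => ?_⟩
  have f0 := H.hF.2.1 x
  have g0 := H.hG.2.1 x
  split_ifs with hj
  · rw [norm_mul]
    refine (mul_le_mul (h j f x _ (by positivity) (H.cf (Or.inl hj) x)).at (H.hg x) (norm_nonneg _) (by positivity)).trans (le_of_eq ?_)
    rw [Real.rpow_sub (by positivity), Real.rpow_one]; ring
  · simp only [norm_zero]; positivity

lemma f_Jg (n N : ℕ) (s : ℝ) : ∃ C > 0, ∀ (j k : ℕ) (f g : Sw n) (F G : Eu n → ℝ), PH N j k f g F G → (1 ≤ j ∨ k ≤ j + 2) →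
    ∀ x, ‖lpp j f x * mu (br s) (lpp k g) x‖ ≤ C * (((2:ℝ) ^ j)⁻¹ * ((2:ℝ) ^ k) ^ s) * (F x * G x) := by
  obtain ⟨C, hC, h⟩ := Mult n N s
  refine ⟨C, hC, fun j k f g F G H hj x => ?_⟩
  have f0 := H.hF.2.1 x
  have g0 := H.hG.2.1 x
  rw [norm_mul]
  refine (mul_le_mul (H.hf hj x) (h k g x _ g0 (H.cg x)).at (norm_nonneg _) (by positivity)).trans (le_of_eq ?_)
  ring

lemma ZA (n N : ℕ) (s : ℝ) : ∃ C > 0, ∀ (j k : ℕ) (f g : Sw n) (F G : Eu n → ℝ), PH N j k f g F G → j + 3 ≤ k →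
    ∀ x, ‖RR s j k f g x‖ ≤ C * Om (s - 1) j k * (F x * G x) := by
  obtain ⟨C1, hC1, h1⟩ := PA n N s
  obtain ⟨C2, hC2, h2⟩ := Jf_g n N s
  refine ⟨C1 + C2, by positivity, fun j k f g F G H hjk x => ?_⟩
  have f0 := H.hF.2.1 x
  have g0 := H.hG.2.1 x
  have a1 := h1 j k f g x _ _ f0 g0 hjk (H.cD x) (H.cg x)
  have a2 := h2 j k f g F G H x
  obtain ⟨d, rfl⟩ := Nat.exists_eq_add_of_le (show j ≤ k by omega)
  have hy : (1:ℝ) ≤ 2 ^ d := one_le_pow₀ (by norm_num)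
  have o1 : ((2:ℝ) ^ (j + d)) ^ s * ((2 ^ (j + d)) ^ 2)⁻¹ * 2 ^ j ≤ Om (s - 1) j (j + d) := by
    rw [Om_right, pow_add, Real.rpow_sub_one (by positivity)]
    have : ((2:ℝ) ^ j * 2 ^ d) ^ s * ((2 ^ j * 2 ^ d) ^ 2)⁻¹ * 2 ^ j =
      ((2:ℝ) ^ j * 2 ^ d) ^ s / (2 ^ j * 2 ^ d) * ((2:ℝ) ^ d)⁻¹ := by
      field_simp
    rw [this]
    gcongr
    exact y_inv hy
  have o2 : ((2:ℝ) ^ j) ^ (s - 1) ≤ Om (s - 1) j (j + d) := by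
    rw [Om_right, Real.mul_rpow (by positivity) (by positivity), mul_assoc]
    refine le_mul_of_one_le_right (by positivity) ?_
    rw [← Real.rpow_add (by positivity)]
    exact Real.one_le_rpow hy (by have := min_le_right 1 (s - 1); linarith)
  calc _ ≤ _ := norm_sub_le _ _
    _ ≤ _ := add_le_add a1 a2
    _ ≤ C1 * Om (s - 1) j (j + d) * (F x * G x) + C2 * Om (s - 1) j (j + d) * (F x * G x) := by gcongr
    _ = _ := by ring

lemma ZB (n N : ℕ) (s : ℝ) (hs : 1 < s) : ∃ C > 0, ∀ (j k : ℕ) (f g : Sw n) (F G : Eu n → ℝ), PH N j k f g F G → k + 3 ≤ j →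
    ∀ x, ‖RR s j k f g x‖ ≤ C * Om (s - 1) j k * (F x * G x) := by
  obtain ⟨C1, hC1, h1⟩ := PB n N s
  obtain ⟨C2, hC2, h2⟩ := f_Jg n N s
  obtain ⟨C3, hC3, h3⟩ := PC n N s
  refine ⟨C1 + C2 + s * C3, by positivity, fun j k f g F G H hjk x => ?_⟩
  have f0 := H.hF.2.1 x
  have g0 := H.hG.2.1 x
  have hj : 1 ≤ j := by omega
  have a1 := h1 j k f g x _ _ (by positivity) g0 hjk (H.cf (Or.inl hj) x) (H.cg x)
  have a2 := h2 j k f g F G H (Or.inl hj) x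
  have a3 := h3 j k f g x _ _ f0 g0 (H.cD x) (H.cg x)
  obtain ⟨d, rfl⟩ := Nat.exists_eq_add_of_le (show k ≤ j by omega)
  have hy : (1:ℝ) ≤ 2 ^ d := one_le_pow₀ (by norm_num)
  have hd0 : (0:ℝ) < 2 ^ d := by positivity
  have hk0 : (0:ℝ) < 2 ^ k := by positivity
  have yi := y_inv (r := s - 1) hy
  have o1 : ((2:ℝ) ^ (k + d)) ^ s * (2 ^ (k + d))⁻¹ * 2 ^ k * ((2:ℝ) ^ (k + d))⁻¹ ≤ Om (s - 1) (k + d) k := by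
    rw [Om_left, pow_add, Real.rpow_sub_one (by positivity)]
    have : ((2:ℝ) ^ k * 2 ^ d) ^ s * (2 ^ k * 2 ^ d)⁻¹ * 2 ^ k * (2 ^ k * 2 ^ d)⁻¹ =
      ((2:ℝ) ^ k * 2 ^ d) ^ s / (2 ^ k * 2 ^ d) * ((2:ℝ) ^ d)⁻¹ := by
      field_simp
    rw [this]
    gcongr
  have o2' : ((2:ℝ) ^ k) ^ (s - 1) ≤ Om (s - 1) (k + d) k := by
    rw [Om_left, Real.mul_rpow (by positivity) (by positivity), mul_assoc]
    refine le_mul_of_one_le_right (by positivity) ?_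
    rw [← Real.rpow_add (by positivity)]
    exact Real.one_le_rpow hy (by have := min_le_right 1 (s - 1); linarith)
  have o3 : ((2:ℝ) ^ k) ^ (s - 2) * 2 ^ k ≤ Om (s - 1) (k + d) k := by
    refine le_trans (le_of_eq ?_) o2'
    rw [show s - 1 = (s - 2) + 1 by ring, Real.rpow_add_one (by positivity)]
  have o2 : ((2:ℝ) ^ (k + d))⁻¹ * ((2:ℝ) ^ k) ^ s ≤ Om (s - 1) (k + d) k := by
    refine le_trans ?_ o2'
    rw [Real.rpow_sub_one (by positivity), pow_add, mul_inv, div_eq_mul_inv, mul_comm]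
    gcongr
    exact mul_le_of_le_one_right (by positivity) (inv_le_one_of_one_le₀ hy)
  have e : RR s (k + d) k f g x = (mu (br s) (mulS (lpp (k + d) f) (lpp k g)) x - mu (br s) (lpp (k + d) f) x * lpp k g x)
      - lpp (k + d) f x * mu (br s) (lpp k g) x + s * ∑ i, D i (lpp (k + d) f) x * D i (mu (br (s - 2)) (lpp k g)) x := by
    rw [RR, if_pos hj, TT]; ring
  rw [e]
  refine (norm_add_le _ _).trans ?_
  rw [norm_mul, Complex.norm_real, Real.norm_of_nonneg (by linarith : (0:ℝ) ≤ s)]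
  calc _ ≤ _ := add_le_add ((norm_sub_le _ _).trans (add_le_add a1 a2)) (mul_le_mul_of_nonneg_left a3 (by linarith))
    _ = C1 * (((2:ℝ) ^ (k + d)) ^ s * (2 ^ (k + d))⁻¹ * 2 ^ k * ((2:ℝ) ^ (k + d))⁻¹) * (F x * G x)
       + C2 * (((2:ℝ) ^ (k + d))⁻¹ * ((2:ℝ) ^ k) ^ s) * (F x * G x) + s * (C3 * (((2:ℝ) ^ k) ^ (s - 2) * 2 ^ k) * (F x * G x)) := by ring
    _ ≤ C1 * Om (s - 1) (k + d) k * (F x * G x) + C2 * Om (s - 1) (k + d) k * (F x * G x) +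
        s * (C3 * Om (s - 1) (k + d) k * (F x * G x)) := by gcongr
    _ = _ := by ring

lemma nm_add_le {p : ℝ≥0∞} (hp : p ≠ 0) (b : ℝ) {u v : Eu n → ℂ} (hu : Continuous u) (hv : Continuous v) {Y : ℝ≥0∞}
    (h1 : nm p b u ≤ Y) (h2 : nm p b v ≤ Y) : nm p b (fun x => u x + v x) ≤ ENNReal.ofReal (2 ^ (1 / qq p)) * Y := by
  have hq := qq_pos hp
  rw [← ENNReal.rpow_le_rpow_iff hq]
  refine (nm_add hp b hu hv).trans ?_
  rw [ENNReal.mul_rpow_of_nonneg _ _ hq.le, ENNReal.ofReal_rpow_of_nonneg (by positivity) hq.le, ← Real.rpow_mul (by norm_num),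
    one_div_mul_cancel hq.ne', Real.rpow_one]
  calc _ ≤ Y ^ qq p + Y ^ qq p := by gcongr
    _ = _ := by rw [← two_mul]; simp

lemma TT_cont (s : ℝ) (f g : Sw n) : Continuous (TT s f g) := by
  unfold TT
  have h := fun u : Sw n => u.continuous
  fun_prop

lemma RR_cont (s : ℝ) (j k : ℕ) (f g : Sw n) : Continuous (RR s j k f g) := by
  unfold RR
  have h := fun u : Sw n => u.continuous
  have := TT_cont s (lpp j f) (lpp k g)
  split_ifs <;> fun_prop

lemma ZC (n N : ℕ) {p : ℝ≥0∞} (hp : 2⁻¹ ≤ p) {b : ℝ} (hb : 0 ≤ b) (s : ℝ) (h1s : 1 < s)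
    (hs : dl n p < s ∨ ∃ m : ℕ, s = 2 * m) : ∃ C > 0, ∀ (j k : ℕ) (f g : Sw n) (F G : Eu n → ℝ), PH N j k f g F G →
    j ≤ k + 2 → k ≤ j + 2 →
    nm p b (RR s j k f g) ≤ ENNReal.ofReal (C * ((2:ℝ) ^ j) ^ (s - 1)) * nm p b (fun x => F x * G x) := by
  have hp0 : p ≠ 0 := by rintro rfl; simp at hp
  obtain ⟨C0, hC0, h0⟩ := Diag n N hp hb s hs
  obtain ⟨C1, hC1, h1⟩ := Jf_g n N s
  obtain ⟨C2, hC2, h2⟩ := f_Jg n N s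
  obtain ⟨C3, hC3, h3⟩ := PC n N s
  set c := C0 + (C1 + C2 * (2 ^ 2) ^ s + s * (C3 * (2 ^ 2) ^ (s - 1)))
  have hr : 0 < s - 1 := by linarith
  refine ⟨2 ^ (1 / qq p) * c, by positivity, fun j k f g F G H hjk hkj => ?_⟩
  set X := nm p b (fun x => F x * G x)
  set P := mu (br s) (mulS (lpp j f) (lpp k g))
  have hk2 : (2:ℝ) ^ k ≤ 2 ^ 2 * 2 ^ j := by rw [← pow_add]; exact pow_le_pow_right₀ (by norm_num) (by omega)
  have e : RR s j k f g = fun x => P x + (RR s j k f g x - P x) := by ext x; ring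
  have b1 : nm p b P ≤ ENNReal.ofReal (c * ((2:ℝ) ^ j) ^ (s - 1)) * X := by
    have := h0 j k f g (fun x => ((2:ℝ) ^ j)⁻¹ * F x) G hjk hkj (H.hF.const_mul (by positivity)) H.hG
      (H.sF.const_mul (by positivity)) H.sG (H.hf (Or.inr hkj)) H.hg
    refine this.trans ?_
    have h4 : nm p b (fun x => ((2:ℝ) ^ j)⁻¹ * F x * G x) ≤ ENNReal.ofReal ((2:ℝ) ^ j)⁻¹ * X :=
      nm_mono p b fun x => by
        rw [mul_assoc, norm_mul]
        exact le_of_eq (by rw [Real.norm_of_nonneg (by positivity)])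
    refine (mul_le_mul_right h4 _).trans ?_
    rw [← mul_assoc, ← ENNReal.ofReal_mul (by positivity), Real.rpow_sub_one (by positivity)]
    refine mul_le_mul_left (ENNReal.ofReal_le_ofReal ?_) _
    rw [mul_assoc, ← div_eq_mul_inv]
    refine mul_le_mul_of_nonneg_right ?_ (by positivity)
    simp only [c]
    have : 0 ≤ (C1 + C2 * (2 ^ 2) ^ s + s * (C3 * (2 ^ 2) ^ (s - 1))) := by positivity
    linarith
  have b2 : nm p b (fun x => RR s j k f g x - P x) ≤ ENNReal.ofReal (c * ((2:ℝ) ^ j) ^ (s - 1)) * X := by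
    refine nm_mono p b fun x => ?_
    have f0 := H.hF.2.1 x
    have g0 := H.hG.2.1 x
    have a1 := h1 j k f g F G H x
    have a2 := h2 j k f g F G H (Or.inr hkj) x
    have a3 := h3 j k f g x _ _ f0 g0 (H.cD x) (H.cg x)
    have o2 : ((2:ℝ) ^ j)⁻¹ * ((2:ℝ) ^ k) ^ s ≤ (2 ^ 2) ^ s * ((2:ℝ) ^ j) ^ (s - 1) := by
      rw [Real.rpow_sub_one (by positivity), div_eq_mul_inv, ← mul_assoc, ← Real.mul_rpow (by positivity) (by positivity), mul_comm]
      exact mul_le_mul_of_nonneg_right (Real.rpow_le_rpow (by positivity) hk2 (by linarith)) (by positivity)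
    have o3 : ((2:ℝ) ^ k) ^ (s - 2) * 2 ^ k ≤ (2 ^ 2) ^ (s - 1) * ((2:ℝ) ^ j) ^ (s - 1) := by
      rw [← Real.rpow_add_one (by positivity), show s - 2 + 1 = s - 1 by ring, ← Real.mul_rpow (by positivity) (by positivity)]
      exact Real.rpow_le_rpow (by positivity) hk2 hr.le
    have e2 : RR s j k f g x - P x = -(if 1 ≤ j then mu (br s) (lpp j f) x * lpp k g x else 0)
        - lpp j f x * mu (br s) (lpp k g) x + s * ∑ i, D i (lpp j f) x * D i (mu (br (s - 2)) (lpp k g)) x := by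
      simp only [RR, TT, P]; ring
    rw [e2, Real.norm_of_nonneg (mul_nonneg f0 g0)]
    refine (norm_add_le _ _).trans ?_
    rw [norm_mul, Complex.norm_real, Real.norm_of_nonneg (by linarith : (0:ℝ) ≤ s)]
    calc _ ≤ _ := add_le_add ((norm_sub_le _ _).trans (add_le_add ((norm_neg _).le.trans a1) a2)) (mul_le_mul_of_nonneg_left a3 (by linarith))
      _ ≤ C1 * ((2:ℝ) ^ j) ^ (s - 1) * (F x * G x) + C2 * ((2 ^ 2) ^ s * ((2:ℝ) ^ j) ^ (s - 1)) * (F x * G x) +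
          s * (C3 * ((2 ^ 2) ^ (s - 1) * ((2:ℝ) ^ j) ^ (s - 1)) * (F x * G x)) := by gcongr
      _ ≤ C0 * ((2:ℝ) ^ j) ^ (s - 1) * (F x * G x) + _ := le_add_of_nonneg_left (by positivity)
      _ = _ := by simp only [c]; ring
  rw [e]
  refine (nm_add_le hp0 b P.continuous ((RR_cont s j k f g).sub P.continuous) b1 b2).trans (le_of_eq ?_)
  rw [← mul_assoc, ← ENNReal.ofReal_mul (by positivity)]
  congr 2; ring

lemma PAIR (n N : ℕ) {p p₁ p₂ : ℝ≥0∞} (hp : 2⁻¹ ≤ p) (hpp : 1 / p = 1 / p₁ + 1 / p₂) {b₁ b₂ : ℝ} (hb₁ : 0 ≤ b₁) (hb₂ : 0 ≤ b₂)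
    (s : ℝ) (h1s : 1 < s) (hs : dl n p < s ∨ ∃ m : ℕ, s = 2 * m) : ∃ C > 0, ∀ (j k : ℕ) (f g : Sw n) (F G : Eu n → ℝ),
    PH N j k f g F G →
    nm p (b₁ + b₂) (RR s j k f g) ≤ ENNReal.ofReal (C * Om (s - 1) j k) * (nm p₁ b₁ F * nm p₂ b₂ G) := by
  obtain ⟨C1, hC1, h1⟩ := ZA n N s
  obtain ⟨C2, hC2, h2⟩ := ZB n N s h1s
  obtain ⟨C3, hC3, h3⟩ := ZC n N hp (add_nonneg hb₁ hb₂) s h1s hs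
  set ρ : ℝ := (2:ℝ) ^ (-(min 1 (s - 1)))
  have hr : 0 < s - 1 := by linarith
  have hρ : 0 < ρ := by positivity
  have hρ1 : ρ ≤ 1 := Real.rpow_le_one_of_one_le_of_nonpos (by norm_num) (by simp [hr.le])
  refine ⟨C1 + C2 + C3 * (ρ ^ 2)⁻¹, by positivity, fun j k f g F G H => ?_⟩
  have hO := Om_pos (s - 1) j k
  suffices h : nm p (b₁ + b₂) (RR s j k f g) ≤ ENNReal.ofReal ((C1 + C2 + C3 * (ρ ^ 2)⁻¹) * Om (s - 1) j k) * nm p (b₁ + b₂) (fun x => F x * G x) from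
    h.trans (mul_le_mul_right (nm_holder hpp b₁ b₂ H.hF.1 H.hG.1) _)
  have nn : ∀ x, 0 ≤ F x * G x := fun x => mul_nonneg (H.hF.2.1 x) (H.hG.2.1 x)
  have pr : 0 < C3 * (ρ ^ 2)⁻¹ := by positivity
  by_cases c1 : j + 3 ≤ k
  · refine nm_mono p _ fun x => (h1 j k f g F G H c1 x).trans ?_
    rw [Real.norm_of_nonneg (nn x)]
    have := nn x
    gcongr; linarith
  by_cases c2 : k + 3 ≤ j
  · refine nm_mono p _ fun x => (h2 j k f g F G H c2 x).trans ?_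
    rw [Real.norm_of_nonneg (nn x)]
    have := nn x
    gcongr; linarith
  refine (h3 j k f g F G H (by omega) (by omega)).trans ?_
  refine mul_le_mul_left (ENNReal.ofReal_le_ofReal ?_) _
  have o : ((2:ℝ) ^ j) ^ (s - 1) ≤ (ρ ^ 2)⁻¹ * Om (s - 1) j k := by
    rw [le_inv_mul_iff₀ (by positivity), mul_comm, Om]
    have q1 : ρ ^ 2 ≤ ρ ^ (max j k - min j k) := pow_le_pow_of_le_one hρ.le hρ1 (by omega)
    have q2 : ((2:ℝ) ^ j) ^ (s - 1) ≤ ((2:ℝ) ^ (max j k)) ^ (s - 1) :=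
      Real.rpow_le_rpow (by positivity) (pow_le_pow_right₀ (by norm_num) (le_max_left _ _)) hr.le
    exact mul_le_mul q2 q1 (by positivity) (by positivity)
  calc _ ≤ C3 * ((ρ ^ 2)⁻¹ * Om (s - 1) j k) := by gcongr
    _ = C3 * (ρ ^ 2)⁻¹ * Om (s - 1) j k := by ring
    _ ≤ _ := by gcongr; linarith

lemma thin_tg (k : ℕ) (t : ℝ) : (fun ξ : Eu n => br t ξ * thin k ξ).HasTemperateGrowth :=
  ((thin_ccs k).mul_left (br_contDiff t)).tg

lemma LTb (n N : ℕ) (hN : n + 1 ≤ N) (t : ℝ) : ∃ C > 0, ∀ (k : ℕ) (g : Sw n) (u : Eu n → ℝ), Bc u →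
    (∀ y, ‖mu (br t) g y‖ ≤ u y) → ∀ x, ‖lpp k g x‖ ≤ C * ((2:ℝ) ^ k) ^ (-t) * MM N (2 ^ k) u x := by
  obtain ⟨C, hC, h⟩ := thin_kernel n (-t) N
  refine ⟨C, hC, fun k g u hu hg x => ?_⟩
  have e : lpp k g = mu (fun ξ => br (-t) ξ * thin k ξ) (mu (br t) g) := by
    refine mu_ext fun ξ => ?_
    rw [lpp, fourier_mu (thin_ccs k).tg, fourier_mu (thin_tg k (-t)), fourier_mu (br_tg t)]
    have : br (-t) ξ * br t ξ = 1 := by rw [br_add]; simp [br]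
    linear_combination (- thin k ξ * 𝓕 g ξ) * this
  rw [e]
  exact MM_dom hN (by positivity) ((thin_ccs k).mul_left (br_contDiff _)) (h k) hu hg x

lemma mu_comm' {m m' : Eu n → ℂ} (hm : m.HasTemperateGrowth) (hm' : m'.HasTemperateGrowth)
    (f : Sw n) : mu m (mu m' f) = mu m' (mu m f) := by
  rw [mu_mu hm hm', mu_mu hm' hm]; congr 1; ext; ring

lemma gradNorm_eq (f : Sw n) (x : Eu n) : gradNorm ⇑f x = Real.sqrt (∑ l, ‖D l f x‖ ^ 2) := rfl

lemma D_le_grad (f : Sw n) (l : Fin n) (x : Eu n) : ‖D l f x‖ ≤ gradNorm ⇑f x := by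
  rw [gradNorm_eq]
  apply Real.le_sqrt_of_sq_le
  exact Finset.single_le_sum (f := fun l => ‖D l f x‖ ^ 2) (fun i _ => by positivity) (Finset.mem_univ l)

lemma Bc_grad (f : Sw n) : Bc (gradNorm ⇑f) := by
  choose B hB0 hB using fun l => Sw_bdd (D l f)
  refine ⟨?_, fun x => Real.sqrt_nonneg _, Real.sqrt (∑ l, B l ^ 2), fun x => ?_⟩
  · have : gradNorm ⇑f = fun x => Real.sqrt (∑ l, ‖D l f x‖ ^ 2) := funext (gradNorm_eq f)
    rw [this]
    have h := fun u : Sw n => u.continuous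
    fun_prop
  · rw [gradNorm_eq]
    gcongr with l
    exact hB l x

def bsym (l : Fin n) (ζ : Eu n) : ℂ :=
  -dsym l ζ * (((((0:ℝ) ^ 2 + (2 * π) ^ 2 * ‖ζ‖ ^ 2) ^ ((-2:ℝ) / 2) : ℝ) : ℂ) * psi ζ)

lemma bsym_ccs (l : Fin n) : Ccs (bsym l : Eu n → ℂ) := by
  obtain ⟨d, hd, h0⟩ := psi_zero (n := n)
  have h := (symb_contDiff psi psi_ccs hd h0 (-2)).comp (contDiff_const (c := (0:ℝ)) |>.prodMk (contDiff_id (E := Eu n)))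
  have h2 : Ccs (fun ζ : Eu n => (((((0:ℝ) ^ 2 + (2 * π) ^ 2 * ‖ζ‖ ^ 2) ^ ((-2:ℝ) / 2) : ℝ) : ℂ) * psi ζ)) :=
    ⟨h, psi_ccs.2.mul_left⟩
  exact h2.mul_left (dsym_contDiff l).neg

lemma dsym_sq (ζ : Eu n) : ∑ l, dsym l ζ * dsym l ζ = -(((2 * π) ^ 2 * ‖ζ‖ ^ 2 : ℝ) : ℂ) := by
  rw [EuclideanSpace.norm_sq_eq]
  simp only [dsym]
  push_cast
  rw [Finset.mul_sum, ← Finset.sum_neg_distrib]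
  refine Finset.sum_congr rfl fun l _ => ?_
  simp only [Real.norm_eq_abs]
  rw [← Complex.ofReal_pow, sq_abs]
  push_cast
  linear_combination (4 * (π:ℂ) ^ 2 * (ζ l : ℂ) ^ 2) * Complex.I_sq

lemma bsym_sum (ζ : Eu n) : ∑ l, bsym l ζ * dsym l ζ = psi ζ := by
  by_cases hz : ζ = 0
  · subst hz
    obtain ⟨d, hd, h0⟩ := psi_zero (n := n)
    rw [h0 0 (by simpa using hd)]
    simp [bsym, h0 0 (by simpa using hd)]
  have hz' : 0 < ‖ζ‖ := norm_pos_iff.2 hz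
  have hπ := Real.pi_pos
  have e : ∀ l, bsym l ζ * dsym l ζ = -(((((0:ℝ) ^ 2 + (2 * π) ^ 2 * ‖ζ‖ ^ 2) ^ ((-2:ℝ) / 2) : ℝ) : ℂ) * psi ζ) * (dsym l ζ * dsym l ζ) := by
    intro l; rw [bsym]; ring
  simp_rw [e]
  rw [← Finset.mul_sum, dsym_sq, show ((-2:ℝ) / 2) = -1 by norm_num, Real.rpow_neg_one]
  have : ((((2 * π) ^ 2 * ‖ζ‖ ^ 2 : ℝ)) : ℂ) ≠ 0 := by
    rw [Complex.ofReal_ne_zero]; positivity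
  rw [zero_pow two_ne_zero, zero_add, Complex.ofReal_inv]
  linear_combination psi ζ * inv_mul_cancel₀ this

lemma lpp_grad {j : ℕ} (hj : 1 ≤ j) (f : Sw n) :
    lpp j f = ((((2:ℝ) ^ j)⁻¹ : ℝ) : ℂ) • ∑ l, mu (fun ξ => bsym l (((2:ℝ) ^ j)⁻¹ • ξ)) (D l f) := by
  refine mu_ext fun ξ => ?_
  have hs : ∀ l : Fin n, (fun ξ => bsym l (((2:ℝ) ^ j)⁻¹ • ξ)).HasTemperateGrowth := fun l =>
    ((bsym_ccs l).scale (by positivity)).tg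
  have e1 : 𝓕 (((((2:ℝ) ^ j)⁻¹ : ℝ) : ℂ) • ∑ l, mu (fun ξ => bsym l (((2:ℝ) ^ j)⁻¹ • ξ)) (D l f)) ξ =
     ((((2:ℝ) ^ j)⁻¹ : ℝ) : ℂ) * ∑ l, 𝓕 (mu (fun ξ => bsym l (((2:ℝ) ^ j)⁻¹ • ξ)) (D l f)) ξ := by
    simp
  rw [e1, lpp, fourier_mu (thin_ccs j).tg]
  simp_rw [fourier_mu (hs _), D_eq_mu, fourier_mu (dsym_tg _)]
  have e2 : thin j ξ = psi (((2:ℝ) ^ j)⁻¹ • ξ) := by rw [thin, fam, if_neg (by omega)]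
  rw [e2, ← bsym_sum, Finset.sum_mul, Finset.mul_sum]
  refine Finset.sum_congr rfl fun l _ => ?_
  rw [dsym_scale]; ring

lemma LG (n N : ℕ) (hN : n + 1 ≤ N) : ∃ C > 0, ∀ (j : ℕ) (f : Sw n), 1 ≤ j →
    ∀ x, ‖lpp j f x‖ ≤ ((2:ℝ) ^ j)⁻¹ * (C * MM N (2 ^ j) (gradNorm ⇑f) x) := by
  choose C hC h using fun l => kerB_scale (bsym_ccs (n := n) l) N
  refine ⟨∑ l, C l + 1, by have := Finset.sum_nonneg (fun l (_ : l ∈ Finset.univ) => (hC l).le); linarith, fun j f hj x => ?_⟩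
  have m0 : 0 ≤ MM N (2 ^ j) (gradNorm ⇑f) x := MM_nonneg (by positivity) (Bc_grad f) x
  rw [lpp_grad hj, smul_apply, norm_smul, Complex.norm_real, Real.norm_of_nonneg (by positivity), sum_apply]
  gcongr
  refine (norm_sum_le _ _).trans ?_
  calc _ ≤ ∑ l, C l * MM N (2 ^ j) (gradNorm ⇑f) x := by
        refine Finset.sum_le_sum fun l _ => ?_
        exact MM_dom hN (by positivity) ((bsym_ccs l).scale (by positivity)) (h l j) (Bc_grad f) (D_le_grad f l) x
    _ ≤ _ := by rw [← Finset.sum_mul]; gcongr; linarith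

lemma nm_cMM {p : ℝ≥0∞} (hp : 1 ≤ p) {N β : ℕ} (hN : n + 1 + β ≤ N) {l : ℝ} (hl : 1 ≤ l) {b : ℝ} (hb : 0 ≤ b) (hβ : b ≤ β)
    {u : Eu n → ℝ} (hu : Bc u) {c : ℝ} (hc : 0 ≤ c) : nm p b (fun x => c * MM N l u x) ≤ ENNReal.ofReal (c * cI n) * nm p b u := by
  refine (nm_mono p b (v := MM N l u) (C := c) fun x => ?_).trans ?_
  · rw [norm_mul, Real.norm_of_nonneg hc]
  · rw [ENNReal.ofReal_mul hc, mul_assoc]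
    exact mul_le_mul_right (nm_MM hp hN hl hb hβ hu) _

lemma Bc_MM {N : ℕ} (hN : n + 1 ≤ N) {l : ℝ} (hl : 0 < l) {u : Eu n → ℝ} (hu : Bc u) : Bc (MM N l u) := by
  refine ⟨MM_cont hN hl hu, MM_nonneg hl hu, ?_⟩
  obtain ⟨B, hB⟩ := hu.2.2
  refine ⟨∫ z : Eu n, Ker n N l ‖z‖ * B, fun x => ?_⟩
  refine integral_mono (MM_int hN hl hu x) ((Ker_int' hN hl).mul_const B) fun z => ?_
  exact mul_le_mul_of_nonneg_left (hB _) (Ker_nonneg hl (norm_nonneg _))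

lemma GG (n : ℕ) {N β : ℕ} (hN : n + 1 + β ≤ N) {p : ℝ≥0∞} (hp : 1 ≤ p) {b : ℝ} (hb : 0 ≤ b) (hβ : b ≤ β) (t : ℝ) :
    ∃ C > 0, ∀ (k : ℕ) (g : Sw n), ∃ G, Bc G ∧ Slow N (2 ^ k) G ∧ (∀ x, ‖lpp k g x‖ ≤ G x) ∧
      nm p b G ≤ ENNReal.ofReal (C * ((2:ℝ) ^ k) ^ (-t)) * nm p b (mu (br t) g) := by
  obtain ⟨C, hC, h⟩ := LTb n N (by omega) t
  have := cI_nonneg n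
  refine ⟨C * (cI n + 1), by positivity, fun k g => ?_⟩
  have hu := Bc_sw (mu (br t) g)
  have h2 : (0:ℝ) < 2 ^ k := by positivity
  refine ⟨fun x => C * ((2:ℝ) ^ k) ^ (-t) * MM N (2 ^ k) (fun y => ‖mu (br t) g y‖) x, ?_, ?_, h k g _ hu fun y => le_rfl, ?_⟩
  · exact (Bc_MM (by omega) h2 hu).const_mul (by positivity)
  · exact (MM_slow (by omega) h2 hu).const_mul (by positivity)
  · refine (nm_cMM hp hN (one_le_pow₀ (by norm_num)) hb hβ hu (by positivity)).trans ?_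
    rw [nm_norm]
    refine mul_le_mul_left (ENNReal.ofReal_le_ofReal ?_) _
    rw [mul_right_comm]
    gcongr; linarith

lemma FJ (n : ℕ) {N β : ℕ} (hN : n + 1 + β ≤ N) {p : ℝ≥0∞} (hp : 1 ≤ p) {b : ℝ} (hb : 0 ≤ b) (hβ : b ≤ β) (s : ℝ) :
    ∃ C > 0, ∀ (j : ℕ) (f : Sw n), ∃ F, Bc F ∧ Slow N (2 ^ j) F ∧ (∀ i x, ‖D i (lpp j f) x‖ ≤ F x) ∧
      (∀ x, ‖lpp j f x‖ ≤ ((2:ℝ) ^ j)⁻¹ * F x) ∧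
      nm p b F ≤ ENNReal.ofReal (C * ((2:ℝ) ^ j) ^ (-(s - 1))) * nm p b (mu (br s) f) := by
  obtain ⟨C, hC, h⟩ := GG n hN hp hb hβ s
  obtain ⟨C2, hC2, h2⟩ := Bern n N
  refine ⟨(C2 + 1) * C, by positivity, fun j f => ?_⟩
  obtain ⟨G, b1, s1, d1, e1⟩ := h j f
  have hj : (0:ℝ) < 2 ^ j := by positivity
  refine ⟨fun x => (C2 + 1) * 2 ^ j * G x, b1.const_mul (by positivity), s1.const_mul (by positivity), fun i x => ?_, fun x => ?_, ?_⟩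
  · have g0 := b1.2.1 x
    have := h2 j (lpp j f) x (G x) g0 ((lpp_sp j f).mono (by nlinarith)) (by
      simpa using s1.ctl (B := 1) zero_le_one (u := lpp j f) (fun y => by simpa using d1 y) x) i
    refine this.at.trans ?_
    beta_reduce
    gcongr; linarith
  · have g0 := b1.2.1 x
    refine (d1 x).trans ?_
    rw [← mul_assoc, show ((2:ℝ) ^ j)⁻¹ * ((C2 + 1) * 2 ^ j) = C2 + 1 by field_simp]
    nlinarith
  · refine (nm_mono p b (v := G) (C := (C2 + 1) * 2 ^ j) fun x => ?_).trans ?_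
    · rw [norm_mul, Real.norm_of_nonneg (by positivity)]
    · refine (mul_le_mul_right e1 _).trans (le_of_eq ?_)
      rw [← mul_assoc, ← ENNReal.ofReal_mul (by positivity)]
      congr 2
      rw [show -(s - 1) = -s + 1 by ring, Real.rpow_add_one (by positivity)]; ring

lemma FG (n : ℕ) {N β : ℕ} (hN : n + 1 + β ≤ N) {p : ℝ≥0∞} (hp : 1 ≤ p) {b : ℝ} (hb : 0 ≤ b) (hβ : b ≤ β) :
    ∃ C > 0, ∀ (j : ℕ) (f : Sw n), ∃ F, Bc F ∧ Slow N (2 ^ j) F ∧ (∀ i x, ‖D i (lpp j f) x‖ ≤ F x) ∧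
      (1 ≤ j → ∀ x, ‖lpp j f x‖ ≤ ((2:ℝ) ^ j)⁻¹ * F x) ∧
      nm p b F ≤ ENNReal.ofReal C * nm p b (gradNorm ⇑f) := by
  obtain ⟨C1, hC1, h1⟩ := LTb n N (by omega) 0
  obtain ⟨C2, hC2, h2⟩ := LG n N (by omega)
  have := cI_nonneg n
  refine ⟨(C1 + C2) * (cI n + 1), by positivity, fun j f => ?_⟩
  have hj : (0:ℝ) < 2 ^ j := by positivity
  have hu := Bc_grad f
  have m0 := MM_nonneg (N := N) hj hu
  refine ⟨fun x => (C1 + C2) * MM N (2 ^ j) (gradNorm ⇑f) x, ?_, ?_, fun i x => ?_, fun hj1 x => ?_, ?_⟩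
  · exact (Bc_MM (by omega) hj hu).const_mul (by positivity)
  · exact (MM_slow (by omega) hj hu).const_mul (by positivity)
  · have e : D i (lpp j f) = lpp j (D i f) := by
      rw [D_eq_mu, D_eq_mu, lpp, lpp, mu_comm' (dsym_tg i) (thin_ccs j).tg]
    rw [e]
    refine (h1 j (D i f) _ hu (fun y => by rw [mu_br_zero]; exact D_le_grad f i y) x).trans ?_
    have := m0 x
    rw [neg_zero, Real.rpow_zero, mul_one]
    beta_reduce
    gcongr; linarith
  · refine (h2 j f hj1 x).trans ?_
    have := m0 x
    beta_reduce
    gcongr; linarith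
  · refine (nm_cMM hp hN (one_le_pow₀ (by norm_num)) hb hβ hu (by positivity)).trans ?_
    gcongr; linarith

lemma tele {t θ : ℝ} (ht : 0 < t) (hθ : 1 < θ) :
    min t t⁻¹ ≤ θ / (θ - 1) * ((min (θ * t) 1 - min (θ * t)⁻¹ 1) - (min t 1 - min t⁻¹ 1)) := by
  have h1 : 0 < θ - 1 := by linarith
  rw [div_mul_eq_mul_div, le_div_iff₀ h1]
  rcases le_or_gt t 1 with h | h
  · have a1 : 1 ≤ t⁻¹ := (one_le_inv₀ ht).2 h
    rw [min_eq_left (h.trans a1), min_eq_left h, min_eq_right a1]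
    rcases le_or_gt (θ * t) 1 with h2 | h2
    · have a2 : 1 ≤ (θ * t)⁻¹ := (one_le_inv₀ (by positivity)).2 h2
      rw [min_eq_left h2, min_eq_right a2]
      have : 0 ≤ t * (θ - 1) ^ 2 := by positivity
      nlinarith
    · have a2 : (θ * t)⁻¹ ≤ 1 := inv_le_one_of_one_le₀ h2.le
      rw [min_eq_right h2.le, min_eq_left a2]
      have e : θ * (1 - (θ * t)⁻¹ - (t - 1)) = 2 * θ - t⁻¹ - θ * t := by field_simp; ring
      rw [e]
      have : t * (θ - 1) ≤ θ - 1 := by nlinarith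
      have h3 : t⁻¹ + θ * t ≤ θ + 1 := by
        have : (t⁻¹ - θ) * (1 - t) ≤ 0 := by
          apply mul_nonpos_of_nonpos_of_nonneg
          · rw [sub_nonpos, inv_le_iff_one_le_mul₀ ht]; linarith
          · linarith
        have e3 : (t⁻¹ - θ) * (1 - t) = t⁻¹ - 1 - θ + θ * t := by field_simp; ring
        linarith
      linarith
  · have a1 : t⁻¹ ≤ 1 := inv_le_one_of_one_le₀ h.le
    have h2 : 1 ≤ θ * t := by nlinarith
    rw [min_eq_right (a1.trans h.le), min_eq_right h.le, min_eq_left a1, min_eq_right h2, min_eq_left (inv_le_one_of_one_le₀ h2)]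
    apply le_of_eq
    field_simp
    ring

lemma bump_sum {θ : ℝ} (hθ : 1 < θ) {w : ℝ} (hw : 0 < w) (L : ℕ) :
    ∑ l ∈ Finset.range L, min (θ ^ l * w) (θ ^ l * w)⁻¹ ≤ 2 * (θ / (θ - 1)) := by
  have h0 : 0 < θ := by linarith
  have h1 : 0 < θ - 1 := by linarith
  set φ : ℕ → ℝ := fun l => min (θ ^ l * w) 1 - min (θ ^ l * w)⁻¹ 1
  have hb : ∀ l, -1 ≤ φ l ∧ φ l ≤ 1 := fun l => by
    have a : 0 < θ ^ l * w := by positivity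
    have b1 : 0 ≤ min (θ ^ l * w) 1 := by positivity
    have b2 : 0 ≤ min (θ ^ l * w)⁻¹ 1 := by positivity
    have c1 := min_le_right (θ ^ l * w) 1
    have c2 := min_le_right (θ ^ l * w)⁻¹ 1
    constructor <;> simp only [φ] <;> linarith
  calc _ ≤ ∑ l ∈ Finset.range L, θ / (θ - 1) * (φ (l + 1) - φ l) := by
        refine Finset.sum_le_sum fun l _ => ?_
        have := tele (t := θ ^ l * w) (by positivity) hθ
        simp only [φ]
        rwa [pow_succ', mul_assoc]
    _ = θ / (θ - 1) * (φ L - φ 0) := by rw [← Finset.mul_sum, Finset.sum_range_sub]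
    _ ≤ θ / (θ - 1) * 2 := by
        gcongr
        linarith [(hb L).2, (hb 0).1]
    _ = _ := by ring

lemma dist_sum {ρ : ℝ} (h0 : 0 < ρ) (h1 : ρ < 1) (j L : ℕ) :
    ∑ k ∈ Finset.range L, ρ ^ (max j k - min j k) ≤ 2 * (1 - ρ)⁻¹ := by
  calc _ ≤ ∑ k ∈ Finset.range ((j + 1) + L), ρ ^ (max j k - min j k) :=
        Finset.sum_le_sum_of_subset_of_nonneg (fun k hk => by simp at *; omega) (fun _ _ _ => by positivity)
    _ = ∑ k ∈ Finset.range (j + 1), ρ ^ (j - k) + ∑ i ∈ Finset.range L, ρ ^ (i + 1) := by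
        rw [Finset.sum_range_add]
        congr 1
        · refine Finset.sum_congr rfl fun k hk => ?_
          congr 1; simp at hk; omega
        · refine Finset.sum_congr rfl fun k hk => ?_
          congr 1; omega
    _ ≤ (1 - ρ)⁻¹ + (1 - ρ)⁻¹ := by
        refine add_le_add (geo_le h0 h1 j) ?_
        rw [← tsum_geometric_of_lt_one h0.le h1]
        refine le_trans (Finset.sum_le_sum fun i _ => ?_) ((summable_geometric_of_lt_one h0.le h1).sum_le_tsum (Finset.range L) (fun i _ => by positivity))
        rw [pow_succ]; exact mul_le_of_le_one_right (by positivity) h1.le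
    _ = _ := by ring

lemma dbl_sum {ρ : ℝ} (h0 : 0 < ρ) (h1 : ρ < 1) {h : ℕ → ℝ} (hh : ∀ i, 0 ≤ h i) {H : ℝ} (hH : ∀ L, ∑ i ∈ Finset.range L, h i ≤ H) (L : ℕ) :
    ∑ j ∈ Finset.range L, ∑ k ∈ Finset.range L, ρ ^ (max j k - min j k) * h (min j k) ≤ 2 * (2 * (1 - ρ)⁻¹ * H) := by
  have hr : 0 < (1 - ρ)⁻¹ := inv_pos.2 (by linarith)
  have key : ∑ j ∈ Finset.range L, ∑ k ∈ Finset.range L, ρ ^ (max j k - min j k) * h j ≤ 2 * (1 - ρ)⁻¹ * H := by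
    calc _ ≤ ∑ j ∈ Finset.range L, 2 * (1 - ρ)⁻¹ * h j := by
          refine Finset.sum_le_sum fun j _ => ?_
          rw [← Finset.sum_mul]
          exact mul_le_mul_of_nonneg_right (dist_sum h0 h1 j L) (hh j)
      _ ≤ _ := by rw [← Finset.mul_sum]; gcongr; exact hH L
  have key2 : ∑ j ∈ Finset.range L, ∑ k ∈ Finset.range L, ρ ^ (max j k - min j k) * h k ≤ 2 * (1 - ρ)⁻¹ * H := by
    rw [Finset.sum_comm]
    refine le_trans (le_of_eq ?_) key
    refine Finset.sum_congr rfl fun j _ => Finset.sum_congr rfl fun k _ => ?_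
    rw [max_comm, min_comm]
  calc _ ≤ ∑ j ∈ Finset.range L, ∑ k ∈ Finset.range L, (ρ ^ (max j k - min j k) * h j + ρ ^ (max j k - min j k) * h k) := by
        refine Finset.sum_le_sum fun j _ => Finset.sum_le_sum fun k _ => ?_
        have p := pow_pos h0 (max j k - min j k)
        rcases le_total j k with c | c
        · rw [min_eq_left c]; exact le_add_of_nonneg_right (mul_nonneg (by positivity) (hh k))
        · rw [min_eq_right c]; exact le_add_of_nonneg_left (mul_nonneg (by positivity) (hh j))
    _ = (∑ j ∈ Finset.range L, ∑ k ∈ Finset.range L, ρ ^ (max j k - min j k) * h j) +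
        ∑ j ∈ Finset.range L, ∑ k ∈ Finset.range L, ρ ^ (max j k - min j k) * h k := by
        simp_rw [Finset.sum_add_distrib]
    _ ≤ _ := by linarith

lemma min_one_rpow {y κ : ℝ} (hy : 0 ≤ y) (h0 : 0 ≤ κ) (h1 : κ ≤ 1) : min 1 y ≤ y ^ κ := by
  rcases le_total y 1 with h | h
  · rw [min_eq_right h]
    rcases eq_or_lt_of_le hy with e | e
    · subst e; exact Real.rpow_nonneg le_rfl _
    · calc y = y ^ (1:ℝ) := (Real.rpow_one y).symm
        _ ≤ _ := Real.rpow_le_rpow_of_exponent_ge e h h1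
  · rw [min_eq_left h]; exact Real.one_le_rpow h h0

lemma term_bd {r q : ℝ} (hr : 0 < r) (hq : 0 < q) {M X Y T : ℝ} (hM : 0 < M) (hX : 0 < X) (hXY : X * Y ≤ M ^ 2)
    (hT : 0 ≤ T) {l d : ℕ} (h1 : T ≤ ((2:ℝ) ^ (-(min 1 r))) ^ d * M)
    (h2 : T ≤ ((2:ℝ) ^ (-(min 1 r))) ^ d * (((2:ℝ) ^ r) ^ d * (((2:ℝ) ^ r) ^ l * X)))
    (h3 : T ≤ ((2:ℝ) ^ (-(min 1 r))) ^ d * ((((2:ℝ) ^ r) ^ l)⁻¹ * Y)) :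
    T ^ q ≤ M ^ q * ((((2:ℝ) ^ (-(min 1 r / 2))) ^ q) ^ d *
      min ((((2:ℝ) ^ r) ^ (min 1 r / (2 * r) * q)) ^ l * (X / M) ^ (min 1 r / (2 * r) * q))
        ((((2:ℝ) ^ r) ^ (min 1 r / (2 * r) * q)) ^ l * (X / M) ^ (min 1 r / (2 * r) * q))⁻¹) := by
  set ε := min 1 r
  have he : 0 < ε := lt_min one_pos hr
  have her : ε ≤ r := min_le_right _ _
  set κ := ε / (2 * r)
  have hκ : 0 < κ := by positivity
  have hκ1 : κ ≤ 1 := by rw [div_le_one (by positivity)]; linarith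
  set ρ := (2:ℝ) ^ (-ε)
  set θ := (2:ℝ) ^ r
  have hρ : 0 < ρ := by positivity
  have hθ : 0 < θ := by positivity
  have hθ1 : 1 ≤ θ := Real.one_le_rpow (by norm_num) hr.le
  set z := θ ^ l * (X / M)
  have hz : 0 < z := by positivity
  have e1 : (θ ^ (κ * q)) ^ l * (X / M) ^ (κ * q) = z ^ (κ * q) := by
    simp only [z]
    rw [Real.mul_rpow (by positivity) (by positivity), ← Real.rpow_natCast, ← Real.rpow_mul hθ.le, ← Real.rpow_natCast θ l,
      ← Real.rpow_mul hθ.le, mul_comm (κ * q)]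
  rw [e1]
  set v := min z z⁻¹
  have hv : 0 < v := lt_min hz (by positivity)
  have e2 : v ^ (κ * q) = min (z ^ (κ * q)) (z ^ (κ * q))⁻¹ := by
    rw [← Real.inv_rpow hz.le]
    exact (Real.monotoneOn_rpow_Ici_of_exponent_nonneg (by positivity)).map_min (by simpa using hz.le) (by simp [hz.le])
  rw [← e2]
  have g1 : T / M ≤ ρ ^ d := by rw [div_le_iff₀ hM]; exact h1
  have g2 : T / M ≤ ρ ^ d * (θ ^ d * z) := by
    rw [div_le_iff₀ hM]; refine h2.trans (le_of_eq ?_); simp only [z]; field_simp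
  have g3 : T / M ≤ ρ ^ d * z⁻¹ := by
    rw [div_le_iff₀ hM]; refine h3.trans ?_
    rw [mul_assoc]
    refine mul_le_mul_of_nonneg_left ?_ (by positivity)
    have : Y ≤ M ^ 2 / X := by rw [le_div_iff₀ hX]; linarith
    calc (θ ^ l)⁻¹ * Y ≤ (θ ^ l)⁻¹ * (M ^ 2 / X) := by gcongr
      _ = z⁻¹ * M := by simp only [z]; field_simp
  have g4 : T / M ≤ ρ ^ d * min 1 (θ ^ d * v) := by
    rw [mul_min_of_nonneg _ _ (by positivity), mul_one]
    refine le_min g1 ?_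
    simp only [v]
    rw [mul_min_of_nonneg _ _ (by positivity), mul_min_of_nonneg _ _ (by positivity)]
    refine le_min g2 (g3.trans ?_)
    gcongr
    exact le_mul_of_one_le_left (by positivity) (one_le_pow₀ hθ1)
  have g5 : T / M ≤ ((2:ℝ) ^ (-(ε / 2))) ^ d * v ^ κ := by
    refine g4.trans ((mul_le_mul_of_nonneg_left (min_one_rpow (by positivity) hκ.le hκ1) (by positivity)).trans (le_of_eq ?_))
    rw [Real.mul_rpow (by positivity) hv.le, ← mul_assoc]
    congr 1
    simp only [ρ, θ]
    have h2 : (0:ℝ) ≤ 2 := by norm_num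
    rw [← Real.rpow_natCast, ← Real.rpow_natCast, ← Real.rpow_natCast, ← Real.rpow_mul h2, ← Real.rpow_mul h2,
      ← Real.rpow_mul h2, ← Real.rpow_mul h2, ← Real.rpow_add (by norm_num)]
    congr 1
    simp only [κ]; field_simp; ring
  have g6 : T ≤ M * (((2:ℝ) ^ (-(ε / 2))) ^ d * v ^ κ) := by
    rw [mul_comm]; exact (div_le_iff₀ hM).1 g5
  refine (Real.rpow_le_rpow hT g6 hq.le).trans (le_of_eq ?_)
  rw [Real.mul_rpow hM.le (by positivity), Real.mul_rpow (by positivity) (by positivity), ← Real.rpow_mul hv.le]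
  congr 2
  have h2 : (0:ℝ) ≤ 2 := by norm_num
  simp only [← Real.rpow_natCast, ← Real.rpow_mul h2]
  congr 1; ring

lemma NUM {r q : ℝ} (hr : 0 < r) (hq : 0 < q) : ∃ K > 0, ∀ (a b c d : ℝ), 0 ≤ a → 0 ≤ b → 0 ≤ c → 0 ≤ d → ∀ T : ℕ → ℕ → ℝ,
    (∀ j k, 0 ≤ T j k) → (∀ j k, T j k ≤ Om r j k * (a * c)) → (∀ j k, T j k ≤ Om r j k * (a * (((2:ℝ) ^ k) ^ (-r) * d))) →
    (∀ j k, T j k ≤ Om r j k * (((2:ℝ) ^ j) ^ (-r) * b * c)) →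
    (∀ j k, T j k ≤ Om r j k * (((2:ℝ) ^ j) ^ (-r) * b * (((2:ℝ) ^ k) ^ (-r) * d))) → ∀ L,
    ∑ j ∈ Finset.range L, ∑ k ∈ Finset.range L, T j k ^ q ≤ K * (b * c + a * d) ^ q := by
  set ε := min 1 r
  have he : 0 < ε := lt_min one_pos hr
  set θ := ((2:ℝ) ^ r) ^ (min 1 r / (2 * r) * q)
  have hθ : 1 < θ := Real.one_lt_rpow (Real.one_lt_rpow (by norm_num) hr) (by positivity)
  set ρ := ((2:ℝ) ^ (-(min 1 r / 2))) ^ q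
  have hρ0 : 0 < ρ := by positivity
  have hρ1 : ρ < 1 := Real.rpow_lt_one (by positivity) (Real.rpow_lt_one_of_one_lt_of_neg (by norm_num) (by simp only [ε] at he; linarith)) hq
  have hi : 0 < (1 - ρ)⁻¹ := inv_pos.2 (by linarith)
  have hi2 : 0 < θ / (θ - 1) := div_pos (by linarith) (by linarith)
  refine ⟨2 * (2 * (1 - ρ)⁻¹ * (2 * (θ / (θ - 1)))), by positivity, fun a b c d ha hb hc hd T hT t1 t2 t3 t4 L => ?_⟩
  set M := b * c + a * d
  have hM0 : 0 ≤ M := by positivity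
  have p1 : ∀ m : ℕ, ((2:ℝ) ^ m) ^ r = ((2:ℝ) ^ r) ^ m := fun m => by
    rw [← Real.rpow_natCast, ← Real.rpow_natCast, ← Real.rpow_mul (by norm_num), ← Real.rpow_mul (by norm_num), mul_comm]
  have p2 : ∀ m : ℕ, ((2:ℝ) ^ m) ^ (-r) = (((2:ℝ) ^ r) ^ m)⁻¹ := fun m => by
    rw [Real.rpow_neg (by positivity), p1]
  have q1 : ∀ j k, T j k ≤ ((2:ℝ) ^ (-ε)) ^ (max j k - min j k) * M := by
    intro j k
    rcases le_total j k with h | h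
    · refine (t2 j k).trans ?_
      rw [Om, max_eq_right h, p1, p2]
      calc _ = ((2:ℝ) ^ (-ε)) ^ (k - min j k) * (a * d) := by simp only [ε]; field_simp
        _ ≤ _ := by gcongr; simp only [M]; linarith [mul_nonneg hb hc]
    · refine (t3 j k).trans ?_
      rw [Om, max_eq_left h, p1, p2]
      calc _ = ((2:ℝ) ^ (-ε)) ^ (j - min j k) * (b * c) := by simp only [ε]; field_simp
        _ ≤ _ := by gcongr; simp only [M]; linarith [mul_nonneg ha hd]
  rcases eq_or_lt_of_le hM0 with hM | hM
  · have : ∀ j k, T j k = 0 := fun j k => le_antisymm (by simpa [← hM] using q1 j k) (hT j k)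
    simp [this, Real.zero_rpow hq.ne', ← hM]
  rcases eq_or_lt_of_le (mul_nonneg ha hc) with hX | hX
  · have : ∀ j k, T j k = 0 := fun j k => le_antisymm (by simpa [← hX] using t1 j k) (hT j k)
    simp only [this, Real.zero_rpow hq.ne', Finset.sum_const_zero]
    positivity
  have hXY : (a * c) * (b * d) ≤ M ^ 2 := by
    have : 0 ≤ (b * c) ^ 2 + (a * d) ^ 2 + (a * d) * (b * c) := by positivity
    simp only [M]; nlinarith
  have q2 : ∀ j k, T j k ≤ ((2:ℝ) ^ (-ε)) ^ (max j k - min j k) * (((2:ℝ) ^ r) ^ (max j k - min j k) * (((2:ℝ) ^ r) ^ (min j k) * (a * c))) := by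
    intro j k
    refine (t1 j k).trans (le_of_eq ?_)
    have : ((2:ℝ) ^ r) ^ (max j k) = ((2:ℝ) ^ r) ^ (max j k - min j k) * ((2:ℝ) ^ r) ^ (min j k) := by
      rw [← pow_add]; congr 1; omega
    rw [Om, p1, this]; simp only [ε]; ring
  have q3 : ∀ j k, T j k ≤ ((2:ℝ) ^ (-ε)) ^ (max j k - min j k) * ((((2:ℝ) ^ r) ^ (min j k))⁻¹ * (b * d)) := by
    intro j k
    refine (t4 j k).trans (le_of_eq ?_)
    rw [Om, p1, p2, p2]
    rcases le_total j k with h | h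
    · rw [max_eq_right h, min_eq_left h]; simp only [ε]; field_simp
    · rw [max_eq_left h, min_eq_right h]; simp only [ε]; field_simp
  set h : ℕ → ℝ := fun l => min (θ ^ l * (a * c / M) ^ (min 1 r / (2 * r) * q)) (θ ^ l * (a * c / M) ^ (min 1 r / (2 * r) * q))⁻¹
  have hw : 0 < (a * c / M) ^ (min 1 r / (2 * r) * q) := by positivity
  have key := dbl_sum hρ0 hρ1 (h := h) (fun i => by simp only [h]; positivity) (fun L => bump_sum hθ hw L) L
  calc _ ≤ ∑ j ∈ Finset.range L, ∑ k ∈ Finset.range L, M ^ q * (ρ ^ (max j k - min j k) * h (min j k)) := by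
        refine Finset.sum_le_sum fun j _ => Finset.sum_le_sum fun k _ => ?_
        exact term_bd hr hq hM hX hXY (hT j k) (q1 j k) (q2 j k) (q3 j k)
    _ = M ^ q * ∑ j ∈ Finset.range L, ∑ k ∈ Finset.range L, ρ ^ (max j k - min j k) * h (min j k) := by simp_rw [Finset.mul_sum]
    _ ≤ _ := by rw [mul_comm]; gcongr

lemma Wt_tg (b : ℝ) : Function.HasTemperateGrowth (Wt b : Eu n → ℝ) := by
  unfold Wt
  exact Function.hasTemperateGrowth_one_add_norm_sq_rpow (Eu n) (b / 2)

lemma nm_fin (p : ℝ≥0∞) (b : ℝ) (u : Sw n) : nm p b u ≠ ⊤ := by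
  have := (SchwartzMap.memLp (SchwartzMap.smulLeftCLM ℂ (Wt b : Eu n → ℝ) u) p volume).2.ne
  have e : (fun x => Wt b x • u x) = ⇑(SchwartzMap.smulLeftCLM ℂ (Wt b : Eu n → ℝ) u) := by
    ext x
    rw [SchwartzMap.smulLeftCLM_apply_apply (Wt_tg b)]
  unfold nm
  rw [e]
  exact this

lemma nm_grad_fin {p : ℝ≥0∞} (hp : 1 ≤ p) (b : ℝ) (u : Sw n) : nm p b (gradNorm ⇑u) ≠ ⊤ := by
  have hp0 : p ≠ 0 := (zero_lt_one.trans_le hp).ne'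
  have h1 := nm_sum hp0 b Finset.univ (u := fun (l : Fin n) (x : Eu n) => ((‖D l u x‖ : ℝ) : ℂ))
    (fun l => by have := (D l u).continuous; fun_prop)
  rw [qq_of_one_le hp] at h1
  simp only [ENNReal.rpow_one] at h1
  have h2 : nm p b (gradNorm ⇑u) ≤ ENNReal.ofReal 1 * nm p b (fun x => ∑ l : Fin n, ((‖D l u x‖ : ℝ) : ℂ)) := by
    refine nm_mono p b fun x => ?_
    rw [one_mul, ← Complex.ofReal_sum, Complex.norm_real, gradNorm_eq, Real.norm_of_nonneg (by positivity), Real.norm_of_nonneg (by positivity)]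
    refine Real.sqrt_le_iff.2 ⟨by positivity, ?_⟩
    exact Finset.sum_sq_le_sq_sum_of_nonneg (fun i _ => norm_nonneg _)
  refine ne_top_of_le_ne_top ?_ (h2.trans (mul_le_mul_right h1 _))
  refine ENNReal.mul_ne_top ENNReal.ofReal_ne_top (ENNReal.sum_ne_top.2 fun l _ => ?_)
  refine ne_top_of_le_ne_top (nm_fin p b (D l u)) ?_
  have := nm_mono (C := 1) p b (u := fun x => ((‖D l u x‖ : ℝ) : ℂ)) (v := D l u) (fun x => by simp)
  simpa using this

lemma exc_sum {e : ℝ} (he : 0 ≤ e) (L : ℕ) :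
    ∑ j ∈ Finset.range L, ∑ k ∈ Finset.range L, (if 1 ≤ j ∨ j + 3 ≤ k then 0 else e) ≤ 3 * e := by
  have h1 : ∀ j ∈ Finset.range L, ∑ k ∈ Finset.range L, (if 1 ≤ j ∨ j + 3 ≤ k then 0 else e) ≤ if j = 0 then 3 * e else 0 := by
    intro j _
    rcases Nat.eq_zero_or_pos j with h | h
    · subst h
      have : ∀ k, (if 1 ≤ 0 ∨ 0 + 3 ≤ k then 0 else e) = if k < 3 then e else 0 := fun k => by
        by_cases hk : k < 3
        · rw [if_pos hk, if_neg (by omega)]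
        · rw [if_neg hk, if_pos (by omega)]
      simp only [this, if_true]
      rw [← Finset.sum_filter, Finset.sum_const, nsmul_eq_mul]
      gcongr
      have : (Finset.filter (fun k => k < 3) (Finset.range L)).card ≤ (Finset.range 3).card :=
        Finset.card_le_card fun k hk => by simp at *; omega
      simpa using (Nat.cast_le (α := ℝ)).2 this
    · rw [if_neg h.ne']
      apply le_of_eq
      refine Finset.sum_eq_zero fun k _ => ?_
      exact if_pos (Or.inl h)
  refine (Finset.sum_le_sum h1).trans ?_
  rw [Finset.sum_ite_eq']
  split_ifs <;> linarith

lemma comb4 {R NF NG : ℝ≥0∞} {Cp O c x c' y b' d K : ℝ} (hO : 0 ≤ O) (hx : 0 ≤ x) (hy : 0 ≤ y) (hb : 0 ≤ b') (hd : 0 ≤ d)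
    (hCp : 0 < Cp) (hc : 0 < c) (hc' : 0 < c') (hK : Cp * c * c' ≤ K)
    (h : R ≤ ENNReal.ofReal (Cp * O) * (NF * NG)) (hF : NF ≤ ENNReal.ofReal (c * x) * ENNReal.ofReal b')
    (hG : NG ≤ ENNReal.ofReal (c' * y) * ENNReal.ofReal d) : R ≤ ENNReal.ofReal (K * (O * (x * b' * (y * d)))) := by
  refine h.trans ?_
  calc _ ≤ ENNReal.ofReal (Cp * O) * ((ENNReal.ofReal (c * x) * ENNReal.ofReal b') * (ENNReal.ofReal (c' * y) * ENNReal.ofReal d)) := by gcongr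
    _ = ENNReal.ofReal ((Cp * c * c') * (O * (x * b' * (y * d)))) := by
        rw [← ENNReal.ofReal_mul (by positivity), ← ENNReal.ofReal_mul (by positivity), ← ENNReal.ofReal_mul (by positivity), ← ENNReal.ofReal_mul (by positivity)]
        congr 1; ring
    _ ≤ _ := by gcongr

lemma PSUM (n : ℕ) {p p₁ p₂ : ℝ≥0∞} (hp : 2⁻¹ ≤ p) (hp1 : 1 ≤ p₁) (hp2 : 1 ≤ p₂) (hpp : 1 / p = 1 / p₁ + 1 / p₂) {b₁ b₂ : ℝ}
    (hb₁ : 0 ≤ b₁) (hb₂ : 0 ≤ b₂) (s : ℝ) (h1s : 1 < s) (hs : dl n p < s ∨ ∃ m : ℕ, s = 2 * m) :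
    ∃ K > 0, ∀ (f g : Sw n) (L : ℕ),
      nm p (b₁ + b₂) (fun x => ∑ j ∈ Finset.range L, ∑ k ∈ Finset.range L, RR s j k f g x) ≤
        ENNReal.ofReal K * (nm p₁ b₁ (mu (br s) f) * nm p₂ b₂ g + nm p₁ b₁ (gradNorm ⇑f) * nm p₂ b₂ (mu (br (s - 1)) g)) := by
  have hp0 : p ≠ 0 := fun h => by simp [h] at hp
  obtain ⟨β₁, hβ₁⟩ := exists_nat_ge b₁
  obtain ⟨β₂, hβ₂⟩ := exists_nat_ge b₂
  set N := n + 1 + (β₁ + β₂)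
  have hN1 : n + 1 + β₁ ≤ N := by omega
  have hN2 : n + 1 + β₂ ≤ N := by omega
  obtain ⟨Cp, hCp, PAI⟩ := PAIR n N hp hpp hb₁ hb₂ s h1s hs
  obtain ⟨c1, hc1, G0⟩ := GG n hN2 hp2 hb₂ hβ₂ 0
  obtain ⟨c2, hc2, G1⟩ := GG n hN2 hp2 hb₂ hβ₂ (s - 1)
  obtain ⟨c3, hc3, F1⟩ := FJ n hN1 hp1 hb₁ hβ₁ s
  obtain ⟨c4, hc4, F0⟩ := FG n hN1 hp1 hb₁ hβ₁
  have hr : 0 < s - 1 := by linarith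
  have hq := qq_pos hp0
  obtain ⟨Kn, hKn, NU⟩ := NUM hr hq
  set r := s - 1
  set q := qq p
  set K0 := Cp * (c3 + c4) * (c1 + c2)
  have hK0 : 0 < K0 := by positivity
  set O := (2:ℝ) ^ (2 * r)
  have hO : 0 < O := by positivity
  set K1 := K0 ^ q * Kn + 3 * (K0 * O) ^ q
  have hK1 : 0 < K1 := by positivity
  refine ⟨K1 ^ (1 / q), by positivity, fun f g L => ?_⟩
  obtain ⟨b, eb⟩ : ∃ b : ℝ, b = (nm p₁ b₁ (mu (br s) f)).toReal := ⟨_, rfl⟩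
  obtain ⟨c, ec⟩ : ∃ b : ℝ, b = (nm p₂ b₂ g).toReal := ⟨_, rfl⟩
  obtain ⟨a, ea⟩ : ∃ b : ℝ, b = (nm p₁ b₁ (gradNorm ⇑f)).toReal := ⟨_, rfl⟩
  obtain ⟨d, ed⟩ : ∃ b : ℝ, b = (nm p₂ b₂ (mu (br r) g)).toReal := ⟨_, rfl⟩
  have hb : 0 ≤ b := by rw [eb]; positivity
  have hc : 0 ≤ c := by rw [ec]; positivity
  have ha : 0 ≤ a := by rw [ea]; positivity
  have hd : 0 ≤ d := by rw [ed]; positivity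
  have fb : nm p₁ b₁ (mu (br s) f) = ENNReal.ofReal b := by rw [eb, ENNReal.ofReal_toReal (nm_fin _ _ _)]
  have fc : nm p₂ b₂ g = ENNReal.ofReal c := by rw [ec, ENNReal.ofReal_toReal (nm_fin _ _ _)]
  have fa : nm p₁ b₁ (gradNorm ⇑f) = ENNReal.ofReal a := by rw [ea, ENNReal.ofReal_toReal (nm_grad_fin hp1 _ _)]
  have fd : nm p₂ b₂ (mu (br r) g) = ENNReal.ofReal d := by rw [ed, ENNReal.ofReal_toReal (nm_fin _ _ _)]
  rw [fb, fc, fa, fd, ← ENNReal.ofReal_mul hb, ← ENNReal.ofReal_mul ha, ← ENNReal.ofReal_add (by positivity) (by positivity),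
    ← ENNReal.ofReal_mul (by positivity)]
  set R : ℕ → ℕ → ℝ≥0∞ := fun j k => nm p (b₁ + b₂) (RR s j k f g)
  have hOm : ∀ j k, 0 ≤ Om r j k := fun j k => (Om_pos r j k).le
  have x1 : ∀ j k, R j k ≤ ENNReal.ofReal (K0 * (Om r j k * (((2:ℝ) ^ j) ^ (-r) * b * (1 * c)))) := by
    intro j k
    obtain ⟨F, u1, u2, u3, u4, u5⟩ := F1 j f
    obtain ⟨G, v1, v2, v3, v4⟩ := G0 k g
    rw [mu_br_zero, fc, neg_zero, Real.rpow_zero] at v4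
    rw [fb] at u5
    refine comb4 (hOm j k) (by positivity) (by positivity) hb hc hCp hc3 hc1 ?_ (PAI j k f g F G ⟨u1, v1, u2, v2, u3, fun _ => u4, v3⟩) u5 v4
    simp only [K0]; gcongr <;> linarith
  have x2 : ∀ j k, R j k ≤ ENNReal.ofReal (K0 * (Om r j k * (((2:ℝ) ^ j) ^ (-r) * b * (((2:ℝ) ^ k) ^ (-r) * d)))) := by
    intro j k
    obtain ⟨F, u1, u2, u3, u4, u5⟩ := F1 j f
    obtain ⟨G, v1, v2, v3, v4⟩ := G1 k g
    rw [fd] at v4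
    rw [fb] at u5
    refine comb4 (hOm j k) (by positivity) (by positivity) hb hd hCp hc3 hc2 ?_ (PAI j k f g F G ⟨u1, v1, u2, v2, u3, fun _ => u4, v3⟩) u5 v4
    simp only [K0]; gcongr <;> linarith
  have x3 : ∀ j k, (1 ≤ j ∨ j + 3 ≤ k) → R j k ≤ ENNReal.ofReal (K0 * (Om r j k * (1 * a * (1 * c)))) := by
    intro j k hjk
    obtain ⟨F, u1, u2, u3, u4, u5⟩ := F0 j f
    obtain ⟨G, v1, v2, v3, v4⟩ := G0 k g
    rw [mu_br_zero, fc, neg_zero, Real.rpow_zero] at v4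
    rw [fa, ← mul_one c4] at u5
    refine comb4 (hOm j k) (by positivity) (by positivity) ha hc hCp hc4 hc1 ?_
      (PAI j k f g F G ⟨u1, v1, u2, v2, u3, fun h => u4 (by omega), v3⟩) u5 v4
    simp only [K0]; gcongr <;> linarith
  have x4 : ∀ j k, (1 ≤ j ∨ j + 3 ≤ k) → R j k ≤ ENNReal.ofReal (K0 * (Om r j k * (1 * a * (((2:ℝ) ^ k) ^ (-r) * d)))) := by
    intro j k hjk
    obtain ⟨F, u1, u2, u3, u4, u5⟩ := F0 j f
    obtain ⟨G, v1, v2, v3, v4⟩ := G1 k g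
    rw [fd] at v4
    rw [fa, ← mul_one c4] at u5
    refine comb4 (hOm j k) (by positivity) (by positivity) ha hd hCp hc4 hc2 ?_
      (PAI j k f g F G ⟨u1, v1, u2, v2, u3, fun h => u4 (by omega), v3⟩) u5 v4
    simp only [K0]; gcongr <;> linarith
  have hRf : ∀ j k, R j k ≠ ⊤ := fun j k => ne_top_of_le_ne_top ENNReal.ofReal_ne_top (x1 j k)
  set T : ℕ → ℕ → ℝ := fun j k => if 1 ≤ j ∨ j + 3 ≤ k then (R j k).toReal / K0 else 0
  have hT : ∀ j k, 0 ≤ T j k := fun j k => by simp only [T]; split_ifs <;> positivity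
  have key : ∀ j k (y : ℝ), 0 ≤ y → ((1 ≤ j ∨ j + 3 ≤ k) → R j k ≤ ENNReal.ofReal (K0 * (Om r j k * y))) → T j k ≤ Om r j k * y := by
    intro j k y hy h
    have := hOm j k
    simp only [T]
    split_ifs with hjk
    · rw [div_le_iff₀ hK0, mul_comm]
      exact ENNReal.toReal_le_of_le_ofReal (by positivity) (h hjk)
    · positivity
  have S1 := NU a b c d ha hb hc hd T hT
    (fun j k => key j k _ (by positivity) (fun h => by simpa using x3 j k h))
    (fun j k => key j k _ (by positivity) (fun h => by simpa using x4 j k h))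
    (fun j k => key j k _ (by positivity) (fun h => by simpa using x1 j k))
    (fun j k => key j k _ (by positivity) (fun h => x2 j k)) L
  set M := b * c + a * d
  have hM : 0 ≤ M := by positivity
  have hE : ∀ j k, R j k ^ q ≤ ENNReal.ofReal (K0 ^ q * T j k ^ q + if 1 ≤ j ∨ j + 3 ≤ k then 0 else (K0 * O * M) ^ q) := by
    intro j k
    rw [← Real.mul_rpow hK0.le (hT j k)]
    by_cases hjk : 1 ≤ j ∨ j + 3 ≤ k
    · simp only [T, if_pos hjk, add_zero]
      rw [mul_div_cancel₀ _ hK0.ne', ← ENNReal.ofReal_rpow_of_nonneg (by positivity) hq.le, ENNReal.ofReal_toReal (hRf j k)]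
    · simp only [T, if_neg hjk, mul_zero]
      rw [Real.zero_rpow hq.ne', zero_add, ← ENNReal.ofReal_rpow_of_nonneg (by positivity) hq.le]
      refine ENNReal.rpow_le_rpow ((x1 j k).trans (ENNReal.ofReal_le_ofReal ?_)) hq.le
      have hj : j = 0 := by omega
      subst hj
      have hk : k ≤ 2 := by omega
      have o1 : Om r 0 k ≤ O := by
        unfold Om
        have e1 : ((2:ℝ) ^ (max 0 k)) ^ r ≤ O := by
          simp only [O]
          rw [← Real.rpow_natCast, ← Real.rpow_mul (by norm_num)]
          refine Real.rpow_le_rpow_of_exponent_le (by norm_num) ?_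
          gcongr
          have : max 0 k ≤ 2 := by omega
          exact_mod_cast this
        refine (mul_le_of_le_one_right (by positivity) (pow_le_one₀ (by positivity) ?_)).trans e1
        refine Real.rpow_le_one_of_one_le_of_nonpos (by norm_num) ?_
        have : 0 ≤ min 1 r := le_min zero_le_one hr.le
        linarith
      rw [pow_zero, Real.one_rpow, one_mul, one_mul, mul_assoc K0 O M]
      have : b * c ≤ M := by simp only [M]; linarith [mul_nonneg ha hd]
      exact mul_le_mul_of_nonneg_left (mul_le_mul o1 this (by positivity) hO.le) hK0.le
  have hM2 := exc_sum (e := (K0 * O * M) ^ q) (by positivity) L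
  have fin : nm p (b₁ + b₂) (fun x => ∑ j ∈ Finset.range L, ∑ k ∈ Finset.range L, RR s j k f g x) ^ q ≤ ENNReal.ofReal (K1 * M ^ q) := by
    calc _ ≤ ∑ j ∈ Finset.range L, nm p (b₁ + b₂) (fun x => ∑ k ∈ Finset.range L, RR s j k f g x) ^ q :=
          nm_sum hp0 _ _ (fun j => continuous_finsetSum _ fun k _ => RR_cont s j k f g)
      _ ≤ ∑ j ∈ Finset.range L, ∑ k ∈ Finset.range L, R j k ^ q :=
          Finset.sum_le_sum fun j _ => nm_sum hp0 _ _ (fun k => RR_cont s j k f g)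
      _ ≤ ∑ j ∈ Finset.range L, ∑ k ∈ Finset.range L, ENNReal.ofReal (K0 ^ q * T j k ^ q + if 1 ≤ j ∨ j + 3 ≤ k then 0 else (K0 * O * M) ^ q) :=
          Finset.sum_le_sum fun j _ => Finset.sum_le_sum fun k _ => hE j k
      _ = ENNReal.ofReal (∑ j ∈ Finset.range L, ∑ k ∈ Finset.range L, (K0 ^ q * T j k ^ q + if 1 ≤ j ∨ j + 3 ≤ k then 0 else (K0 * O * M) ^ q)) := by
          have nn : ∀ j k, 0 ≤ (K0 ^ q * T j k ^ q + if 1 ≤ j ∨ j + 3 ≤ k then 0 else (K0 * O * M) ^ q) := fun j k => by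
            have := Real.rpow_nonneg (hT j k) q
            split_ifs <;> positivity
          rw [ENNReal.ofReal_sum_of_nonneg (fun j _ => Finset.sum_nonneg fun k _ => nn j k)]
          exact Finset.sum_congr rfl fun j _ => (ENNReal.ofReal_sum_of_nonneg (fun k _ => nn j k)).symm
      _ ≤ _ := by
          refine ENNReal.ofReal_le_ofReal ?_
          simp_rw [Finset.sum_add_distrib, ← Finset.mul_sum]
          rw [Real.mul_rpow (by positivity) hM] at hM2
          have := mul_le_mul_of_nonneg_left S1 (by positivity : 0 ≤ K0 ^ q)
          simp only [K1]
          rw [Real.mul_rpow (by positivity) hM]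
          nlinarith
  have := ENNReal.rpow_le_rpow fin (z := 1 / q) (by positivity)
  rw [← ENNReal.rpow_mul, mul_one_div_cancel hq.ne', ENNReal.rpow_one, ENNReal.ofReal_rpow_of_nonneg (by positivity) (by positivity),
    Real.mul_rpow hK1.le (by positivity), ← Real.rpow_mul hM, mul_one_div_cancel hq.ne', Real.rpow_one] at this
  exact this

def cut (J : ℕ) (f : Sw n) : Sw n := ∑ j ∈ Finset.range (J + 1), lpp j f

def cutm (J : ℕ) (ξ : Eu n) : ℂ := phi (((2:ℝ) ^ J)⁻¹ • ξ)

lemma cutm_tg (J : ℕ) : Function.HasTemperateGrowth (cutm J : Eu n → ℂ) :=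
  (phi_ccs.scale (by positivity : ((2:ℝ) ^ J)⁻¹ ≠ 0)).tg

lemma cut_eq (J : ℕ) (f : Sw n) : cut J f = mu (cutm J) f := by
  refine mu_ext fun ξ => ?_
  rw [fourier_mu (cutm_tg J)]
  have e : 𝓕 (cut J f) = ∑ j ∈ Finset.range (J + 1), 𝓕 (lpp j f) := by
    unfold cut
    exact map_sum (FourierTransform.fourierCLM ℂ (Sw n)) _ _
  rw [e, SchwartzMap.sum_apply, cutm, ← thin_sum, Finset.sum_mul]
  exact Finset.sum_congr rfl fun j _ => fourier_mu (thin_ccs j).tg f ξ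

lemma cutm_le (J : ℕ) (ξ : Eu n) : ‖cutm J ξ‖ ≤ 1 := phi_norm_le _

lemma cutm_lim (ξ : Eu n) : Filter.Tendsto (fun J => cutm J ξ) Filter.atTop (nhds 1) := by
  obtain ⟨J0, hJ0⟩ := pow_unbounded_of_one_lt ‖ξ‖ (one_lt_two : (1:ℝ) < 2)
  refine tendsto_const_nhds.congr' ?_
  filter_upwards [Filter.eventually_ge_atTop J0] with J hJ
  refine (phi_one ?_).symm
  rw [norm_smul, norm_inv, norm_pow, Real.norm_of_nonneg (by norm_num), inv_mul_le_iff₀ (by positivity), mul_one]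
  exact hJ0.le.trans (pow_le_pow_right₀ (by norm_num) hJ)

lemma cut_four (J : ℕ) (f : Sw n) (ξ : Eu n) : (𝓕 (cut J f)) ξ = cutm J ξ * (𝓕 f) ξ := by
  rw [cut_eq, fourier_mu (cutm_tg J)]

lemma cut_mu_lim {m : Eu n → ℂ} (hm : Function.HasTemperateGrowth m) (f : Sw n) (x : Eu n) :
    Filter.Tendsto (fun J => mu m (cut J f) x) Filter.atTop (nhds (mu m f x)) := by
  simp_rw [mu_apply hm]
  refine tendsto_integral_of_dominated_convergence (fun ξ => ‖(𝓕 (mu m f)) ξ‖) (fun J => ?_) (𝓕 (mu m f)).integrable.norm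
    (fun J => Filter.Eventually.of_forall fun ξ => ?_) (Filter.Eventually.of_forall fun ξ => ?_)
  · have h1 := hm.1.continuous
    have h2 := (𝓕 (cut J f)).continuous
    exact Continuous.aestronglyMeasurable (by fun_prop)
  · rw [norm_mul, cut_four, fourier_mu hm]
    have : ‖cexp (2 * π * I * (⟪ξ, x⟫ : ℝ))‖ = 1 := by
      rw [show (2 * π * I * (⟪ξ, x⟫ : ℝ) : ℂ) = ((2 * π * ⟪ξ, x⟫ : ℝ) : ℂ) * I by push_cast; ring]
      exact Complex.norm_exp_ofReal_mul_I _
    rw [this, one_mul, norm_mul, norm_mul, norm_mul]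
    gcongr
    exact mul_le_of_le_one_left (norm_nonneg _) (cutm_le J ξ)
  · simp_rw [cut_four]
    have := (cutm_lim ξ).mul_const ((𝓕 f) ξ)
    rw [one_mul] at this
    exact (this.const_mul _).const_mul _

lemma cut_lim (f : Sw n) (x : Eu n) : Filter.Tendsto (fun J => cut J f x) Filter.atTop (nhds (f x)) := by
  have := cut_mu_lim (br_tg 0) f x
  simpa only [mu_br_zero] using this

lemma cut_D_lim (i : Fin n) (f : Sw n) (x : Eu n) : Filter.Tendsto (fun J => D i (cut J f) x) Filter.atTop (nhds (D i f x)) := by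
  have := cut_mu_lim (dsym_tg i) f x
  simpa only [← D_eq_mu] using this

lemma cut_comm {m : Eu n → ℂ} (hm : Function.HasTemperateGrowth m) (J : ℕ) (f : Sw n) : mu m (cut J f) = cut J (mu m f) := by
  refine SchwartzMap.ext fun x => ?_
  rw [cut_eq, cut_eq, mu_mu hm (cutm_tg J), mu_mu (cutm_tg J) hm]
  simp only [mul_comm]

lemma cvb (u v : Sw n) (N : ℕ) : ∃ C > 0, ∀ ξ η : Eu n, ‖u η‖ * ‖v (ξ - η)‖ ≤ C / (1 + ‖ξ‖) ^ N * (1 + ‖η‖) ^ (-((n:ℝ) + 1)) := by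
  obtain ⟨A, hA, hu⟩ := schwartz_decay u (N + (n + 1))
  obtain ⟨B, hB, hv⟩ := schwartz_decay v N
  refine ⟨A * B, by positivity, fun ξ η => ?_⟩
  have h0 : 1 + ‖ξ‖ ≤ (1 + ‖η‖) * (1 + ‖ξ - η‖) := by
    have : ‖ξ‖ ≤ ‖η‖ + ‖ξ - η‖ := by simpa using norm_add_le η (ξ - η)
    nlinarith [mul_nonneg (norm_nonneg η) (norm_nonneg (ξ - η))]
  have e : (1 + ‖η‖) ^ (-((n:ℝ) + 1)) = ((1 + ‖η‖) ^ (n + 1))⁻¹ := by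
    rw [Real.rpow_neg (by positivity), ← Real.rpow_natCast]; push_cast; rfl
  rw [e]
  calc _ ≤ (A / (1 + ‖η‖) ^ (N + (n + 1))) * (B / (1 + ‖ξ - η‖) ^ N) := mul_le_mul (hu η) (hv _) (norm_nonneg _) (by positivity)
    _ = A * B / ((1 + ‖η‖) * (1 + ‖ξ - η‖)) ^ N * ((1 + ‖η‖) ^ (n + 1))⁻¹ := by
        rw [pow_add, mul_pow]; field_simp
    _ ≤ _ := by gcongr

lemma cut_mulS_lim {m : Eu n → ℂ} (hm : Function.HasTemperateGrowth m) (f g : Sw n) (x : Eu n) :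
    Filter.Tendsto (fun J => mu m (mulS (cut J f) (cut J g)) x) Filter.atTop (nhds (mu m (mulS f g) x)) := by
  obtain ⟨k, C0, hm0⟩ := hm.2 0
  simp only [norm_iteratedFDeriv_zero] at hm0
  have hC0 : 0 ≤ C0 := by have := (norm_nonneg _).trans (hm0 0); simpa using this
  obtain ⟨C, hC, hcv⟩ := cvb (𝓕 f) (𝓕 g) (k + (n + 1))
  have hI : Integrable (fun η : Eu n => (1 + ‖η‖) ^ (-((n:ℝ) + 1))) := integrable_one_add_norm (by simp)
  have hb : ∀ J (ξ η : Eu n), ‖(𝓕 (cut J f)) η * (𝓕 (cut J g)) (ξ - η)‖ ≤ C / (1 + ‖ξ‖) ^ (k + (n + 1)) * (1 + ‖η‖) ^ (-((n:ℝ) + 1)) := by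
    intro J ξ η
    rw [norm_mul, cut_four, cut_four, norm_mul, norm_mul]
    refine le_trans ?_ (hcv ξ η)
    gcongr
    · exact mul_le_of_le_one_left (norm_nonneg _) (cutm_le J _)
    · exact mul_le_of_le_one_left (norm_nonneg _) (cutm_le J _)
  have hF : ∀ ξ, Filter.Tendsto (fun J => (𝓕 (mulS (cut J f) (cut J g))) ξ) Filter.atTop (nhds ((𝓕 (mulS f g)) ξ)) := by
    intro ξ
    simp_rw [fourier_mulS]
    refine tendsto_integral_of_dominated_convergence _ (fun J => ?_) (hI.const_mul (C / (1 + ‖ξ‖) ^ (k + (n + 1))))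
      (fun J => Filter.Eventually.of_forall fun η => hb J ξ η) (Filter.Eventually.of_forall fun η => ?_)
    · have h1 := (𝓕 (cut J f)).continuous
      have h2 := (𝓕 (cut J g)).continuous
      exact Continuous.aestronglyMeasurable (by fun_prop)
    · simp_rw [cut_four]
      have a1 := (cutm_lim η).mul_const ((𝓕 f) η)
      have a2 := (cutm_lim (ξ - η)).mul_const ((𝓕 g) (ξ - η))
      rw [one_mul] at a1 a2
      exact a1.mul a2
  set Iη := ∫ η : Eu n, (1 + ‖η‖) ^ (-((n:ℝ) + 1))
  have hFb : ∀ J ξ, ‖(𝓕 (mulS (cut J f) (cut J g))) ξ‖ ≤ C / (1 + ‖ξ‖) ^ (k + (n + 1)) * Iη := by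
    intro J ξ
    rw [fourier_mulS]
    refine (norm_integral_le_of_norm_le (hI.const_mul (C / (1 + ‖ξ‖) ^ (k + (n + 1)))) (Filter.Eventually.of_forall fun η => hb J ξ η)).trans ?_
    rw [integral_const_mul]
  simp_rw [mu_apply hm]
  refine tendsto_integral_of_dominated_convergence (fun ξ => (C0 * C * Iη) * (1 + ‖ξ‖) ^ (-((n:ℝ) + 1))) (fun J => ?_) (hI.const_mul _)
    (fun J => Filter.Eventually.of_forall fun ξ => ?_) (Filter.Eventually.of_forall fun ξ => ?_)
  · have h1 := hm.1.continuous
    have h2 := (𝓕 (mulS (cut J f) (cut J g))).continuous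
    exact Continuous.aestronglyMeasurable (by fun_prop)
  · rw [norm_mul]
    have : ‖cexp (2 * π * I * (⟪ξ, x⟫ : ℝ))‖ = 1 := by
      rw [show (2 * π * I * (⟪ξ, x⟫ : ℝ) : ℂ) = ((2 * π * ⟪ξ, x⟫ : ℝ) : ℂ) * I by push_cast; ring]
      exact Complex.norm_exp_ofReal_mul_I _
    rw [this, one_mul, norm_mul]
    have e : (1 + ‖ξ‖) ^ (-((n:ℝ) + 1)) = ((1 + ‖ξ‖) ^ (n + 1))⁻¹ := by
      rw [Real.rpow_neg (by positivity), ← Real.rpow_natCast]; push_cast; rfl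
    rw [e]
    calc _ ≤ (C0 * (1 + ‖ξ‖) ^ k) * (C / (1 + ‖ξ‖) ^ (k + (n + 1)) * Iη) := mul_le_mul (hm0 ξ) (hFb J ξ) (norm_nonneg _) (by positivity)
      _ = _ := by rw [pow_add]; field_simp
  · exact ((hF ξ).const_mul _).const_mul _

lemma TT_lim (s : ℝ) (f g : Sw n) (x : Eu n) :
    Filter.Tendsto (fun J => TT s (cut J f) (cut J g) x) Filter.atTop (nhds (TT s f g x)) := by
  unfold TT
  refine ((cut_mulS_lim (br_tg s) f g x).sub ((cut_lim f x).mul (cut_mu_lim (br_tg s) g x))).add (Filter.Tendsto.const_mul _ ?_)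
  refine tendsto_finsetSum _ fun i _ => (cut_D_lim i f x).mul ?_
  simp_rw [cut_comm (br_tg (s - 2))]
  exact cut_D_lim i _ x

lemma TT_add_left (s : ℝ) (f f' g : Sw n) (x : Eu n) : TT s (f + f') g x = TT s f g x + TT s f' g x := by
  have e : mulS (f + f') g = mulS f g + mulS f' g := by ext y; simp [mulS_apply', add_mul]
  unfold TT
  simp only [e, mu_add, D_add, SchwartzMap.add_apply, add_mul, Finset.sum_add_distrib]
  ring

lemma TT_add_right (s : ℝ) (f g g' : Sw n) (x : Eu n) : TT s f (g + g') x = TT s f g x + TT s f g' x := by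
  have e : mulS f (g + g') = mulS f g + mulS f g' := by ext y; simp [mulS_apply', mul_add]
  unfold TT
  simp only [e, mu_add, D_add, SchwartzMap.add_apply, mul_add, Finset.sum_add_distrib]
  ring

lemma TT_cut (s : ℝ) (f g : Sw n) (J : ℕ) (x : Eu n) :
    TT s (cut J f) (cut J g) x = ∑ j ∈ Finset.range (J + 1), ∑ k ∈ Finset.range (J + 1), TT s (lpp j f) (lpp k g) x := by
  have h1 := map_sum (AddMonoidHom.mk' (fun u : Sw n => TT s u (cut J g) x) (fun a b => TT_add_left s a b _ x)) (fun j => lpp j f) (Finset.range (J + 1))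
  refine h1.trans (Finset.sum_congr rfl fun j _ => ?_)
  exact map_sum (AddMonoidHom.mk' (fun u : Sw n => TT s (lpp j f) u x) (fun a b => TT_add_right s _ a b x)) (fun k => lpp k g) (Finset.range (J + 1))

lemma RR_cut (s : ℝ) (f g : Sw n) (J : ℕ) (x : Eu n) :
    ∑ j ∈ Finset.range (J + 1), ∑ k ∈ Finset.range (J + 1), RR s j k f g x =
      TT s (cut J f) (cut J g) x - (mu (br s) (cut J f) x - mu (br s) (lpp 0 f) x) * cut J g x := by
  unfold RR
  simp_rw [Finset.sum_sub_distrib]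
  rw [← TT_cut]
  congr 1
  have e1 : mu (br s) (cut J f) x - mu (br s) (lpp 0 f) x = ∑ j ∈ Finset.range (J + 1), if 1 ≤ j then mu (br s) (lpp j f) x else 0 := by
    unfold cut
    rw [mu_sum, SchwartzMap.sum_apply, Finset.sum_range_succ', Finset.sum_range_succ']
    simp
  have e2 : cut J g x = ∑ k ∈ Finset.range (J + 1), lpp k g x := by unfold cut; rw [SchwartzMap.sum_apply]
  rw [e1, e2, Finset.sum_mul_sum]
  refine Finset.sum_congr rfl fun j _ => Finset.sum_congr rfl fun k _ => ?_
  split_ifs <;> simp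

lemma RR_lim (s : ℝ) (f g : Sw n) (x : Eu n) :
    Filter.Tendsto (fun J => ∑ j ∈ Finset.range (J + 1), ∑ k ∈ Finset.range (J + 1), RR s j k f g x) Filter.atTop
      (nhds (TT s f g x - (mu (br s) f x - mu (br s) (lpp 0 f) x) * g x)) := by
  simp_rw [RR_cut]
  exact (TT_lim s f g x).sub (((cut_mu_lim (br_tg s) f x).sub_const _).mul (cut_lim g x))

lemma ZBound (n : ℕ) {p p₁ p₂ : ℝ≥0∞} (hp0 : p ≠ 0) (hp1 : 1 ≤ p₁) (hpp : 1 / p = 1 / p₁ + 1 / p₂) {b₁ b₂ : ℝ}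
    (hb₁ : 0 ≤ b₁) (s : ℝ) :
    ∃ K > 0, ∀ (f g : Sw n), nm p (b₁ + b₂) (fun x => (mu (br s) f x - mu (br s) (lpp 0 f) x) * g x) ≤
        ENNReal.ofReal K * (nm p₁ b₁ (mu (br s) f) * nm p₂ b₂ g) := by
  obtain ⟨β₁, hβ₁⟩ := exists_nat_ge b₁
  obtain ⟨c1, hc1, G0⟩ := GG n (le_refl (n + 1 + β₁)) hp1 hb₁ hβ₁ 0
  refine ⟨2 ^ (1 / qq p) * (c1 + 1), by positivity, fun f g => ?_⟩
  have e : mu (br s) (lpp 0 f) = lpp 0 (mu (br s) f) := by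
    unfold lpp; exact mu_comm' (br_tg s) (thin_ccs 0).tg f
  rw [e]
  set u := mu (br s) f
  obtain ⟨G, v1, v2, v3, v4⟩ := G0 0 u
  rw [mu_br_zero, neg_zero, Real.rpow_zero, mul_one] at v4
  have hu := u.continuous
  have hg := g.continuous
  have hl := (lpp 0 u).continuous
  have h1 : nm p (b₁ + b₂) (fun x => u x * g x) ≤ ENNReal.ofReal (c1 + 1) * (nm p₁ b₁ u * nm p₂ b₂ g) := by
    have a1 := nm_holder hpp b₁ b₂ hu.norm hg.norm
    rw [nm_norm, nm_norm] at a1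
    have a2 := nm_mono (C := c1 + 1) p (b₁ + b₂) (u := fun x => u x * g x) (v := fun x => ‖u x‖ * ‖g x‖) (fun x => by
      rw [norm_mul, norm_mul, norm_norm, norm_norm]
      exact le_mul_of_one_le_left (by positivity) (by linarith))
    exact a2.trans (mul_le_mul_right a1 _)
  have h2 : nm p (b₁ + b₂) (fun x => -(lpp 0 u x * g x)) ≤ ENNReal.ofReal (c1 + 1) * (nm p₁ b₁ u * nm p₂ b₂ g) := by
    have a1 := nm_holder hpp b₁ b₂ v1.1 hg.norm
    rw [nm_norm] at a1
    have a2 := nm_mono (C := 1) p (b₁ + b₂) (u := fun x => -(lpp 0 u x * g x)) (v := fun x => G x * ‖g x‖) (fun x => by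
      rw [norm_neg, norm_mul, norm_mul, norm_norm, one_mul, Real.norm_of_nonneg (v1.2.1 x)]
      gcongr; exact v3 x)
    rw [ENNReal.ofReal_one, one_mul] at a2
    refine a2.trans (a1.trans ?_)
    rw [← mul_assoc]
    gcongr
    refine v4.trans ?_
    gcongr
    linarith
  have := nm_add_le hp0 (b₁ + b₂) (u := fun x => u x * g x) (v := fun x => -(lpp 0 u x * g x)) (by fun_prop) (by fun_prop) h1 h2
  rw [ENNReal.ofReal_mul (by positivity), mul_assoc]
  convert this using 3
  ring

lemma TTB (n : ℕ) {p p₁ p₂ : ℝ≥0∞} (hp : 2⁻¹ ≤ p) (hp1 : 1 ≤ p₁) (hp2 : 1 ≤ p₂) (hpp : 1 / p = 1 / p₁ + 1 / p₂) {b₁ b₂ : ℝ}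
    (hb₁ : 0 ≤ b₁) (hb₂ : 0 ≤ b₂) (s : ℝ) (h1s : 1 < s) (hs : dl n p < s ∨ ∃ m : ℕ, s = 2 * m) :
    ∃ K > 0, ∀ (f g : Sw n), nm p (b₁ + b₂) (TT s f g) ≤
        ENNReal.ofReal K * (nm p₁ b₁ (mu (br s) f) * nm p₂ b₂ g + nm p₁ b₁ (gradNorm ⇑f) * nm p₂ b₂ (mu (br (s - 1)) g)) := by
  have hp0 : p ≠ 0 := fun h => by simp [h] at hp
  obtain ⟨K1, hK1, P⟩ := PSUM n hp hp1 hp2 hpp hb₁ hb₂ s h1s hs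
  obtain ⟨K2, hK2, Z⟩ := ZBound n hp0 hp1 hpp (b₂ := b₂) hb₁ s
  refine ⟨2 ^ (1 / qq p) * (K1 + K2), by positivity, fun f g => ?_⟩
  set M := nm p₁ b₁ (mu (br s) f) * nm p₂ b₂ g + nm p₁ b₁ (gradNorm ⇑f) * nm p₂ b₂ (mu (br (s - 1)) g)
  have h1 : nm p (b₁ + b₂) (fun x => TT s f g x - (mu (br s) f x - mu (br s) (lpp 0 f) x) * g x) ≤ ENNReal.ofReal (K1 + K2) * M := by
    refine (nm_fatou p (b₁ + b₂) (fun J => ?_) (fun x => RR_lim s f g x) (fun J => P f g (J + 1))).trans ?_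
    · exact continuous_finsetSum _ fun j _ => continuous_finsetSum _ fun k _ => RR_cont s j k f g
    · gcongr; linarith
  have h2 : nm p (b₁ + b₂) (fun x => (mu (br s) f x - mu (br s) (lpp 0 f) x) * g x) ≤ ENNReal.ofReal (K1 + K2) * M := by
    refine (Z f g).trans ?_
    gcongr
    · linarith
    · exact le_self_add
  have c1 := (mu (br s) f).continuous
  have c2 := (mu (br s) (lpp 0 f)).continuous
  have c3 := g.continuous
  have c4 := TT_cont s f g
  have := nm_add_le hp0 (b₁ + b₂) (by fun_prop) (by fun_prop) h1 h2
  rw [ENNReal.ofReal_mul (by positivity), mul_assoc]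
  simpa using this

end KP

/-- **The weighted Kato–Ponce commutator estimate for `s > 1`, with second-order
correction term** (Theorem 1.2, second inequality). -/
theorem weighted_kato_ponce_commutator_high (n : ℕ) (hn : 1 ≤ n) (p p₁ p₂ : ℝ≥0∞)
    (a a₁ a₂ s : ℝ)
    (hp : 2⁻¹ ≤ p) (hp1 : 1 ≤ p₁) (hp2 : 1 ≤ p₂)
    (ha : 0 ≤ a) (ha1 : 0 ≤ a₁) (ha2 : 0 ≤ a₂)
    (hexp : 1 / p = 1 / p₁ + 1 / p₂)
    (hwexp : ENNReal.ofReal a / p = ENNReal.ofReal a₁ / p₁ + ENNReal.ofReal a₂ / p₂)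
    (hs : max 1 ((n : ℝ) * (1 / p.toReal - 1)) < s ∨ ∃ m : ℕ, s = 2 * m) :
    ∃ C : ℝ, 0 < C ∧ ∀ f g : SchwartzMap (Eu n) ℂ,
      wNorm p a (fun x => Js s (fun y => f y * g y) x - f x * Js s ⇑g x +
          (s : ℂ) * gradDot ⇑f (Js (s - 2) ⇑g) x) ≤
        ENNReal.ofReal C *
          (wNorm p₁ a₁ (Js s ⇑f) * wNorm p₂ a₂ ⇑g +
            wNorm p₁ a₁ (gradNorm ⇑f) * wNorm p₂ a₂ (Js (s - 1) ⇑g)) := by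
  have hp0 : p ≠ 0 := fun h => by simp [h] at hp
  have hp10 : p₁ ≠ 0 := (zero_lt_one.trans_le hp1).ne'
  have hp20 : p₂ ≠ 0 := (zero_lt_one.trans_le hp2).ne'
  have hb : a / p.toReal = a₁ / p₁.toReal + a₂ / p₂.toReal := by
    have := congrArg ENNReal.toReal hwexp
    rwa [ENNReal.toReal_add (ENNReal.div_ne_top ENNReal.ofReal_ne_top hp10) (ENNReal.div_ne_top ENNReal.ofReal_ne_top hp20),
      ENNReal.toReal_div, ENNReal.toReal_div, ENNReal.toReal_div, ENNReal.toReal_ofReal ha, ENNReal.toReal_ofReal ha1,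
      ENNReal.toReal_ofReal ha2] at this
  have eJ : ∀ (t : ℝ) (u : Sw n), Js t ⇑u = ⇑(mu (br t) u) := fun t u => funext fun x => Js_eq t u x
  have eT : ∀ f g : Sw n, (fun x => Js s (fun y => f y * g y) x - f x * Js s ⇑g x +
          (s : ℂ) * gradDot ⇑f (Js (s - 2) ⇑g) x) = TT s f g := by
    intro f g
    funext x
    rw [Js_mul_eq, eJ, eJ]
    simp only [TT, gradDot, D_apply]
  have key : ∃ C : ℝ, 0 < C ∧ ∀ f g : Sw n, nm p (a₁ / p₁.toReal + a₂ / p₂.toReal) (TT s f g) ≤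
      ENNReal.ofReal C * (nm p₁ (a₁ / p₁.toReal) (mu (br s) f) * nm p₂ (a₂ / p₂.toReal) g +
        nm p₁ (a₁ / p₁.toReal) (gradNorm ⇑f) * nm p₂ (a₂ / p₂.toReal) (mu (br (s - 1)) g)) := by
    by_cases h0 : s = 0
    · refine ⟨1, one_pos, fun f g => ?_⟩
      have : TT s f g = fun _ => 0 := by
        funext x
        simp only [TT, h0, mu_br_zero, mulS_apply']
        simp
      rw [this]
      simp [nm]
    · have h1s : 1 < s := by
        rcases hs with h | ⟨m, hm⟩
        · exact (le_max_left _ _).trans_lt h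
        · have : m ≠ 0 := by rintro rfl; simp [hm] at h0
          have : (1:ℝ) ≤ m := by exact_mod_cast Nat.one_le_iff_ne_zero.2 this
          linarith
      have hs' : dl n p < s ∨ ∃ m : ℕ, s = 2 * m := by
        rcases hs with h | h
        · left
          unfold dl
          split_ifs
          · exact (le_max_right _ _).trans_lt h
          · linarith
        · exact Or.inr h
      exact TTB n hp hp1 hp2 hexp (by positivity) (by positivity) s h1s hs'
  obtain ⟨C, hC, h⟩ := key
  refine ⟨C, hC, fun f g => ?_⟩
  rw [eT, wNorm_eq hp0, wNorm_eq hp10, wNorm_eq hp10, wNorm_eq hp20, wNorm_eq hp20, hb, eJ, eJ]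
  exact h f g
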